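/- arXiv:2210.09635 — 3 statements merged into one kernel-verified Lean document; each statement's English description precedes it below -/
import Mathlib

section
/- For every integer n ≥ 5, there exists an element s of the alternating group A_n (the alternating group on Fin n) such that for every nontrivial x ∈ A_n there exists g ∈ A_n with ⟨x, g⁻¹sg⟩ = A_n. In particular, every nontrivial element of A_n is contained in a generating pair. -/
open Equiv Equiv.Perm MulAction

theorem jp_trans {α : Type*} [Fintype α] [DecidableEq α] {G : Subgroup (Perm α)}
    (hG : IsPreprimitive G α) {p : ℕ} (hp : p.Prime) (hp' : p + 3 ≤ Nat.card α)
    {σ : Perm α} (hc : σ.IsCycle) (hcard : σ.support.card = p) (hσ : σ ∈ G)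
    (t : Perm α) : ∃ h ∈ G, ∀ x ∉ σ.support, h x = t x := by
  classical
  obtain ⟨n, hn⟩ := Nat.exists_eq_add_of_le' hp'
  have h1 : IsMultiplyPreprimitive G α (n + 2 + 2) := by
    apply hG.isMultiplyPreprimitive (s := (σ.supportᶜ : Set α))
    · apply Nat.add_left_cancel
      rw [Set.ncard_add_ncard_compl, Set.ncard_coe_finset, hcard, hn]
      omega
    · have := hp.two_le
      omega
    have := isPretransitive_of_isCycle_mem hc hσ
    apply IsPreprimitive.of_prime_card
    convert! hp
    rw [Nat.card_eq_fintype_card, Fintype.card_subtype, ← hcard]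
    apply congr_arg
    ext x
    simp [SubMulAction.mem_ofFixingSubgroup_iff]
  have h2 : IsMultiplyPretransitive G α (n + 2 + 2) :=
    IsMultiplyPreprimitive.isMultiplyPretransitive ..
  have h3 : IsMultiplyPretransitive G α (n + 3) := by
    apply isMultiplyPretransitive_of_le (n := n + 2 + 2) (by omega)
    have := hp.two_le
    omega
  have hcc : (σ.supportᶜ).card = n + 3 := by
    rw [Finset.card_compl, hcard, ← Nat.card_eq_fintype_card, hn]; omega
  let e := (Finset.equivFinOfCardEq hcc).symm
  let x : Fin (n + 3) ↪ α := ⟨fun i => (e i : α), fun i j h => e.injective (Subtype.ext h)⟩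
  obtain ⟨g, hg⟩ := exists_smul_eq G x (t • x)
  refine ⟨g, g.2, fun y hy => ?_⟩
  have hy' : y ∈ σ.supportᶜ := by simpa using hy
  have hx : x (e.symm ⟨y, hy'⟩) = y := congrArg Subtype.val (e.apply_symm_apply ⟨y, hy'⟩)
  have := congrArg (fun f : Fin (n + 3) ↪ α => f (e.symm ⟨y, hy'⟩)) hg
  simpa [hx, Subgroup.smul_def] using this

theorem jp_norm {α : Type*} [Fintype α] [DecidableEq α] {G : Subgroup (Perm α)}
    {p : ℕ} (hp : p.Prime)
    {σ : Perm α} (hc : σ.IsCycle) (hcard : σ.support.card = p) (hσ : σ ∈ G)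
    {h : Perm α} (hh : h ∈ G) (hs : ∀ x ∉ σ.support, h x ∉ σ.support) :
    ∃ h' ∈ G, (∀ x ∉ σ.support, h' x = h x) ∧ h' * σ * h'⁻¹ ∈ Subgroup.zpowers σ := by
  have : Fact p.Prime := ⟨hp⟩
  let R : Subgroup (Perm α) := (ofSubtype : Perm {x // x ∈ σ.support} →* Perm α).range
  have hR : ∀ g, g ∈ R ↔ ∀ x ∉ σ.support, g x = x := by
    intro g
    rw [mem_range_ofSubtype_iff]
    constructor
    · intro H x hx
      by_contra hne
      exact hx (H (by simpa using hne))
    · intro H x hx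
      by_contra hne
      have := H x hne
      simp at hx
      exact hx this
  have hRc : Nat.card R ∣ p.factorial := by
    have h1 := Subgroup.card_range_dvd (ofSubtype : Perm {x // x ∈ σ.support} →* Perm α)
    rwa [Nat.card_perm, Nat.card_eq_fintype_card (α := {x // x ∈ σ.support}), Fintype.card_coe,
      hcard] at h1
  let K := G ⊓ R
  have hKc : Nat.card K ∣ p.factorial :=
    (Subgroup.card_dvd_of_le (inf_le_right : K ≤ R)).trans hRc
  have hord : orderOf σ = p := by rw [hc.orderOf, hcard]
  have hσK : σ ∈ K := ⟨hσ, (hR σ).2 fun x hx => by simpa using hx⟩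
  have hs' : ∀ x ∉ σ.support, h⁻¹ x ∉ σ.support := by
    intro x hx
    have hmaps : Set.MapsTo h (σ.supportᶜ : Finset α) (σ.supportᶜ : Finset α) := by
      intro y hy
      simpa using hs y (by simpa using hy)
    have hsurj := (Set.Finite.surjOn_iff_bijOn_of_mapsTo (Finset.finite_toSet _) hmaps)
    have hinj : Set.InjOn h (σ.supportᶜ : Finset α) := h.injective.injOn
    have hb : Set.BijOn h (σ.supportᶜ : Finset α) (σ.supportᶜ : Finset α) :=
      (Set.Finite.injOn_iff_bijOn_of_mapsTo (Finset.finite_toSet _) hmaps).1 hinj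
    obtain ⟨y, hy, rfl⟩ := hb.surjOn (by simpa using hx : x ∈ ((σ.supportᶜ : Finset α) : Set α))
    simpa using hy
  have hσ'K : h * σ * h⁻¹ ∈ K := by
    refine ⟨G.mul_mem (G.mul_mem hh hσ) (G.inv_mem hh), (hR _).2 fun x hx => ?_⟩
    have := hs' x hx
    rw [notMem_support] at this
    simp only [coe_mul, Function.comp_apply, this]
    simp
  let a : K := ⟨σ, hσK⟩
  let b : K := ⟨h * σ * h⁻¹, hσ'K⟩
  have ha : orderOf a = p := by rw [← hord]; exact Subgroup.orderOf_mk _ _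
  have hb : orderOf b = p := by
    rw [← hord]
    have : orderOf b = orderOf (h * σ * h⁻¹) := Subgroup.orderOf_mk _ _
    rw [this]
    exact (MulAut.conj h).orderOf_eq σ
  have hpa : IsPGroup p (Subgroup.zpowers a) :=
    IsPGroup.of_card (n := 1) (by rw [Nat.card_zpowers, ha, pow_one])
  have hpb : IsPGroup p (Subgroup.zpowers b) :=
    IsPGroup.of_card (n := 1) (by rw [Nat.card_zpowers, hb, pow_one])
  obtain ⟨Qa, hQa⟩ := hpa.exists_le_sylow
  obtain ⟨Qb, hQb⟩ := hpb.exists_le_sylow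
  have hQ : Nat.card Qa ≤ p := by
    rw [Qa.card_eq_multiplicity]
    have h1 : (Nat.card K).factorization p ≤ (p.factorial).factorization p :=
      (Nat.factorization_le_iff_dvd Nat.card_pos.ne' p.factorial_ne_zero).2 hKc p
    have h2 : (p.factorial).factorization p = 1 := by
      rw [← Nat.mul_factorial_pred hp.ne_zero, Nat.factorization_mul hp.ne_zero (Nat.factorial_ne_zero _)]
      simp only [Finsupp.add_apply, hp.factorization_self]
      rw [Nat.factorization_eq_zero_of_not_dvd]
      rw [hp.dvd_factorial]
      have := hp.pos
      omega
    calc p ^ _ ≤ p ^ 1 := Nat.pow_le_pow_right hp.pos (h1.trans h2.le)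
      _ = p := pow_one p
  have hQeq : Subgroup.zpowers a = Qa := by
    apply Subgroup.eq_of_le_of_card_ge hQa
    rw [Nat.card_zpowers, ha]
    exact hQ
  obtain ⟨k, hk⟩ := exists_smul_eq K Qb Qa
  have hmem : k * b * k⁻¹ ∈ Subgroup.zpowers a := by
    rw [hQeq, ← hk]
    have : b ∈ (Qb : Subgroup K) := hQb (Subgroup.mem_zpowers b)
    exact Subgroup.smul_mem_pointwise_smul b (MulAut.conj k) _ this
  refine ⟨k * h, G.mul_mem k.2.1 hh, fun x hx => ?_, ?_⟩
  · exact (hR _).1 k.2.2 _ (hs x hx)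
  · obtain ⟨i, hi⟩ := hmem
    refine ⟨i, ?_⟩
    have := congrArg (Subtype.val) hi
    simp [a, b] at this
    simp only [this]
    group

theorem jordan_prime {α : Type*} [Fintype α] [DecidableEq α] {G : Subgroup (Perm α)}
    (hG : IsPreprimitive G α) {p : ℕ} (hp : p.Prime) (hp' : p + 3 ≤ Nat.card α)
    {σ : Perm α} (hc : σ.IsCycle) (hcard : σ.support.card = p) (hσ : σ ∈ G) :
    alternatingGroup α ≤ G := by
  have hcc : 2 < (σ.supportᶜ).card := by
    rw [Finset.card_compl, hcard, ← Nat.card_eq_fintype_card]; omega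
  obtain ⟨a, b, c, ha, hb, hcm, hab, hac, hbc⟩ := Finset.two_lt_card_iff.1 hcc
  rw [Finset.mem_compl] at ha hb hcm
  have key : ∀ u v : α, u ∉ σ.support → v ∉ σ.support →
      ∃ h ∈ G, (∀ x ∉ σ.support, h x = swap u v x) ∧ h * σ * h⁻¹ ∈ Subgroup.zpowers σ := by
    intro u v hu hv
    obtain ⟨h, hh, H⟩ := jp_trans hG hp hp' hc hcard hσ (swap u v)
    obtain ⟨h', hh', H', H''⟩ := jp_norm hp hc hcard hσ hh (by
      intro x hx
      rw [H x hx, swap_apply_def]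
      split_ifs <;> assumption)
    exact ⟨h', hh', fun x hx => (H' x hx).trans (H x hx), H''⟩
  have hsw : ∀ u v : α, u ∉ σ.support → v ∉ σ.support → ∀ x ∉ σ.support,
      swap u v x ∉ σ.support := by
    intro u v hu hv x hx
    rw [swap_apply_def]
    split_ifs <;> assumption
  obtain ⟨h1, hh1, H1, i, hi⟩ := key a b ha hb
  obtain ⟨h2, hh2, H2, j, hj⟩ := key a c ha hcm
  simp only at hi hj
  have e1 : (h1 * h2) * σ * (h1 * h2)⁻¹ = σ ^ (i * j) := by
    have : (h1 * h2) * σ * (h1 * h2)⁻¹ = h1 * (h2 * σ * h2⁻¹) * h1⁻¹ := by group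
    rw [this, ← hj, ← conj_zpow, ← hi, zpow_mul]
  have e2 : (h2 * h1) * σ * (h2 * h1)⁻¹ = σ ^ (i * j) := by
    have : (h2 * h1) * σ * (h2 * h1)⁻¹ = h2 * (h1 * σ * h1⁻¹) * h2⁻¹ := by group
    rw [this, ← hi, ← conj_zpow, ← hj, mul_comm, zpow_mul]
  set w := (h2 * h1)⁻¹ * (h1 * h2) with hw
  have hwG : w ∈ G := G.mul_mem (G.inv_mem (G.mul_mem hh2 hh1)) (G.mul_mem hh1 hh2)
  have hcomm : Commute w σ := by
    have : w * σ * w⁻¹ = σ := by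
      have : w * σ * w⁻¹ = (h2 * h1)⁻¹ * ((h1 * h2) * σ * (h1 * h2)⁻¹) * (h2 * h1) := by
        rw [hw]; group
      rw [this, e1, ← e2]; group
    rw [mul_inv_eq_iff_eq_mul] at this
    exact this
  set t := swap a b * swap a c with ht
  have ht3 : IsThreeCycle t := isThreeCycle_swap_mul_swap_same hab hac hbc
  have hwx : ∀ x ∉ σ.support, w x = (t * t) x := by
    intro x hx
    have hA := hsw a c ha hcm x hx
    have hB := hsw a b ha hb _ hA
    have hC := hsw a c ha hcm _ hB
    have hD := hsw a b ha hb _ hC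
    rw [hw, Perm.mul_apply, Perm.inv_eq_iff_eq]
    simp only [ht, Perm.mul_apply]
    rw [H2 x hx, H1 _ hA, H1 _ hD, H2 _ (hsw a b ha hb _ hD)]
    simp
  obtain ⟨a0, ha0, -⟩ := id hc
  have hwa0 : σ (w a0) ≠ w a0 := by
    intro h
    apply ha0
    apply w.injective
    rw [← Perm.mul_apply, hcomm.eq, Perm.mul_apply, h]
  obtain ⟨m, hm⟩ := hc.sameCycle ha0 hwa0
  have hwm : ∀ x ∈ σ.support, w x = (σ ^ m) x := by
    intro x hx
    obtain ⟨l, rfl⟩ := hc.sameCycle ha0 (mem_support.1 hx)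
    rw [← Perm.mul_apply, (hcomm.zpow_right l).eq, Perm.mul_apply, ← hm, ← Perm.mul_apply,
      ← Perm.mul_apply, ← zpow_add, ← zpow_add, add_comm]
  have hfin : w * (σ ^ m)⁻¹ = t * t := by
    ext x
    by_cases hx : x ∈ σ.support
    · have h1 : (σ ^ m)⁻¹ x ∈ σ.support := by
        rw [← zpow_neg]
        exact (zpow_apply_mem_support).2 hx
      rw [Perm.mul_apply, hwm _ h1, ← Perm.mul_apply, mul_inv_cancel]
      have hxa : x ≠ a := fun h => ha (h ▸ hx)
      have hxb : x ≠ b := fun h => hb (h ▸ hx)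
      have hxc : x ≠ c := fun h => hcm (h ▸ hx)
      simp [swap_apply_of_ne_of_ne, *]
    · have h1 : (σ ^ m)⁻¹ x = x := by
        rw [Perm.inv_eq_iff_eq]
        have := notMem_support.1 hx
        exact (zpow_apply_eq_self_of_apply_eq_self this m).symm
      rw [Perm.mul_apply, h1, hwx x hx]
  refine alternatingGroup_le_of_isPreprimitive_of_isThreeCycle_mem hG
    (g := t * t) ht3.isThreeCycle_sq ?_
  rw [← hfin]
  exact G.mul_mem hwG (G.inv_mem (G.zpow_mem hσ m))

/-- `x` and `y` lie in the same orbit of `G`. -/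
def Conn {α : Type*} (G : Subgroup (Perm α)) (x y : α) : Prop := ∃ g ∈ G, g x = y

theorem Conn.rfl' {α : Type*} {G : Subgroup (Perm α)} (x : α) : Conn G x x :=
  ⟨1, G.one_mem, by simp⟩

theorem Conn.symm' {α : Type*} {G : Subgroup (Perm α)} {x y : α} (h : Conn G x y) :
    Conn G y x := by
  obtain ⟨g, hg, rfl⟩ := h
  exact ⟨g⁻¹, G.inv_mem hg, by simp⟩

theorem Conn.trans' {α : Type*} {G : Subgroup (Perm α)} {x y z : α} (h : Conn G x y)
    (h' : Conn G y z) : Conn G x z := by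
  obtain ⟨g, hg, rfl⟩ := h
  obtain ⟨k, hk, rfl⟩ := h'
  exact ⟨k * g, G.mul_mem hk hg, by simp⟩

theorem Conn.of_cycleOn {α : Type*} {G : Subgroup (Perm α)} {σ : Perm α} (hσ : σ ∈ G)
    {P : Finset α} (hP : σ.IsCycleOn (P : Set α)) {x y : α} (hx : x ∈ P) (hy : y ∈ P) :
    Conn G x y := by
  obtain ⟨i, hi⟩ := hP.2 (Finset.mem_coe.2 hx) (Finset.mem_coe.2 hy)
  exact ⟨σ ^ i, G.zpow_mem hσ i, hi⟩

theorem pretransitive_of_conn {α : Type*} {G : Subgroup (Perm α)} (a : α)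
    (h : ∀ x, Conn G a x) : IsPretransitive G α := by
  refine ⟨fun x y => ?_⟩
  obtain ⟨g, hg, e⟩ := (h x).symm'.trans' (h y)
  exact ⟨⟨g, hg⟩, e⟩

open scoped Pointwise in
theorem block_pow {α : Type*} {G : Subgroup (Perm α)} {B : Set α} (hB : IsBlock G B)
    {g : Perm α} (hg : g ∈ G) {a : α} (ha : a ∈ B) (hga : g a ∈ B) {x : α} (hx : x ∈ B) (i : ℤ) :
    (g ^ i) x ∈ B := by
  have h1 : (⟨g, hg⟩ : G) • B = B := hB.smul_eq_of_mem ha hga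
  have h2 : (⟨g, hg⟩ : G) ^ i ∈ stabilizer G B := Subgroup.zpow_mem _ h1 i
  have h3 : (⟨g, hg⟩ : G) ^ i • B = B := h2
  rw [← h3]
  exact ⟨x, hx, rfl⟩

theorem block_mixed {α : Type*} {G : Subgroup (Perm α)} {B : Set α} (hB : IsBlock G B)
    {σ : Perm α} (hσ : σ ∈ G) {P : Finset α} (hP : σ.IsCycleOn (P : Set α))
    (hfix : ∀ x ∉ P, σ x = x) {a b : α} (ha : a ∈ B) (haP : a ∈ P) (hb : b ∈ B) (hbP : b ∉ P) :
    (P : Set α) ⊆ B := by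
  intro x hx
  obtain ⟨i, rfl⟩ := hP.2 (Finset.mem_coe.2 haP) hx
  exact block_pow hB hσ hb (by rwa [hfix b hbP]) ha i

theorem block_prime {α : Type*} {G : Subgroup (Perm α)} {B : Set α} (hB : IsBlock G B)
    {σ : Perm α} (hσ : σ ∈ G) {P : Finset α} (hP : σ.IsCycleOn (P : Set α))
    (hp : P.card.Prime) {a b : α} (ha : a ∈ B) (haP : a ∈ P) (hb : b ∈ B)
    (hbP : b ∈ P) (hab : a ≠ b) : (P : Set α) ⊆ B := by
  intro x hx
  obtain ⟨i, rfl⟩ := hP.2 (Finset.mem_coe.2 haP) (Finset.mem_coe.2 hbP)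
  obtain ⟨j, rfl⟩ := hP.2 (Finset.mem_coe.2 haP) hx
  have hni : ¬ (P.card : ℤ) ∣ i := fun h => hab ((hP.zpow_apply_eq haP).2 h).symm
  have hco : IsCoprime (P.card : ℤ) i :=
    (Nat.prime_iff_prime_int.1 hp).coprime_iff_not_dvd.2 hni
  obtain ⟨u, v, huv⟩ := hco
  have h1 := block_pow hB (G.zpow_mem hσ i) ha hb ha (v * j)
  rw [← zpow_mul] at h1
  have h2 : (σ ^ (i * (v * j))) a = (σ ^ j) a := by
    rw [hP.zpow_apply_eq_zpow_apply haP]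
    apply Int.modEq_of_dvd
    refine ⟨u * j, ?_⟩
    linear_combination (-j) * huv
  rwa [h2] at h1

/-- Primitivity: two coprime cycles covering everything. -/
theorem prim_even {α : Type*} [Fintype α] [DecidableEq α] {G : Subgroup (Perm α)}
    [IsPretransitive G α] {σ τ : Perm α} (hσ : σ ∈ G) (hτ : τ ∈ G) {P Q : Finset α}
    (hP : σ.IsCycleOn (P : Set α)) (hPf : ∀ x ∉ P, σ x = x)
    (hQ : τ.IsCycleOn (Q : Set α)) (hQf : ∀ x ∉ Q, τ x = x)
    (hp : P.card.Prime) (hpn : ¬ P.card ∣ Nat.card α) (hdis : Disjoint P Q)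
    (hcov : ∀ x, x ∈ P ∨ x ∈ Q) : IsPreprimitive G α := by
  obtain ⟨a, haP⟩ := Finset.card_pos.1 hp.pos
  refine IsPreprimitive.of_isTrivialBlock_base a fun {B} ha hB => ?_
  by_cases hs : B.Subsingleton
  · exact Or.inl hs
  right
  obtain ⟨b, hb, hba⟩ := (Set.not_subsingleton_iff.1 hs).exists_ne a
  have hPB : (P : Set α) ⊆ B := by
    by_cases hbP : b ∈ P
    · exact block_prime hB hσ hP hp ha haP hb hbP hba.symm
    · exact block_mixed hB hσ hP hPf ha haP hb hbP
  have hne : B ≠ (P : Set α) := by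
    rintro rfl
    have := hB.ncard_dvd_card ⟨a, ha⟩
    rw [Set.ncard_coe_finset] at this
    exact hpn this
  obtain ⟨c, hc, hcP⟩ : ∃ c ∈ B, c ∉ P := by
    by_contra! h
    exact hne (Set.Subset.antisymm h hPB)
  have hcQ := (hcov c).resolve_left hcP
  have hQB := block_mixed hB hτ hQ hQf hc hcQ ha (Finset.disjoint_left.1 hdis haP)
  exact Set.eq_univ_of_forall fun x => (hcov x).elim (fun h => hPB h) (fun h => hQB h)

/-- Primitivity: two odd cycles covering everything except one point. -/
theorem prim_odd {α : Type*} [Fintype α] [DecidableEq α] {G : Subgroup (Perm α)}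
    [IsPretransitive G α] {σ τ : Perm α} (hσ : σ ∈ G) (hτ : τ ∈ G) {P Q : Finset α}
    (hP : σ.IsCycleOn (P : Set α)) (hPf : ∀ x ∉ P, σ x = x)
    (hQ : τ.IsCycleOn (Q : Set α)) (hQf : ∀ x ∉ Q, τ x = x)
    (hp : Odd P.card) (hq : Odd Q.card) (hn : Odd (Nat.card α))
    {f : α} (hfP : f ∉ P) (hfQ : f ∉ Q)
    (hcov : ∀ x, x ∈ P ∨ x ∈ Q ∨ x = f) : IsPreprimitive G α := by
  refine IsPreprimitive.of_isTrivialBlock_base f fun {B} hf hB => ?_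
  by_cases hs : B.Subsingleton
  · exact Or.inl hs
  right
  have key : ∀ R : Finset α, Odd R.card → f ∉ R → B ≠ ((insert f R : Finset α) : Set α) := by
    rintro R hR hfR rfl
    have := hB.ncard_dvd_card ⟨f, hf⟩
    rw [Set.ncard_coe_finset, Finset.card_insert_of_notMem hfR] at this
    have h2 : 2 ∣ R.card + 1 := by obtain ⟨k, hk⟩ := hR; omega
    have h3 := h2.trans this
    obtain ⟨k, hk⟩ := hn
    omega
  have hP1 : ∀ x ∈ B, x ∈ P → (P : Set α) ⊆ B := fun x hx hxP =>
    block_mixed hB hσ hP hPf hx hxP hf hfP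
  have hQ1 : ∀ x ∈ B, x ∈ Q → (Q : Set α) ⊆ B := fun x hx hxQ =>
    block_mixed hB hτ hQ hQf hx hxQ hf hfQ
  obtain ⟨b, hb, hbf⟩ := (Set.not_subsingleton_iff.1 hs).exists_ne f
  have hPB : (P : Set α) ⊆ B := by
    by_contra hcon
    have hno : ∀ x ∈ B, x ∉ P := fun x hx hxP => hcon (hP1 x hx hxP)
    have hQB := hQ1 b hb (((hcov b).resolve_left (hno b hb)).resolve_right hbf)
    apply key Q hq hfQ
    ext x
    simp only [Finset.coe_insert, Set.mem_insert_iff, Finset.mem_coe]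
    constructor
    · intro hx
      have := hcov x
      have := hno x hx
      tauto
    · rintro (rfl | h)
      · exact hf
      · exact hQB h
  have hQB : (Q : Set α) ⊆ B := by
    by_contra hcon
    have hno : ∀ x ∈ B, x ∉ Q := fun x hx hxP => hcon (hQ1 x hx hxP)
    apply key P hp hfP
    ext x
    simp only [Finset.coe_insert, Set.mem_insert_iff, Finset.mem_coe]
    constructor
    · intro hx
      have := hcov x
      have := hno x hx
      tauto
    · rintro (rfl | h)
      · exact hf
      · exact hPB h
  refine Set.eq_univ_of_forall fun x => ?_
  rcases hcov x with h | h | rfl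
  · exact hPB h
  · exact hQB h
  · exact hf

theorem cycleOn_pow_card {α : Type*} [DecidableEq α] {σ : Perm α} {P : Finset α}
    (hP : σ.IsCycleOn (P : Set α)) (hPf : ∀ x ∉ P, σ x = x) : σ ^ P.card = 1 := by
  ext x
  by_cases hx : x ∈ P
  · simpa using hP.pow_card_apply hx
  · simpa using pow_apply_eq_self_of_apply_eq_self (hPf x hx) _

theorem mem_of_mul_mem {Γ : Type*} [Group Γ] {G : Subgroup Γ} {σ τ : Γ} (hc : Commute σ τ)
    {p q : ℕ} (hp : σ ^ p = 1) (hq : τ ^ q = 1) (hpq : p.Coprime q) (h : σ * τ ∈ G) :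
    σ ∈ G := by
  obtain ⟨u, v, huv⟩ := Nat.isCoprime_iff_coprime.2 hpq
  have : (σ * τ) ^ ((q : ℤ) * v) = σ := by
    rw [hc.mul_zpow, zpow_mul τ, zpow_natCast, hq, one_zpow, mul_one]
    have e : (q : ℤ) * v = 1 - p * u := by linear_combination huv
    rw [e, zpow_sub, zpow_one, zpow_mul, zpow_natCast, hp, one_zpow, inv_one, mul_one]
  rw [← this]
  exact G.zpow_mem h _

theorem sign_eq_one_of_odd {α : Type*} [Fintype α] [DecidableEq α] {σ : Perm α} {p : ℕ}
    (hp : Odd p) (h : σ ^ p = 1) : sign σ = 1 := by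
  rcases Int.units_eq_one_or (sign σ) with h1 | h1
  · exact h1
  · have := congrArg sign h
    rw [map_pow, h1, hp.neg_one_pow] at this
    simp at this

/-- Putting a nontrivial even permutation in a standard position. -/
theorem exists_conj_form {n : ℕ} (hn : 5 ≤ n) (x : alternatingGroup (Fin n)) (hx : x ≠ 1)
    {a b c d : Fin n} (hab : a ≠ b) (hac : a ≠ c) (had : a ≠ d) (hbc : b ≠ c) (hbd : b ≠ d)
    (hcd : c ≠ d) : ∃ h : alternatingGroup (Fin n), ∃ y : Perm (Fin n),
      ((h * x * h⁻¹ : alternatingGroup (Fin n)) : Perm (Fin n)) = y ∧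
      ((y a = b ∧ y b = c) ∨ (y a = b ∧ y b = a ∧ y c = d ∧ y d = c)) := by
  have e4 : ∀ {u v w z : Fin n}, u ≠ v → u ≠ w → u ≠ z → v ≠ w → v ≠ z → w ≠ z →
      Function.Injective ![u, v, w, z] := by
    intro u v w z h1 h2 h3 h4 h5 h6 i j hij
    fin_cases i <;> fin_cases j <;> simp_all
  have e3 : ∀ {u v w : Fin n}, u ≠ v → u ≠ w → v ≠ w → Function.Injective ![u, v, w] := by
    intro u v w h1 h2 h4 i j hij
    fin_cases i <;> fin_cases j <;> simp_all
  by_cases hinv : ∃ u, (x : Perm (Fin n)) ((x : Perm (Fin n)) u) ≠ u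
  · obtain ⟨u, hu⟩ := hinv
    have h1 : u ≠ (x : Perm (Fin n)) u := by
      intro h
      rw [← h] at hu
      exact hu h.symm
    have h2 : (x : Perm (Fin n)) u ≠ (x : Perm (Fin n)) ((x : Perm (Fin n)) u) :=
      fun h => h1 ((x : Perm (Fin n)).injective h)
    have hT : IsMultiplyPretransitive (alternatingGroup (Fin n)) (Fin n) 3 := by
      have := alternatingGroup.isMultiplyPretransitive (Fin n)
      refine isMultiplyPretransitive_of_le (n := Nat.card (Fin n) - 2) ?_ (Nat.sub_le _ _)
      rw [Nat.card_fin]; omega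
    obtain ⟨h, hh⟩ := exists_smul_eq (alternatingGroup (Fin n))
      (⟨_, e3 h1 hu.symm h2⟩ : Fin 3 ↪ Fin n) (⟨_, e3 hab hac hbc⟩ : Fin 3 ↪ Fin n)
    have k0 : (h : Perm (Fin n)) u = a := congrArg (fun f : Fin 3 ↪ Fin n => f 0) hh
    have k1 : (h : Perm (Fin n)) ((x : Perm (Fin n)) u) = b :=
      congrArg (fun f : Fin 3 ↪ Fin n => f 1) hh
    have k2 : (h : Perm (Fin n)) ((x : Perm (Fin n)) ((x : Perm (Fin n)) u)) = c :=
      congrArg (fun f : Fin 3 ↪ Fin n => f 2) hh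
    refine ⟨h, _, rfl, Or.inl ⟨?_, ?_⟩⟩
    · rw [← k0, ← k1]; simp
    · rw [← k1, ← k2]; simp
  · push Not at hinv
    set X : Perm (Fin n) := (x : Perm (Fin n)) with hX
    have hX1 : X ≠ 1 := fun h => hx (Subtype.ext h)
    obtain ⟨u, hu⟩ : ∃ u, X u ≠ u := by
      by_contra! h
      exact hX1 (Equiv.ext h)
    have hsX : sign X = 1 := x.2
    obtain ⟨v, hvu, hvu', hv⟩ : ∃ v, v ≠ u ∧ v ≠ X u ∧ X v ≠ v := by
      by_contra! h
      have : X = swap u (X u) := by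
        ext z
        rw [swap_apply_def]
        split_ifs with h1 h2
        · rw [h1]
        · rw [h2, hinv]
        · rw [h z h1 h2]
      rw [this, sign_swap hu.symm] at hsX
      exact absurd hsX (by decide)
    have hv1 : X v ≠ u := fun h => hvu' (by rw [← h, hinv])
    have hv2 : X v ≠ X u := fun h => hvu (X.injective h)
    obtain ⟨g, hg⟩ := exists_smul_eq_embedding
      (⟨_, e4 hu.symm hvu.symm hv1.symm hvu'.symm hv2.symm hv.symm⟩ : Fin 4 ↪ Fin n)
      (⟨_, e4 hab hac had hbc hbd hcd⟩ : Fin 4 ↪ Fin n)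
    have k0 : g u = a := congrArg (fun f : Fin 4 ↪ Fin n => f 0) hg
    have k1 : g (X u) = b := congrArg (fun f : Fin 4 ↪ Fin n => f 1) hg
    have k2 : g v = c := congrArg (fun f : Fin 4 ↪ Fin n => f 2) hg
    have k3 : g (X v) = d := congrArg (fun f : Fin 4 ↪ Fin n => f 3) hg
    have hform : ∀ y : Perm (Fin n), y = g * X * g⁻¹ →
        (y a = b ∧ y b = a ∧ y c = d ∧ y d = c) := by
      rintro y rfl
      refine ⟨?_, ?_, ?_, ?_⟩
      · rw [← k0, ← k1]; simp
      · rw [← k0, ← k1]; simp [hinv]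
      · rw [← k2, ← k3]; simp
      · rw [← k2, ← k3]; simp [hinv]
    rcases Int.units_eq_one_or (sign g) with hs | hs
    · exact ⟨⟨g, hs⟩, _, rfl, Or.inr (hform _ rfl)⟩
    · refine ⟨⟨g * swap u (X u), ?_⟩, _, rfl, Or.inr (hform _ ?_)⟩
      · rw [mem_alternatingGroup, map_mul, hs, sign_swap hu.symm]; rfl
      · have hcm : X * swap u (X u) = swap u (X u) * X := by
          rw [mul_swap_eq_swap_mul, hinv, swap_comm]
        have hcm' : swap u (X u) * X * swap u (X u) = X := by
          rw [← hcm, mul_assoc, swap_mul_self, mul_one]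
        simp only [Subgroup.coe_mul, Subgroup.coe_inv, ← hX, mul_inv_rev, swap_inv]
        calc g * swap u (X u) * X * (swap u (X u) * g⁻¹)
            = g * (swap u (X u) * X * swap u (X u)) * g⁻¹ := by simp only [mul_assoc]
          _ = _ := by rw [hcm']

theorem reduce {n : ℕ} (s x h k : alternatingGroup (Fin n)) {y s' : Perm (Fin n)}
    (hy : ((h * x * h⁻¹ : alternatingGroup (Fin n)) : Perm (Fin n)) = y)
    (hs' : ((k⁻¹ * s * k : alternatingGroup (Fin n)) : Perm (Fin n)) = s')
    (H : alternatingGroup (Fin n) ≤ Subgroup.closure {y, s'}) :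
    ∃ g : alternatingGroup (Fin n),
        Subgroup.closure {x, g⁻¹ * s * g} = (⊤ : Subgroup (alternatingGroup (Fin n))) := by
  have h1 : Subgroup.closure {h * x * h⁻¹, k⁻¹ * s * k} = ⊤ := by
    rw [eq_top_iff]
    intro z _
    have hz := H z.2
    rw [← hy, ← hs'] at hz
    have : Subgroup.closure {((h * x * h⁻¹ : alternatingGroup (Fin n)) : Perm (Fin n)),
        ((k⁻¹ * s * k : alternatingGroup (Fin n)) : Perm (Fin n))} =
        (Subgroup.closure {h * x * h⁻¹, k⁻¹ * s * k}).map (alternatingGroup (Fin n)).subtype := by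
      rw [MonoidHom.map_closure, Set.image_pair]; rfl
    rw [this] at hz
    obtain ⟨w, hw, e⟩ := hz
    have : w = z := Subtype.ext e
    rwa [← this]
  refine ⟨k * h, ?_⟩
  have h2 := congrArg (Subgroup.map (MulAut.conj h⁻¹).toMonoidHom) h1
  rw [MonoidHom.map_closure, Set.image_pair,
    Subgroup.map_top_of_surjective _ (MulAut.conj h⁻¹).surjective] at h2
  rw [← h2]
  congr 2
  · simp; group

theorem spread_general {n : ℕ} (hn : 5 ≤ n) {p q : ℕ} (hp : p.Prime) (hpo : Odd p) (hqo : Odd q)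
    (hpq : p.Coprime q) (hp3 : p = 3 ∨ p + 3 ≤ n) (hnpq : n = p + q ∨ n = p + q + 1) :
    ∃ s : alternatingGroup (Fin n), ∀ x : alternatingGroup (Fin n), x ≠ 1 →
      ∃ g : alternatingGroup (Fin n),
        Subgroup.closure {x, g⁻¹ * s * g} = (⊤ : Subgroup (alternatingGroup (Fin n))) := by
  obtain ⟨P, -, hPc⟩ := Finset.exists_subset_card_eq (s := (Finset.univ : Finset (Fin n)))
    (n := p) (by simp; omega)
  have hPcc : Pᶜ.card = n - p := by rw [Finset.card_compl, Fintype.card_fin, hPc]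
  obtain ⟨Q, hQP, hQc⟩ := Finset.exists_subset_card_eq (s := Pᶜ) (n := q) (by omega)
  have hdis : Disjoint P Q := by
    rw [Finset.disjoint_right]
    intro a ha
    simpa using hQP ha
  obtain ⟨σ, hσP, hσs⟩ := P.exists_cycleOn
  obtain ⟨τ, hτQ, hτs⟩ := Q.exists_cycleOn
  have hPf : ∀ x ∉ P, σ x = x := fun x hx => by
    by_contra h
    exact hx (hσs (mem_support.2 h))
  have hQf : ∀ x ∉ Q, τ x = x := fun x hx => by
    by_contra h
    exact hx (hτs (mem_support.2 h))
  have hσ1 : σ ^ p = 1 := hPc ▸ cycleOn_pow_card hσP hPf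
  have hτ1 : τ ^ q = 1 := hQc ▸ cycleOn_pow_card hτQ hQf
  have hcomm : Commute σ τ := by
    apply Perm.Disjoint.commute
    rw [disjoint_iff_disjoint_support]
    exact Finset.disjoint_of_subset_left hσs (Finset.disjoint_of_subset_right hτs hdis)
  have hsign : sign (σ * τ) = 1 := by
    rw [map_mul, sign_eq_one_of_odd hpo hσ1, sign_eq_one_of_odd hqo hτ1, mul_one]
  have hp2 : 2 < P.card := by
    rw [hPc]
    have := hp.two_le
    obtain ⟨k, hk⟩ := hpo
    omega
  have hPnt : (P : Set (Fin n)).Nontrivial := Finset.one_lt_card_iff_nontrivial.1 (by omega)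
  have hσc : σ.IsCycle := by
    rw [isCycle_iff_exists_isCycleOn]
    refine ⟨P, hPnt, hσP, fun x hx => ?_⟩
    by_contra h
    exact hx (hPf x h)
  have hsupp : σ.support = P := by
    apply Finset.Subset.antisymm hσs
    intro x hx
    rw [mem_support]
    exact hσP.apply_ne hPnt hx
  obtain ⟨b, hb⟩ : Q.Nonempty := Finset.card_pos.1 (by rw [hQc]; exact hqo.pos)
  refine ⟨⟨σ * τ, hsign⟩, fun x hx => ?_⟩
  -- the final step
  have fin : ∀ (h : alternatingGroup (Fin n)) (y : Perm (Fin n)),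
      ((h * x * h⁻¹ : alternatingGroup (Fin n)) : Perm (Fin n)) = y →
      (∀ G : Subgroup (Perm (Fin n)), y ∈ G → σ ∈ G → τ ∈ G → IsPreprimitive G (Fin n)) →
      ∃ g : alternatingGroup (Fin n), Subgroup.closure {x, g⁻¹ * ⟨σ * τ, hsign⟩ * g} =
        (⊤ : Subgroup (alternatingGroup (Fin n))) := by
    intro h y hy H
    refine reduce _ x h 1 hy (s' := σ * τ) (by simp) ?_
    have hst : σ * τ ∈ Subgroup.closure {y, σ * τ} := Subgroup.subset_closure (by simp)
    have hyG : y ∈ Subgroup.closure {y, σ * τ} := Subgroup.subset_closure (by simp)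
    have hσG : σ ∈ Subgroup.closure {y, σ * τ} := mem_of_mul_mem hcomm hσ1 hτ1 hpq hst
    have hτG : τ ∈ Subgroup.closure {y, σ * τ} :=
      mem_of_mul_mem hcomm.symm hτ1 hσ1 hpq.symm (by rw [← hcomm.eq]; exact hst)
    have hprim := H _ hyG hσG hτG
    rcases hp3 with rfl | hp3
    · exact alternatingGroup_le_of_isPreprimitive_of_isThreeCycle_mem hprim (g := σ)
        (card_support_eq_three_iff.1 (by rw [hsupp, hPc])) hσG
    · exact jordan_prime hprim hp (by rwa [Nat.card_fin]) hσc (by rw [hsupp, hPc]) hσG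
  rcases hnpq with hnpq | hnpq
  · have hcov : ∀ x, x ∈ P ∨ x ∈ Q := by
      have : P ∪ Q = Finset.univ := by
        rw [← Finset.card_eq_iff_eq_univ, Finset.card_union_of_disjoint hdis, hPc, hQc,
          Fintype.card_fin, hnpq]
      intro x
      have hx : x ∈ P ∪ Q := by rw [this]; simp
      exact Finset.mem_union.1 hx
    obtain ⟨a, c, d, ha, hc, hd, hac, had, hcd⟩ := Finset.two_lt_card_iff.1 hp2
    have hne : ∀ z ∈ P, z ≠ b := fun z hz h => Finset.disjoint_left.1 hdis hz (h ▸ hb)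
    obtain ⟨h, y, hy, hyf⟩ := exists_conj_form hn x hx (hne a ha) hac had (hne c hc).symm
      (hne d hd).symm hcd
    have hyab : y a = b := by rcases hyf with h | h <;> exact h.1
    refine fin h y hy fun G hyG hσG hτG => ?_
    have : IsPretransitive G (Fin n) := by
      refine pretransitive_of_conn a fun z => ?_
      rcases hcov z with hz | hz
      · exact Conn.of_cycleOn hσG hσP ha hz
      · exact Conn.trans' ⟨y, hyG, hyab⟩ (Conn.of_cycleOn hτG hτQ hb hz)
    refine prim_even hσG hτG hσP hPf hτQ hQf (hPc ▸ hp) ?_ hdis hcov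
    rw [hPc, Nat.card_fin, hnpq, Nat.dvd_add_right (dvd_refl p)]
    exact (hp.coprime_iff_not_dvd).1 hpq
  · obtain ⟨f, hf⟩ : ∃ f, (P ∪ Q)ᶜ = {f} := by
      rw [← Finset.card_eq_one, Finset.card_compl, Finset.card_union_of_disjoint hdis, hPc, hQc,
          Fintype.card_fin, hnpq]
      omega
    have hf' : ∀ x, x = f ↔ (x ∉ P ∧ x ∉ Q) := by
      intro x
      have := congrArg (fun S => x ∈ S) hf
      simp at this
      rw [← this]
    have hfP := ((hf' f).1 rfl).1
    have hfQ := ((hf' f).1 rfl).2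
    have hcov : ∀ x, x ∈ P ∨ x ∈ Q ∨ x = f := by
      intro x
      have := hf' x
      tauto
    obtain ⟨a, d, _, ha, hd, -, had, -, -⟩ := Finset.two_lt_card_iff.1 hp2
    have hne : ∀ z ∈ P, z ≠ b := fun z hz h => Finset.disjoint_left.1 hdis hz (h ▸ hb)
    have hne' : ∀ z ∈ P, z ≠ f := fun z hz h => hfP (h ▸ hz)
    obtain ⟨h, y, hy, hyf⟩ := exists_conj_form hn x hx (hne a ha) (hne' a ha) had
      (fun h => hfQ (h ▸ hb)) (hne d hd).symm (hne' d hd).symm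
    have hyab : y a = b := by rcases hyf with h | h <;> exact h.1
    refine fin h y hy fun G hyG hσG hτG => ?_
    have hab : Conn G a b := ⟨y, hyG, hyab⟩
    have haf : Conn G a f := by
      rcases hyf with h | h
      · exact hab.trans' ⟨y, hyG, h.2⟩
      · exact (Conn.of_cycleOn hσG hσP ha hd).trans' ⟨y, hyG, h.2.2.2⟩
    have : IsPretransitive G (Fin n) := by
      refine pretransitive_of_conn a fun z => ?_
      rcases hcov z with hz | hz | rfl
      · exact Conn.of_cycleOn hσG hσP ha hz
      · exact hab.trans' (Conn.of_cycleOn hτG hτQ hb hz)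
      · exact haf
    refine prim_odd hσG hτG hσP hPf hτQ hQf (hPc ▸ hpo) (hQc ▸ hqo) ?_ hfP hfQ hcov
    rw [Nat.card_fin, hnpq]
    exact (hpo.add_odd hqo).add_one

theorem exists_pq {k : ℕ} (hk : 4 ≤ k) : ∃ p q : ℕ, p.Prime ∧ Odd p ∧ Odd q ∧ p.Coprime q ∧
    p + 3 ≤ 2 * k ∧ 2 * k = p + q := by
  obtain ⟨m, hm3, hmk, hmo, hmc⟩ : ∃ m, 3 ≤ m ∧ m < k ∧ Odd m ∧ m.Coprime (2 * k) := by
    rcases Nat.even_or_odd k with h | h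
    · obtain ⟨r, hr⟩ := h
      have ho : Odd (k - 1) := ⟨r - 1, by omega⟩
      refine ⟨k - 1, by omega, by omega, ho, ?_⟩
      apply Nat.Coprime.mul_right
      · exact Nat.coprime_two_right.2 ho
      · exact (Nat.coprime_self_sub_left (by omega : 1 ≤ k)).2 (by simp)
    · obtain ⟨r, hr⟩ := h
      have ho : Odd (k - 2) := ⟨r - 1, by omega⟩
      refine ⟨k - 2, by omega, by omega, ho, ?_⟩
      apply Nat.Coprime.mul_right
      · exact Nat.coprime_two_right.2 ho
      · exact (Nat.coprime_self_sub_left (by omega : 2 ≤ k)).2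
          (Nat.coprime_two_left.2 ⟨r, hr⟩)
  have hp : m.minFac.Prime := Nat.minFac_prime (by omega)
  have hle := Nat.minFac_le (n := m) (by omega)
  have hpo : Odd m.minFac := hmo.of_dvd_nat (Nat.minFac_dvd m)
  refine ⟨m.minFac, 2 * k - m.minFac, hp, hpo, ?_, ?_, by omega, by omega⟩
  · obtain ⟨r, hr⟩ := hpo
    exact ⟨k - r - 1, by omega⟩
  · rw [Nat.coprime_sub_self_right (by omega)]
    exact hmc.coprime_dvd_left (Nat.minFac_dvd m)

theorem spread_seven :
    ∃ s : alternatingGroup (Fin 7), ∀ x : alternatingGroup (Fin 7), x ≠ 1 →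
      ∃ g : alternatingGroup (Fin 7),
        Subgroup.closure {x, g⁻¹ * s * g} = (⊤ : Subgroup (alternatingGroup (Fin 7))) := by
  set S : Perm (Fin 7) := swap 0 1 * swap 1 2 * swap 3 4 * swap 5 6 with hS
  have hsign : sign S = 1 := by decide
  refine ⟨⟨S, hsign⟩, fun x hx => ?_⟩
  obtain ⟨h, y, hy, hyf⟩ := exists_conj_form (by norm_num) x hx
    (a := 0) (b := 3) (c := 5) (d := 1) (by decide) (by decide) (by decide) (by decide)
    (by decide) (by decide)
  refine reduce _ x h 1 hy (s' := S) (by simp) ?_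
  set G := Subgroup.closure {y, S}
  have hSG : S ∈ G := Subgroup.subset_closure (by simp)
  have hyG : y ∈ G := Subgroup.subset_closure (by simp)
  have h01 : Conn G 0 1 := ⟨S, hSG, by decide⟩
  have h12 : Conn G 1 2 := ⟨S, hSG, by decide⟩
  have h34 : Conn G 3 4 := ⟨S, hSG, by decide⟩
  have h56 : Conn G 5 6 := ⟨S, hSG, by decide⟩
  have h03 : Conn G 0 3 := ⟨y, hyG, by rcases hyf with h | h <;> exact h.1⟩
  have h05 : Conn G 0 5 := by
    rcases hyf with h | h
    · exact h03.trans' ⟨y, hyG, h.2⟩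
    · exact h01.trans' ⟨y, hyG, h.2.2.2⟩
  have : IsPretransitive G (Fin 7) := by
    refine pretransitive_of_conn 0 fun z => ?_
    fin_cases z
    · exact Conn.rfl' _
    · exact h01
    · exact h01.trans' h12
    · exact h03
    · exact h03.trans' h34
    · exact h05
    · exact h05.trans' h56
  have hprim : IsPreprimitive G (Fin 7) :=
    IsPreprimitive.of_prime_card (by rw [Nat.card_fin]; norm_num)
  exact alternatingGroup_le_of_isPreprimitive_of_isThreeCycle_mem hprim (g := S ^ 4)
    (card_support_eq_three_iff.1 (by decide)) (G.pow_mem hSG 4)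

/-- The permutation `i ↦ r i` fixing `0`, given by tables. -/
def tab (f g : Fin 6 → Fin 6) (h : ∀ x, g (f x) = x) (hgf : ∀ x, f (g x) = x) : Perm (Fin 6) :=
  ⟨f, g, h, hgf⟩

/-- A `5`-cycle. -/
def S0 : Perm (Fin 6) := tab ![0, 2, 3, 4, 5, 1] ![0, 5, 1, 2, 3, 4] (by decide) (by decide)

theorem S0_cycleOn : S0.IsCycleOn ((Finset.univ.erase 0 : Finset (Fin 6)) : Set (Fin 6)) := by
  constructor
  · exact S0.bijOn (by decide)
  · intro x hx y hy
    have : ∀ x y : Fin 6, x ≠ 0 → y ≠ 0 → ∃ i : Fin 5, (S0 ^ (i : ℕ)) x = y := by decide +kernel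
    obtain ⟨i, hi⟩ := this x y (by simpa using hx) (by simpa using hy)
    exact ⟨(i : ℕ), by simpa using hi⟩

theorem six_core (r : Perm (Fin 6)) (hr : r 0 = 0) {y w : Perm (Fin 6)} (hy : y 0 = 1)
    {G : Subgroup (Perm (Fin 6))} (hyG : y ∈ G) (hsG : r * S0 * r⁻¹ ∈ G) (hwG : w ∈ G)
    (hw : w.support.card = 3) : alternatingGroup (Fin 6) ≤ G := by
  have hP : (r * S0 * r⁻¹).IsCycleOn ((Finset.univ.erase 0 : Finset (Fin 6)) : Set (Fin 6)) := by
    have h1 := S0_cycleOn.conj (g := r)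
    have h2 : (r '' ((Finset.univ.erase 0 : Finset (Fin 6)) : Set (Fin 6))) =
        ((Finset.univ.erase 0 : Finset (Fin 6)) : Set (Fin 6)) := by
      ext z
      simp only [Finset.coe_erase, Finset.coe_univ, Set.mem_image, Set.mem_sdiff, Set.mem_univ,
        Set.mem_singleton_iff, true_and]
      constructor
      · rintro ⟨u, hu, rfl⟩ h
        exact hu (r.injective (h.trans hr.symm))
      · intro hz
        exact ⟨r⁻¹ z, fun h => hz (by rw [← hr, ← h]; simp), by simp⟩
    rwa [h2] at h1
  have hr' : r⁻¹ 0 = 0 := by rw [Perm.inv_eq_iff_eq, hr]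
  have : IsPretransitive G (Fin 6) := by
    refine pretransitive_of_conn 1 fun z => ?_
    by_cases hz : z = 0
    · subst hz
      exact Conn.symm' ⟨y, hyG, hy⟩
    · exact Conn.of_cycleOn hsG hP (by decide) (by simpa using hz)
  have hprim : IsPreprimitive G (Fin 6) := by
    refine prim_even hsG G.one_mem (Q := {0}) hP ?_ (by simp) (by simp) ?_ ?_ (by decide)
      (by decide)
    · intro x hx
      have : x = 0 := by simpa using hx
      subst this
      have h0 : S0 0 = 0 := by decide
      simp only [Perm.mul_apply, hr', h0, hr]
    · have : (Finset.univ.erase 0 : Finset (Fin 6)).card = 5 := by decide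
      rw [this]; norm_num
    · have : (Finset.univ.erase 0 : Finset (Fin 6)).card = 5 := by decide
      rw [this, Nat.card_fin]; norm_num
  exact alternatingGroup_le_of_isPreprimitive_of_isThreeCycle_mem hprim
    (card_support_eq_three_iff.1 hw) hwG

/-- A self-map of `Fin 6` moving exactly three points. -/
def M3 (f : Fin 6 → Fin 6) : Prop := (Finset.univ.filter fun i => f i ≠ i).card = 3

instance (f : Fin 6 → Fin 6) : Decidable (M3 f) := by unfold M3; infer_instance

theorem M3.support {w : Perm (Fin 6)} {f : Fin 6 → Fin 6} (h : M3 f) (hf : ∀ i, w i = f i) :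
    w.support.card = 3 := by
  rw [← h]
  congr 1
  ext i
  simp [hf]

/-- One of seven short words moves exactly three points. -/
def Good (f : Fin 6 → Fin 6) : Prop :=
  M3 (fun i => f (![0, 3, 1, 5, 2, 4] (f (![0, 3, 1, 5, 2, 4] i)))) ∨
  M3 (fun i => f (![0, 5, 4, 2, 1, 3] (![0, 5, 4, 2, 1, 3] (f (![0, 5, 4, 2, 1, 3] (![0, 5, 4, 2, 1, 3] i)))))) ∨
  M3 (fun i => f (![0, 4, 1, 5, 3, 2] (f (![0, 4, 1, 5, 3, 2] i)))) ∨
  M3 (fun i => f (![0, 3, 5, 4, 2, 1] (![0, 3, 5, 4, 2, 1] (f (![0, 3, 5, 4, 2, 1] (![0, 3, 5, 4, 2, 1] i)))))) ∨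
  M3 (fun i => f (![0, 3, 5, 2, 1, 4] (f (![0, 3, 5, 2, 1, 4] (![0, 3, 5, 2, 1, 4] i))))) ∨
  M3 (fun i => f (![0, 5, 1, 2, 3, 4] i)) ∨
  M3 (fun i => f (![0, 2, 3, 4, 5, 1] (f (![0, 2, 3, 4, 5, 1] (![0, 2, 3, 4, 5, 1] (f (![0, 2, 3, 4, 5, 1] (![0, 2, 3, 4, 5, 1] (![0, 2, 3, 4, 5, 1] i)))))))))

instance (f : Fin 6 → Fin 6) : Decidable (Good f) := by unfold Good; infer_instance

theorem good_long : ∀ u v w z : Fin 6, u ∉ ({1, 2} : Finset (Fin 6)) →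
    v ∉ ({1, 2, u} : Finset (Fin 6)) → w ∉ ({1, 2, u, v} : Finset (Fin 6)) →
    z ∉ ({1, 2, u, v, w} : Finset (Fin 6)) → Good ![1, 2, u, v, w, z] := by
  decide +kernel

theorem good_short : ∀ w z : Fin 6, w ∉ ({0, 1, 2, 3} : Finset (Fin 6)) →
    z ∉ ({0, 1, 2, 3, w} : Finset (Fin 6)) → Good ![1, 0, 3, 2, w, z] := by
  decide +kernel

theorem spread_six :
    ∃ s : alternatingGroup (Fin 6), ∀ x : alternatingGroup (Fin 6), x ≠ 1 →
      ∃ g : alternatingGroup (Fin 6),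
        Subgroup.closure {x, g⁻¹ * s * g} = (⊤ : Subgroup (alternatingGroup (Fin 6))) := by
  have hsign : sign S0 = 1 := by decide +kernel
  refine ⟨⟨S0, hsign⟩, fun x hx => ?_⟩
  obtain ⟨h, y, hy, hyf⟩ := exists_conj_form (by norm_num) x hx
    (a := 0) (b := 1) (c := 2) (d := 3) (by decide) (by decide) (by decide) (by decide)
    (by decide) (by decide)
  have hy0 : y 0 = 1 := by rcases hyf with h | h <;> exact h.1
  have hinj : ∀ i j : Fin 6, i ≠ j → y i ≠ y j := fun i j hij h => hij (y.injective h)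
  have hgood : Good y := by
    have hvec : (y : Fin 6 → Fin 6) = ![y 0, y 1, y 2, y 3, y 4, y 5] := by
      ext i; fin_cases i <;> rfl
    rcases hyf with ⟨h0, h1⟩ | ⟨h0, h1, h2, h3⟩
    · rw [hvec, h0, h1]
      have e02 := hinj 2 0 (by decide)
      have e12 := hinj 2 1 (by decide)
      have e03 := hinj 3 0 (by decide)
      have e13 := hinj 3 1 (by decide)
      have e23 := hinj 3 2 (by decide)
      have e04 := hinj 4 0 (by decide)
      have e14 := hinj 4 1 (by decide)
      have e24 := hinj 4 2 (by decide)
      have e34 := hinj 4 3 (by decide)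
      have e05 := hinj 5 0 (by decide)
      have e15 := hinj 5 1 (by decide)
      have e25 := hinj 5 2 (by decide)
      have e35 := hinj 5 3 (by decide)
      have e45 := hinj 5 4 (by decide)
      rw [h0] at e02 e03 e04 e05
      rw [h1] at e12 e13 e14 e15
      apply good_long <;> simp only [Finset.mem_insert, Finset.mem_singleton, not_or] <;> tauto
    · rw [hvec, h0, h1, h2, h3]
      have e04 := hinj 4 0 (by decide)
      have e14 := hinj 4 1 (by decide)
      have e24 := hinj 4 2 (by decide)
      have e34 := hinj 4 3 (by decide)
      have e05 := hinj 5 0 (by decide)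
      have e15 := hinj 5 1 (by decide)
      have e25 := hinj 5 2 (by decide)
      have e35 := hinj 5 3 (by decide)
      have e45 := hinj 5 4 (by decide)
      rw [h0] at e04 e05
      rw [h1] at e14 e15
      rw [h2] at e24 e25
      rw [h3] at e34 e35
      apply good_short <;> simp only [Finset.mem_insert, Finset.mem_singleton, not_or] <;> tauto
  have fin : ∀ (r w : Perm (Fin 6)), sign r = 1 → r 0 = 0 → w.support.card = 3 →
      w ∈ Subgroup.closure {y, r * S0 * r⁻¹} →
      ∃ g : alternatingGroup (Fin 6), Subgroup.closure {x, g⁻¹ * ⟨S0, hsign⟩ * g} =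
        (⊤ : Subgroup (alternatingGroup (Fin 6))) := by
    intro r w hr hr0 hw hwG
    refine reduce _ x h (⟨r, hr⟩⁻¹) hy (s' := r * S0 * r⁻¹) (by simp) ?_
    exact six_core r hr0 hy0 (Subgroup.subset_closure (by simp))
      (Subgroup.subset_closure (by simp)) hwG hw
  have hmem : ∀ S : Perm (Fin 6), y ∈ Subgroup.closure {y, S} ∧ S ∈ Subgroup.closure {y, S} :=
    fun S => ⟨Subgroup.subset_closure (by simp), Subgroup.subset_closure (by simp)⟩
  rcases hgood with H | H | H | H | H | H | H
  · let r := tab ![0, 1, 3, 5, 4, 2] ![0, 1, 5, 2, 4, 3] (by decide) (by decide)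
    obtain ⟨S, hS⟩ : ∃ S, S = r * S0 * r⁻¹ := ⟨_, rfl⟩
    have hT : ∀ i, S i = ![0, 3, 1, 5, 2, 4] i := by rw [hS]; decide +kernel
    refine fin r (y * S * y * S) (by decide +kernel) rfl
      (H.support fun i => by simp only [Perm.mul_apply, hT]) ?_
    rw [← hS]
    exact mul_mem (mul_mem (mul_mem (hmem S).1 (hmem S).2) (hmem S).1) (hmem S).2
  · let r := tab ![0, 1, 5, 3, 2, 4] ![0, 1, 4, 3, 5, 2] (by decide) (by decide)
    obtain ⟨S, hS⟩ : ∃ S, S = r * S0 * r⁻¹ := ⟨_, rfl⟩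
    have hT : ∀ i, S i = ![0, 5, 4, 2, 1, 3] i := by rw [hS]; decide +kernel
    refine fin r (y * S * S * y * S * S) (by decide +kernel) rfl
      (H.support fun i => by simp only [Perm.mul_apply, hT]) ?_
    rw [← hS]
    exact mul_mem (mul_mem (mul_mem (mul_mem (mul_mem (hmem S).1 (hmem S).2) (hmem S).2) (hmem S).1) (hmem S).2) (hmem S).2
  · let r := tab ![0, 1, 4, 3, 5, 2] ![0, 1, 5, 3, 2, 4] (by decide) (by decide)
    obtain ⟨S, hS⟩ : ∃ S, S = r * S0 * r⁻¹ := ⟨_, rfl⟩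
    have hT : ∀ i, S i = ![0, 4, 1, 5, 3, 2] i := by rw [hS]; decide +kernel
    refine fin r (y * S * y * S) (by decide +kernel) rfl
      (H.support fun i => by simp only [Perm.mul_apply, hT]) ?_
    rw [← hS]
    exact mul_mem (mul_mem (mul_mem (hmem S).1 (hmem S).2) (hmem S).1) (hmem S).2
  · let r := tab ![0, 1, 3, 4, 2, 5] ![0, 1, 4, 2, 3, 5] (by decide) (by decide)
    obtain ⟨S, hS⟩ : ∃ S, S = r * S0 * r⁻¹ := ⟨_, rfl⟩
    have hT : ∀ i, S i = ![0, 3, 5, 4, 2, 1] i := by rw [hS]; decide +kernel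
    refine fin r (y * S * S * y * S * S) (by decide +kernel) rfl
      (H.support fun i => by simp only [Perm.mul_apply, hT]) ?_
    rw [← hS]
    exact mul_mem (mul_mem (mul_mem (mul_mem (mul_mem (hmem S).1 (hmem S).2) (hmem S).2) (hmem S).1) (hmem S).2) (hmem S).2
  · let r := tab ![0, 1, 3, 2, 5, 4] ![0, 1, 3, 2, 5, 4] (by decide) (by decide)
    obtain ⟨S, hS⟩ : ∃ S, S = r * S0 * r⁻¹ := ⟨_, rfl⟩
    have hT : ∀ i, S i = ![0, 3, 5, 2, 1, 4] i := by rw [hS]; decide +kernel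
    refine fin r (y * S * y * S * S) (by decide +kernel) rfl
      (H.support fun i => by simp only [Perm.mul_apply, hT]) ?_
    rw [← hS]
    exact mul_mem (mul_mem (mul_mem (mul_mem (hmem S).1 (hmem S).2) (hmem S).1) (hmem S).2) (hmem S).2
  · let r := tab ![0, 1, 5, 4, 3, 2] ![0, 1, 5, 4, 3, 2] (by decide) (by decide)
    obtain ⟨S, hS⟩ : ∃ S, S = r * S0 * r⁻¹ := ⟨_, rfl⟩
    have hT : ∀ i, S i = ![0, 5, 1, 2, 3, 4] i := by rw [hS]; decide +kernel
    refine fin r (y * S) (by decide +kernel) rfl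
      (H.support fun i => by simp only [Perm.mul_apply, hT]) ?_
    rw [← hS]
    exact mul_mem (hmem S).1 (hmem S).2
  · let r := tab ![0, 1, 2, 3, 4, 5] ![0, 1, 2, 3, 4, 5] (by decide) (by decide)
    obtain ⟨S, hS⟩ : ∃ S, S = r * S0 * r⁻¹ := ⟨_, rfl⟩
    have hT : ∀ i, S i = ![0, 2, 3, 4, 5, 1] i := by rw [hS]; decide +kernel
    refine fin r (y * S * y * S * S * y * S * S * S) (by decide +kernel) rfl
      (H.support fun i => by simp only [Perm.mul_apply, hT]) ?_
    rw [← hS]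
    exact mul_mem (mul_mem (mul_mem (mul_mem (mul_mem (mul_mem (mul_mem (mul_mem (hmem S).1 (hmem S).2) (hmem S).1) (hmem S).2) (hmem S).2) (hmem S).1) (hmem S).2) (hmem S).2) (hmem S).2

/-- For every `n ≥ 5` there exists `s ∈ Aₙ` such that every nontrivial element of `Aₙ`
generates `Aₙ` together with some conjugate of `s`. -/
theorem alternating_uniform_spread_one (n : ℕ) (hn : 5 ≤ n) :
    ∃ s : alternatingGroup (Fin n), ∀ x : alternatingGroup (Fin n), x ≠ 1 →
      ∃ g : alternatingGroup (Fin n),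
        Subgroup.closure {x, g⁻¹ * s * g} = (⊤ : Subgroup (alternatingGroup (Fin n))) := by
  by_cases h5 : n = 5
  · exact spread_general hn (p := 3) (q := 1) Nat.prime_three (by decide) (by decide) (by simp)
      (Or.inl rfl) (Or.inr h5)
  by_cases h6 : n = 6
  · subst h6
    exact spread_six
  by_cases h7 : n = 7
  · subst h7
    exact spread_seven
  obtain ⟨p, q, hp, hpo, hqo, hpq, hle, hs⟩ := exists_pq (k := n / 2) (by omega)
  exact spread_general hn hp hpo hqo hpq (Or.inr (by omega)) (by omega)
end

section
/- Let 𝔤 be a finite-dimensional simple Lie algebra over ℂ. Then for every nonzero x ∈ 𝔤 there exists y ∈ 𝔤 such that x and y generate 𝔤 as a Lie algebra, i.e. the only Lie subalgebra of 𝔤 containing both x and y is 𝔤 itself. -/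
open LieAlgebra LieModule Polynomial

/-- The one-parameter group of automorphisms attached to an ad-nilpotent element. -/
theorem exists_exp_family {L : Type*} [LieRing L] [LieAlgebra ℂ L] (n : L)
    (hn : IsNilpotent (ad ℂ L n)) :
    ∃ (σ : ℂ → (L ≃ₗ⁅ℂ⁆ L)) (k : ℕ), ∀ t v, σ t v =
      ∑ i ∈ Finset.range (k + 2), (t ^ i * ((i.factorial : ℂ))⁻¹) • (((ad ℂ L n) ^ i) v) := by
  let _ : Module ℚ L := Module.compHom L (algebraMap ℚ ℂ)
  have hq : ∀ (q : ℚ) (v : L), q • v = (q : ℂ) • v := fun q v => rfl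
  let _ : LieAlgebra ℚ L := { lie_smul := fun q x y => by simp [hq] }
  obtain ⟨k, hk₀⟩ := hn
  have hk : (ad ℂ L n) ^ (k + 2) = 0 := by rw [pow_add, hk₀, zero_mul]
  have hD : ∀ t : ℂ, (LieDerivation.ad ℂ L (t • n)).toLinearMap = t • ad ℂ L n := by
    intro t; ext v; simp
  have hk' : ∀ t : ℂ, ((LieDerivation.ad ℂ L (t • n)).toLinearMap) ^ (k + 2) = 0 := by
    intro t; rw [hD, _root_.smul_pow, hk, smul_zero]
  have hnil : ∀ t : ℂ, IsNilpotent (LieDerivation.ad ℂ L (t • n)).toLinearMap :=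
    fun t => ⟨k + 2, hk' t⟩
  refine ⟨fun t => LieDerivation.exp (LieDerivation.ad ℂ L (t • n)) (hnil t), k, ?_⟩
  intro t v
  beta_reduce
  rw [LieDerivation.exp_map_apply, IsNilpotent.exp_eq_sum (hk' t), hD]
  simp only [LinearMap.sum_apply, LinearMap.smul_apply, _root_.smul_pow, hq, smul_smul]
  refine Finset.sum_congr rfl fun i _ => ?_
  push_cast
  rw [mul_comm]

/-- Curves all of whose coordinates are polynomial. -/
def PolyCurve {L : Type*} [AddCommGroup L] [Module ℂ L] (f : ℂ → L) : Prop :=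
  ∀ φ : Module.Dual ℂ L, ∃ p : ℂ[X], ∀ s, φ (f s) = p.eval s

/-- Points reachable from `x` by polynomial curves inside the automorphism orbit. -/
def Reach {L : Type*} [LieRing L] [LieAlgebra ℂ L] (x v : L) : Prop :=
  ∃ f : ℂ → L, PolyCurve f ∧ f 0 = x ∧ f 1 = v ∧ ∀ s, ∃ σ : L ≃ₗ⁅ℂ⁆ L, f s = σ x

theorem Reach.refl {L : Type*} [LieRing L] [LieAlgebra ℂ L] (x : L) : Reach x x :=
  ⟨fun _ => x, fun φ => ⟨C (φ x), by simp⟩, rfl, rfl, fun _ => ⟨LieEquiv.refl, rfl⟩⟩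

theorem Reach.step {L : Type*} [LieRing L] [LieAlgebra ℂ L] {x v n : L}
    {σ : ℂ → (L ≃ₗ⁅ℂ⁆ L)} {k : ℕ} (hσ : ∀ t v, σ t v =
      ∑ i ∈ Finset.range (k + 2), (t ^ i * ((i.factorial : ℂ))⁻¹) • (((ad ℂ L n) ^ i) v))
    (h : Reach x v) (h0 : ∀ v, σ 0 v = v) (t : ℂ) : Reach x (σ t v) := by
  obtain ⟨f, hf, hf0, hf1, hfs⟩ := h
  refine ⟨fun s => σ (s * t) (f s), ?_, ?_, ?_, ?_⟩
  · intro φ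
    choose p hp using fun i : ℕ => hf (φ ∘ₗ ((ad ℂ L n) ^ i))
    refine ⟨∑ i ∈ Finset.range (k + 2), (X * C t) ^ i * C (((i.factorial : ℂ))⁻¹) * p i, fun s => ?_⟩
    beta_reduce
    rw [hσ, map_sum, eval_finsetSum]
    refine Finset.sum_congr rfl fun i _ => ?_
    have := hp i s
    simp only [LinearMap.comp_apply] at this
    simp [this, mul_comm t s]
  · simp [h0, hf0]
  · simp [hf1]
  · intro s
    obtain ⟨τ, hτ⟩ := hfs s
    exact ⟨τ.trans (σ (s * t)), by simp [hτ]⟩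

theorem sigma_zero {L : Type*} [LieRing L] [LieAlgebra ℂ L] {n : L}
    {σ : ℂ → (L ≃ₗ⁅ℂ⁆ L)} {k : ℕ} (hσ : ∀ t v, σ t v =
      ∑ i ∈ Finset.range (k + 2), (t ^ i * ((i.factorial : ℂ))⁻¹) • (((ad ℂ L n) ^ i) v))
    (v : L) : σ 0 v = v := by
  rw [hσ, Finset.sum_range_succ']
  simp

/-- A subspace stable under the one-parameter group is stable under its generator. -/
theorem lie_mem_of_exp_stable {L : Type*} [LieRing L] [LieAlgebra ℂ L] {n : L}
    {σ : ℂ → (L ≃ₗ⁅ℂ⁆ L)} {k : ℕ} (hσ : ∀ t v, σ t v =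
      ∑ i ∈ Finset.range (k + 2), (t ^ i * ((i.factorial : ℂ))⁻¹) • (((ad ℂ L n) ^ i) v))
    (W : Submodule ℂ L) (hW : ∀ t, ∀ w ∈ W, σ t w ∈ W) (w : L) (hw : w ∈ W) : ⁅n, w⁆ ∈ W := by
  by_contra hcon
  obtain ⟨φ, hφ, hφW⟩ := Submodule.exists_le_ker_of_notMem hcon
  have key : (∑ i ∈ Finset.range (k + 2),
      C (((i.factorial : ℂ))⁻¹ * φ (((ad ℂ L n) ^ i) w)) * X ^ i : ℂ[X]) = 0 := by
    refine Polynomial.funext fun t => ?_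
    have h1 : φ (σ t w) = 0 := hφW (hW t w hw)
    rw [hσ, map_sum] at h1
    rw [eval_finsetSum, eval_zero, ← h1]
    refine Finset.sum_congr rfl fun i _ => ?_
    simp; ring
  have h1 := congrArg (fun p => coeff p 1) key
  simp only [finsetSum_coeff, coeff_C_mul, coeff_X_pow, coeff_zero] at h1
  simp at h1
  exact hφ h1

section roots

variable {L : Type*} [LieRing L] [LieAlgebra ℂ L] [FiniteDimensional ℂ L] [IsKilling ℂ L]

theorem eq_top_of_rootSpace_le (H : LieSubalgebra ℂ L) [H.IsCartanSubalgebra]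
    (K : LieSubalgebra ℂ L)
    (hK : ∀ α : Weight ℂ H L, α.IsNonZero → ∀ v ∈ rootSpace H α, v ∈ K) : K = ⊤ := by
  have h1 : ∀ h : H, (h : L) ∈ K := by
    intro h
    have hh : h ∈ ⨆ α : Weight ℂ H L, ⨆ (_ : α.IsNonZero), corootSpace α := by simp
    have hle : (⨆ α : Weight ℂ H L, ⨆ (_ : α.IsNonZero), corootSpace α).toSubmodule ≤
        K.toSubmodule.comap H.toSubmodule.subtype := by
      simp only [LieSubmodule.iSup_toSubmodule, iSup_le_iff]
      intro α hα z hz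
      have hz' := (mem_corootSpace (α : H → ℂ)).1 hz
      have hsp : Submodule.span ℂ {x | ∃ y ∈ rootSpace H α, ∃ z ∈ rootSpace H (-α : H → ℂ), ⁅y, z⁆ = x} ≤
          K.toSubmodule := by
        rw [Submodule.span_le]
        rintro _ ⟨a, ha, b, hb, rfl⟩
        exact K.lie_mem (hK α hα a ha) (hK (-α) (by simpa using hα) b hb)
      exact hsp hz'
    exact hle hh
  have h2 := cartan_sup_iSup_rootSpace_eq_top (K := ℂ) (L := L) (H := H)
  have h3 := congrArg LieSubmodule.toSubmodule h2
  rw [← LieSubalgebra.toSubmodule_inj, LieSubalgebra.top_toSubmodule, eq_top_iff, ← LieSubmodule.top_toSubmodule (L := H), ← h3]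
  simp only [LieSubmodule.sup_toSubmodule, LieSubmodule.iSup_toSubmodule, sup_le_iff, iSup_le_iff]
  exact ⟨fun z hz => h1 ⟨z, hz⟩, fun α hα z hz => hK α hα z hz⟩

/-- The span of the reachable points is everything. -/
theorem span_reach (H : LieSubalgebra ℂ L) [H.IsCartanSubalgebra] [LieAlgebra.IsSimple ℂ L] (x : L) (hx : x ≠ 0) :
    Submodule.span ℂ {v | Reach x v} = ⊤ := by
  set W := Submodule.span ℂ {v | Reach x v} with hWdef
  have hroot : ∀ α : Weight ℂ H L, α.IsNonZero → ∀ n ∈ rootSpace H α, ∀ w ∈ W, ⁅n, w⁆ ∈ W := by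
    intro α hα n hn
    have hα' : (α : H → ℂ) ≠ 0 := hα
    obtain ⟨σ, k, hσ⟩ := exists_exp_family n (isNilpotent_ad_of_mem_rootSpace H hα' hn)
    refine lie_mem_of_exp_stable hσ W fun t w hw => ?_
    have : W ≤ W.comap ((σ t : L →ₗ⁅ℂ⁆ L) : L →ₗ[ℂ] L) := by
      rw [hWdef, Submodule.span_le]
      intro v hv
      exact Submodule.subset_span (Reach.step hσ hv (sigma_zero hσ) t)
    exact this hw
  let K : LieSubalgebra ℂ L :=
    { carrier := {n | ∀ w ∈ W, ⁅n, w⁆ ∈ W}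
      add_mem' := fun {a b} ha hb w hw => by
        rw [add_lie]; exact W.add_mem (ha w hw) (hb w hw)
      zero_mem' := fun w hw => by simp
      smul_mem' := fun c a ha w hw => by
        rw [smul_lie]; exact W.smul_mem c (ha w hw)
      lie_mem' := fun {a b} ha hb w hw => by
        rw [lie_lie]; exact W.sub_mem (ha _ (hb w hw)) (hb _ (ha w hw)) }
  have hK : K = ⊤ := eq_top_of_rootSpace_le H K hroot
  let I : LieIdeal ℂ L :=
    { W with
      lie_mem := fun {a w} hw => by
        have : a ∈ K := by rw [hK]; trivial
        exact this w hw }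
  have hI : I = ⊤ := by
    refine (eq_bot_or_eq_top I).resolve_left fun hI => hx ?_
    have : x ∈ I := Submodule.subset_span (Reach.refl x)
    rw [hI] at this
    simpa using this
  have := congrArg LieSubmodule.toSubmodule hI
  exact this

/-- Simultaneous nonvanishing of finitely many functionals on the orbit of `x`. -/
theorem exists_aut_forall_ne_zero (H : LieSubalgebra ℂ L) [H.IsCartanSubalgebra]
    [LieAlgebra.IsSimple ℂ L] (x : L) (hx : x ≠ 0)
    {ι : Type*} (φ : ι → Module.Dual ℂ L) (hφ : ∀ i, φ i ≠ 0) (S : Finset ι) :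
    ∃ σ : L ≃ₗ⁅ℂ⁆ L, ∀ i ∈ S, φ i (σ x) ≠ 0 := by
  classical
  induction S using Finset.induction_on with
  | empty => exact ⟨LieEquiv.refl, by simp⟩
  | insert j S hj ih =>
    obtain ⟨σ, hσ⟩ := ih
    have hy : σ x ≠ 0 := by simpa using hx
    have hex : ∃ v, Reach (σ x) v ∧ φ j v ≠ 0 := by
      by_contra hcon
      push Not at hcon
      apply hφ j
      have : Submodule.span ℂ {v | Reach (σ x) v} ≤ LinearMap.ker (φ j) :=
        Submodule.span_le.2 fun v hv => hcon v hv
      rw [span_reach H _ hy, top_le_iff] at this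
      exact LinearMap.ker_eq_top.1 this
    obtain ⟨v, ⟨f, hf, hf0, hf1, hfs⟩, hv⟩ := hex
    choose p hp using fun i => hf (φ i)
    have hne : (∏ i ∈ insert j S, p i) ≠ 0 := by
      rw [Finset.prod_ne_zero_iff]
      intro i hi h0
      rcases Finset.mem_insert.1 hi with rfl | hi
      · apply hv; rw [← hf1, hp, h0, eval_zero]
      · apply hσ i hi; rw [← hf0, hp, h0, eval_zero]
    obtain ⟨s, hs⟩ : ∃ s, eval s (∏ i ∈ insert j S, p i) ≠ 0 := by
      by_contra hcon
      push Not at hcon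
      exact hne (Polynomial.funext fun s => by rw [hcon s, eval_zero])
    obtain ⟨τ, hτ⟩ := hfs s
    refine ⟨σ.trans τ, fun i hi h0 => ?_⟩
    rw [eval_prod, Finset.prod_ne_zero_iff] at hs
    apply hs i hi
    rw [← hp, hτ]
    simpa using h0

theorem exists_separating (H : LieSubalgebra ℂ L) [H.IsCartanSubalgebra]
    :
    ∃ h : H, ∀ α β : Weight ℂ H L, α ≠ β → α h ≠ β h := by
  obtain ⟨h, hh⟩ := Module.Dual.exists_forall_ne_zero_of_forall_exists
    (ι := {p : Weight ℂ H L × Weight ℂ H L // p.1 ≠ p.2})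
    (fun p => Weight.toLinear ℂ H L p.1.1 - Weight.toLinear ℂ H L p.1.2) (by
      rintro ⟨⟨α, β⟩, hne⟩
      by_contra hcon
      push Not at hcon
      apply hne
      refine Weight.ext fun z => ?_
      have := hcon z
      simpa [sub_eq_zero] using this)
  refine ⟨h, fun α β hne h0 => hh ⟨(α, β), hne⟩ ?_⟩
  simp [h0]

theorem generates_of_components (H : LieSubalgebra ℂ L) [H.IsCartanSubalgebra]
    (h : H) (hsep : ∀ α β : Weight ℂ H L, α ≠ β → α h ≠ β h)
    (x : L) (hx : ∀ α : Weight ℂ H L, α.IsNonZero →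
      ∃ e ∈ rootSpace H (-α : H → ℂ), killingForm ℂ L e x ≠ 0)
    (K : LieSubalgebra ℂ L) (hxK : x ∈ K) (hhK : (h : L) ∈ K) : K = ⊤ := by
  classical
  refine eq_top_of_rootSpace_le H K fun α hα v hv => ?_
  have hxtop : x ∈ ⨆ χ : Weight ℂ H L, (genWeightSpace L χ).toSubmodule := by
    rw [← LieSubmodule.iSup_toSubmodule, iSup_genWeightSpace_eq_top' ℂ H L]
    trivial
  obtain ⟨f, hf, hfx⟩ := (Submodule.mem_iSup_iff_exists_finsupp _ _).1 hxtop
  have hfe : ∀ χ : Weight ℂ H L, ad ℂ L (h : L) (f χ) = (χ h) • f χ := fun χ => by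
    simpa using IsKilling.lie_eq_smul_of_mem_rootSpace (hf χ) h
  obtain ⟨e, he, hex⟩ := hx α hα
  have hfα : f α ≠ 0 := by
    intro h0
    apply hex
    rw [← hfx, Finsupp.sum, map_sum]
    refine Finset.sum_eq_zero fun χ _ => ?_
    by_cases hχ : χ = α
    · rw [hχ, h0, map_zero]
    · refine killingForm_apply_eq_zero_of_mem_rootSpace_of_add_ne_zero ℂ L H he (hf χ) ?_
      intro h1
      apply hχ
      refine Weight.ext fun z => ?_
      have := congrFun h1 z
      simp at this
      linear_combination this
  let _ := Fintype.ofFinite (Weight ℂ H L)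
  let q : ℂ[X] := ∏ χ ∈ Finset.univ.erase α, (X - C (χ h))
  have hq0 : ∀ χ, χ ≠ α → q.eval (χ h) = 0 := by
    intro χ hχ
    rw [eval_prod]
    exact Finset.prod_eq_zero (Finset.mem_erase.2 ⟨hχ, Finset.mem_univ _⟩) (by simp)
  have hqα : q.eval (α h) ≠ 0 := by
    rw [eval_prod, Finset.prod_ne_zero_iff]
    intro χ hχ
    simpa [sub_eq_zero] using hsep α χ (Finset.ne_of_mem_erase hχ).symm
  have hqx : aeval (ad ℂ L (h : L)) q x = q.eval (α h) • f α := by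
    rw [← hfx, Finsupp.sum, map_sum, Finset.sum_eq_single α]
    · exact Module.End.aeval_apply_of_mem_apply_eq_smul (hfe α)
    · intro χ _ hχ
      rw [Module.End.aeval_apply_of_mem_apply_eq_smul (hfe χ), hq0 χ hχ, zero_smul]
    · intro h0; rw [Finsupp.notMem_support_iff.1 h0, map_zero]
  have hpow : ∀ p : ℂ[X], aeval (ad ℂ L (h : L)) p x ∈ K := by
    intro p
    induction p using Polynomial.induction_on with
    | C a => simpa [Module.algebraMap_end_apply] using K.smul_mem a hxK
    | add p q hp hq => simpa using K.add_mem hp hq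
    | monomial n a hna =>
      have : aeval (ad ℂ L (h : L)) (C a * X ^ (n + 1)) x =
          ⁅(h : L), aeval (ad ℂ L (h : L)) (C a * X ^ n) x⁆ := by
        rw [pow_succ', ← mul_assoc, mul_comm (C a) X, mul_assoc, map_mul, aeval_X]
        rfl
      rw [this]
      exact K.lie_mem hhK hna
  have hfK : f α ∈ K := by
    have := K.smul_mem (q.eval (α h))⁻¹ (hqx ▸ hpow q)
    rwa [smul_smul, inv_mul_cancel₀ hqα, one_smul] at this
  obtain ⟨c, hc⟩ := exists_smul_eq_of_finrank_eq_one (IsKilling.finrank_rootSpace_eq_one α hα)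
    (x := ⟨f α, hf α⟩) (by simpa [Subtype.ext_iff] using hfα) ⟨v, hv⟩
  have hcv : c • f α = v := congrArg Subtype.val hc
  rw [← hcv]
  exact K.smul_mem c hfK

end roots

/-- Every finite-dimensional simple Lie algebra over ℂ is 3/2-generated: for every
nonzero `x` there exists `y` such that the only Lie subalgebra containing both `x`
and `y` is the whole Lie algebra. -/
theorem simple_lie_algebra_three_halves_generated
    (L : Type*) [LieRing L] [LieAlgebra ℂ L] [LieAlgebra.IsSimple ℂ L]
    [FiniteDimensional ℂ L] :
    ∀ x : L, x ≠ 0 → ∃ y : L, ∀ K : LieSubalgebra ℂ L, x ∈ K → y ∈ K → K = ⊤ := by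
  intro x hx
  obtain ⟨z, hz⟩ := LieAlgebra.exists_isCartanSubalgebra_engel ℂ L
  set H := LieSubalgebra.engel ℂ z
  obtain ⟨h, hsep⟩ := exists_separating H
  have hE : ∀ α : Weight ℂ H L, ∃ e ∈ rootSpace H (-α : H → ℂ), e ≠ 0 := by
    intro α
    obtain ⟨e, he, he0⟩ := (-α).exists_ne_zero
    exact ⟨e, he, he0⟩
  choose e he he0 using hE
  let _ := Fintype.ofFinite (Weight ℂ H L)
  obtain ⟨σ, hσ⟩ := exists_aut_forall_ne_zero H x hx
    (fun α : Weight ℂ H L => killingForm ℂ L (e α)) (fun α h0 => he0 α (by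
      have : e α ∈ LinearMap.ker (killingForm ℂ L) := h0
      rw [IsKilling.ker_killingForm_eq_bot] at this
      simpa using this)) Finset.univ
  refine ⟨σ.symm h, fun K hxK hyK => ?_⟩
  have hmap : K.map (σ : L →ₗ⁅ℂ⁆ L) = ⊤ := by
    refine generates_of_components H h hsep (σ x)
      (fun α _ => ⟨e α, he α, hσ α (Finset.mem_univ _)⟩) _ ?_ ?_
    · exact (LieSubalgebra.mem_map _ _ _).2 ⟨x, hxK, rfl⟩
    · exact (LieSubalgebra.mem_map _ _ _).2 ⟨σ.symm h, hyK, by simp⟩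
  rw [eq_top_iff]
  intro w _
  have hw : σ w ∈ K.map (σ : L →ₗ⁅ℂ⁆ L) := by rw [hmap]; trivial
  obtain ⟨w', hw', hww⟩ := (LieSubalgebra.mem_map _ _ _).1 hw
  have : w' = w := σ.injective hww
  exact this ▸ hw'
end

section
/- Let F be a finite field with |F| = q ≥ 11 and let G = PSL₂(F), the quotient of SL₂(F) by its center. (i) If q is even, then the spread and uniform spread of G both equal q−2: there exists s ∈ G such that any q−2 nontrivial elements of G have a common generating partner conjugate to s, and there exist q−1 nontrivial elements of G with no common generating partner. (ii) If q ≡ 1 (mod 4), then the spread and uniform spread of G both equal q−1: there exists s ∈ G such that any q−1 nontrivial elements have a common generating partner conjugate to s, and there exist q nontrivial elements with no common generating partner. (iii) If q ≡ 3 (mod 4), then the spread of G is at least q−3 and the uniform spread of G is at least q−4. -/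
/-- The spread of `G` is at least `k`. -/
def SpreadAtLeast (G : Type*) [Group G] (k : ℕ) : Prop :=
  ∀ x : Fin k → G, (∀ i, x i ≠ 1) →
    ∃ y : G, ∀ i, Subgroup.closure {x i, y} = ⊤

/-- The uniform spread of `G` is at least `k`. -/
def UniformSpreadAtLeast (G : Type*) [Group G] (k : ℕ) : Prop :=
  ∃ s : G, ∀ x : Fin k → G, (∀ i, x i ≠ 1) →
    ∃ y : G, IsConj s y ∧ ∀ i, Subgroup.closure {x i, y} = ⊤


section PSLHelpers
open Matrix
set_option linter.unusedSimpArgs false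
set_option linter.unusedSectionVars false
variable {F : Type*} [Field F]
local notation "SL2" => Matrix.SpecialLinearGroup (Fin 2)
local notation "PSL2" F => (Matrix.SpecialLinearGroup (Fin 2) F ⧸ Subgroup.center (Matrix.SpecialLinearGroup (Fin 2) F))

theorem sl_ext {g h : SL2 F} (h00 : g 0 0 = h 0 0) (h01 : g 0 1 = h 0 1)
    (h10 : g 1 0 = h 1 0) (h11 : g 1 1 = h 1 1) : g = h := by
  apply Matrix.SpecialLinearGroup.ext
  intro i j
  fin_cases i <;> fin_cases j <;> assumption

theorem sl_det (g : SL2 F) : g 0 0 * g 1 1 - g 0 1 * g 1 0 = 1 := by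
  have := g.det_coe
  rwa [Matrix.det_fin_two] at this

theorem sl_mul (g h : SL2 F) (i j : Fin 2) : (g * h) i j = g i 0 * h 0 j + g i 1 * h 1 j := by
  simp [Matrix.SpecialLinearGroup.coe_mul, Matrix.mul_apply, Fin.sum_univ_two]

theorem sl_inv00 (g : SL2 F) : g⁻¹ 0 0 = g 1 1 := by
  simp [Matrix.SpecialLinearGroup.SL2_inv_expl]
theorem sl_inv01 (g : SL2 F) : g⁻¹ 0 1 = - g 0 1 := by
  simp [Matrix.SpecialLinearGroup.SL2_inv_expl]
theorem sl_inv10 (g : SL2 F) : g⁻¹ 1 0 = - g 1 0 := by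
  simp [Matrix.SpecialLinearGroup.SL2_inv_expl]
theorem sl_inv11 (g : SL2 F) : g⁻¹ 1 1 = g 0 0 := by
  simp [Matrix.SpecialLinearGroup.SL2_inv_expl]

theorem sl_one00 : (1 : SL2 F) 0 0 = 1 := by simp
theorem sl_one01 : (1 : SL2 F) 0 1 = 0 := by simp
theorem sl_one10 : (1 : SL2 F) 1 0 = 0 := by simp
theorem sl_one11 : (1 : SL2 F) 1 1 = 1 := by simp

/-- Explicit elements. -/
def slm (a b c d : F) (h : a * d - b * c = 1) : SL2 F :=
  ⟨!![a, b; c, d], by rw [Matrix.det_fin_two]; simpa using h⟩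

theorem slm00 (a b c d : F) (h : a * d - b * c = 1) : slm a b c d h 0 0 = a := rfl
theorem slm01 (a b c d : F) (h : a * d - b * c = 1) : slm a b c d h 0 1 = b := rfl
theorem slm10 (a b c d : F) (h : a * d - b * c = 1) : slm a b c d h 1 0 = c := rfl
theorem slm11 (a b c d : F) (h : a * d - b * c = 1) : slm a b c d h 1 1 = d := rfl

/-- Trace. -/
def slt (g : SL2 F) : F := g 0 0 + g 1 1

theorem sl_center (g : SL2 F) : g ∈ Subgroup.center (SL2 F) ↔
    g 0 1 = 0 ∧ g 1 0 = 0 ∧ g 0 0 = g 1 1 := by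
  rw [Matrix.SpecialLinearGroup.mem_center_iff]
  constructor
  · rintro ⟨r, -, h⟩
    simp [← h]
  · rintro ⟨h1, h2, h3⟩
    refine ⟨g 0 0, ?_, ?_⟩
    · have := sl_det g
      rw [h1, ← h3, zero_mul, sub_zero] at this
      rw [Fintype.card_fin, sq]; exact this
    · ext i j
      fin_cases i <;> fin_cases j <;> simp [h1, h2, h3]

theorem sl_comm_iff (g h : SL2 F) : g * h = h * g ↔
    g 0 1 * h 1 0 = h 0 1 * g 1 0 ∧
    (g 0 0 - g 1 1) * h 0 1 = (h 0 0 - h 1 1) * g 0 1 ∧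
    (g 0 0 - g 1 1) * h 1 0 = (h 0 0 - h 1 1) * g 1 0 := by
  constructor
  · intro e
    have e00 := congrArg (fun x : SL2 F => x 0 0) e
    have e01 := congrArg (fun x : SL2 F => x 0 1) e
    have e10 := congrArg (fun x : SL2 F => x 1 0) e
    simp only [sl_mul] at e00 e01 e10
    refine ⟨by linear_combination e00, by linear_combination e01, by linear_combination -e10⟩
  · rintro ⟨h1, h2, h3⟩
    apply sl_ext <;> simp only [sl_mul]
    · linear_combination h1
    · linear_combination h2
    · linear_combination -h3
    · linear_combination -h1

/-- Upper unipotent. -/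
def slu (t : F) : SL2 F := slm 1 t 0 1 (by ring)
/-- Lower unipotent. -/
def sll (t : F) : SL2 F := slm 1 0 t 1 (by ring)
/-- Diagonal. -/
def sld (t : F) (ht : t ≠ 0) : SL2 F := slm t 0 0 t⁻¹ (by field_simp; ring)

theorem slu_mul (s t : F) : slu s * slu t = slu (s + t) := by
  apply sl_ext <;> simp only [sl_mul, slu, slm00, slm01, slm10, slm11] <;> ring

theorem sl_gen (H : Subgroup (SL2 F)) (hu : ∀ t, slu t ∈ H) (hl : ∀ t, sll t ∈ H) : H = ⊤ := by
  have key : ∀ g : SL2 F, g 1 0 ≠ 0 → g ∈ H := by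
    intro g hg
    have hd := sl_det g
    have : g = slu ((g 0 0 - 1) / g 1 0) * sll (g 1 0) * slu ((g 1 1 - 1) / g 1 0) := by
      apply sl_ext <;> simp only [sl_mul, slu, sll, slm00, slm01, slm10, slm11] <;> field_simp <;>
        first | ring1 | linear_combination -hd | linear_combination hd
    rw [this]
    exact H.mul_mem (H.mul_mem (hu _) (hl _)) (hu _)
  rw [eq_top_iff]
  intro g _
  by_cases hg : g 1 0 = 0
  · have h1 : g = (g * sll 1) * (sll 1)⁻¹ := by group
    rw [h1]
    refine H.mul_mem (key _ ?_) (H.inv_mem (hl 1))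
    have hd := sl_det g
    simp only [sl_mul, sll, slm00, slm01, slm10, slm11]
    intro h
    have : g 1 1 = 0 := by linear_combination h - hg
    simp [this, hg] at hd
  · exact key g hg

theorem slt_mul_comm (a b : SL2 F) : slt (a * b) = slt (b * a) := by
  simp only [slt, sl_mul]; ring

theorem slt_inv (a : SL2 F) : slt a⁻¹ = slt a := by
  simp only [slt, sl_inv00, sl_inv11]; ring

theorem slt_mul_inv (a b : SL2 F) : slt (a * b⁻¹) = slt a * slt b - slt (a * b) := by
  simp only [slt, sl_mul, sl_inv00, sl_inv01, sl_inv10, sl_inv11]; ring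

theorem slt_one : slt (1 : SL2 F) = 2 := by
  simp only [slt, sl_one00, sl_one11]; norm_num

theorem slt_sq (a : SL2 F) : slt (a * a) = slt a * slt a - 2 := by
  have := slt_mul_inv a a
  rw [mul_inv_cancel, slt_one] at this
  linear_combination this

theorem slt_conj (a b : SL2 F) : slt (a * b * a⁻¹) = slt b := by
  rw [slt_mul_comm, ← mul_assoc, inv_mul_cancel, one_mul]

theorem slt_four (y t : SL2 F) : slt (y * (t * y * t⁻¹)) =
    2 + slt y * slt t * slt (y * t) - slt t * slt t - slt (y * t) * slt (y * t) := by
  have h1 : y * (t * y * t⁻¹) = (y * t * y) * t⁻¹ := by group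
  have h2 : y * t * y * t = (y * t) * (y * t) := by group
  have h3 : slt (y * t * y) = slt y * slt (y * t) - slt t := by
    have e : slt (y * t * y) = slt (t * (y * y)) := by
      rw [slt_mul_comm, ← mul_assoc, slt_mul_comm]
    have e2 := slt_mul_inv (t * y) y
    have e3 : t * y * y⁻¹ = t := by group
    have e4 : t * y * y = t * (y * y) := by group
    rw [e3, e4, ← e, slt_mul_comm t y] at e2
    linear_combination e2
  rw [h1, slt_mul_inv, h2, slt_sq, h3]
  ring

theorem sl_comm_trans (x y z : SL2 F) (hx : x ∉ Subgroup.center (SL2 F))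
    (h1 : x * y = y * x) (h2 : x * z = z * x) : y * z = z * y := by
  rw [sl_comm_iff] at *
  rw [sl_center] at hx
  obtain ⟨a1, a2, a3⟩ := h1
  obtain ⟨b1, b2, b3⟩ := h2
  by_cases hb : x 0 1 = 0
  · by_cases hc : x 1 0 = 0
    · have hd : x 0 0 - x 1 1 ≠ 0 := fun h => hx ⟨hb, hc, sub_eq_zero.mp h⟩
      rw [hb, mul_zero] at a2 b2
      rw [hc, mul_zero] at a3 b3
      have e1 : y 0 1 = 0 := (mul_eq_zero.mp a2).resolve_left hd
      have e2 : y 1 0 = 0 := (mul_eq_zero.mp a3).resolve_left hd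
      have e3 : z 0 1 = 0 := (mul_eq_zero.mp b2).resolve_left hd
      have e4 : z 1 0 = 0 := (mul_eq_zero.mp b3).resolve_left hd
      simp [e1, e2, e3, e4]
    · refine ⟨?_, ?_, ?_⟩ <;> apply mul_left_cancel₀ hc
      · linear_combination (-z 1 0) * a1 + (y 1 0) * b1
      · apply mul_left_cancel₀ hc
        linear_combination (x 1 0 * z 0 1) * (-a3) + x 1 0 * y 0 1 * b3 +
           (x 0 0 - x 1 1) * (z 1 0 * a1 - y 1 0 * b1)
      · linear_combination (-z 1 0) * a3 + (y 1 0) * b3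
  · refine ⟨?_, ?_, ?_⟩ <;> apply mul_left_cancel₀ hb
    · linear_combination (z 0 1) * (-a1) + (y 0 1) * b1
    · linear_combination (-z 0 1) * a2 + (y 0 1) * b2
    · apply mul_left_cancel₀ hb
      linear_combination (x 0 1 * z 1 0) * (-a2) + x 0 1 * y 1 0 * b2 +
           (x 0 0 - x 1 1) * (y 0 1 * b1 - z 0 1 * a1)

section irr
variable {τ : F}

theorem irr_disc (hirr : ∀ r : F, r * r - τ * r + 1 ≠ 0) : τ * τ ≠ 4 := by
  intro h
  by_cases h2 : (2 : F) = 0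
  · have h4 : τ * τ = 0 := by rw [h]; linear_combination 2 * h2
    have h0 : τ = 0 := by simpa using h4
    apply hirr 1
    rw [h0]; linear_combination h2
  · apply hirr (τ / 2)
    field_simp
    linear_combination -h

theorem irr_01 (hirr : ∀ r : F, r * r - τ * r + 1 ≠ 0) (y : SL2 F) (hy : slt y = τ) : y 0 1 ≠ 0 := by
  intro h
  apply hirr (y 0 0)
  have := sl_det y
  rw [h] at this
  rw [← hy, slt]
  linear_combination -this

theorem irr_noncentral (hirr : ∀ r : F, r * r - τ * r + 1 ≠ 0) (y : SL2 F) (hy : slt y = τ) : y ∉ Subgroup.center (SL2 F) := by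
  rw [sl_center]
  exact fun h => irr_01 hirr y hy h.1

/-- the `y`-coordinate of an element commuting with `y`. -/
theorem irr_param (hirr : ∀ r : F, r * r - τ * r + 1 ≠ 0) (y : SL2 F) (hy : slt y = τ) (t : SL2 F) (h : t * y = y * t) :
    ∃ u v : F, u * u + τ * u * v + v * v = 1 ∧ t 0 0 = u + v * y 0 0 ∧ t 0 1 = v * y 0 1 ∧
      t 1 0 = v * y 1 0 ∧ t 1 1 = u + v * y 1 1 := by
  have hb := irr_01 hirr y hy
  rw [sl_comm_iff] at h
  obtain ⟨h1, h2, h3⟩ := h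
  have e1 : t 0 1 = t 0 1 / y 0 1 * y 0 1 := by field_simp
  have e2 : t 1 0 = t 0 1 / y 0 1 * y 1 0 := by
    field_simp; linear_combination -h1
  have e3 : t 1 1 = t 0 0 - t 0 1 / y 0 1 * y 0 0 + t 0 1 / y 0 1 * y 1 1 := by
    field_simp; linear_combination -h2
  have e0 : t 0 0 = (t 0 0 - t 0 1 / y 0 1 * y 0 0) + t 0 1 / y 0 1 * y 0 0 := by ring
  refine ⟨t 0 0 - t 0 1 / y 0 1 * y 0 0, t 0 1 / y 0 1, ?_, e0, e1, e2, e3⟩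
  generalize t 0 1 / y 0 1 = v at *
  generalize hu : t 0 0 - v * y 0 0 = u at *
  have hd := sl_det t
  have hd' := sl_det y
  rw [e0, e1, e2, e3] at hd
  rw [← hy, slt]
  linear_combination hd - v * v * hd'

theorem irr_aniso (hirr : ∀ r : F, r * r - τ * r + 1 ≠ 0) (y z : SL2 F) (hy : slt y = τ) (hz : slt z = τ) (h : slt (y * z) = 2) :
    z = y⁻¹ := by
  have hb := irr_01 hirr y hy
  have dy := sl_det y
  have dz := sl_det z
  simp only [slt, sl_mul] at hy hz h
  have ha : z 1 1 - y 0 0 = - (z 0 0 - y 1 1) := by linear_combination hz - hy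
  have e1 : (z 0 0 - y 1 1) * (y 0 0 - y 1 1) + (z 0 1 + y 0 1) * y 1 0
      + (z 1 0 + y 1 0) * y 0 1 = 0 := by
    linear_combination h - y 1 1 * ha - 2 * dy
  have e2 : (z 0 0 - y 1 1) * (z 0 0 - y 1 1) + (z 0 1 + y 0 1) * (z 1 0 + y 1 0) = 0 := by
    linear_combination -dz - dy + h + (z 0 0 - y 1 1) * ha
  have hB : z 0 1 + y 0 1 = 0 := by
    by_contra hB
    apply hirr (y 0 0 - y 0 1 * ((z 0 0 - y 1 1) / (z 0 1 + y 0 1)))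
    rw [← hy]
    generalize z 0 0 - y 1 1 = a at *
    generalize z 0 1 + y 0 1 = b at *
    generalize z 1 0 + y 1 0 = c at *
    field_simp
    linear_combination (-y 0 1 * b) * e1 + y 0 1 * y 0 1 * e2 + b * b * (-dy)
  rw [hB] at e1 e2
  have hA : z 0 0 - y 1 1 = 0 := by simpa using e2
  rw [hA] at e1 ha
  have hC : z 1 0 + y 1 0 = 0 := by simpa [hb] using e1
  apply sl_ext
  · rw [sl_inv00]; linear_combination hA
  · rw [sl_inv01]; linear_combination hB
  · rw [sl_inv10]; linear_combination hC
  · rw [sl_inv11]; linear_combination ha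

theorem irr_aniso' (hirr : ∀ r : F, r * r - τ * r + 1 ≠ 0) (y z : SL2 F) (hy : slt y = τ) (hz : slt z = τ)
    (h : slt (y * z) = τ * τ - 2) : z = y := by
  have := irr_aniso hirr y z⁻¹ hy (by rw [slt_inv, hz]) (by rw [slt_mul_inv, h, hy, hz]; ring)
  exact inv_injective this

theorem irr_comm_eq (hirr : ∀ r : F, r * r - τ * r + 1 ≠ 0) (y z : SL2 F) (hy : slt y = τ) (hz : slt z = τ) (h : z * y = y * z) :
    z = y ∨ z = y⁻¹ := by
  obtain ⟨u, v, hn, h00, h01, h10, h11⟩ := irr_param hirr y hy z h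
  have hd := irr_disc hirr
  have ht : 2 * u + v * τ = τ := by
    have : slt z = 2 * u + v * slt y := by simp only [slt, h00, h11]; ring
    rw [hy, hz] at this; exact this.symm
  have hv : (v * v - 1) * (τ * τ - 4) = 0 := by
    linear_combination (2 * u + v * τ + τ) * ht - 4 * hn
  have hv1 : v * v = 1 := by
    rcases mul_eq_zero.mp hv with h | h
    · linear_combination h
    · exact absurd (sub_eq_zero.mp h) hd
  have dy := sl_det y
  have hcases : (u = 0 ∧ v = 1) ∨ (u = τ ∧ v = -1) := by
    have hv2 : (v - 1) * (v + 1) = 0 := by linear_combination hv1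
    by_cases h2 : (2 : F) = 0
    · have hτ : τ ≠ 0 := by
        intro h0; apply hd; rw [h0]; linear_combination -2 * h2
      have e : v = 1 := mul_right_cancel₀ hτ (by linear_combination ht - u * h2)
      subst e
      have : u * (u + τ) = 0 := by linear_combination hn
      rcases mul_eq_zero.mp this with h | h
      · left; exact ⟨h, rfl⟩
      · right; exact ⟨by linear_combination h - τ * h2, by linear_combination h2⟩
    · rcases mul_eq_zero.mp hv2 with h | h
      · left
        have e : v = 1 := by linear_combination h
        refine ⟨?_, e⟩
        apply mul_left_cancel₀ h2; rw [e] at ht; linear_combination ht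
      · right
        have e : v = -1 := by linear_combination h
        refine ⟨?_, e⟩
        apply mul_left_cancel₀ h2; rw [e] at ht; linear_combination ht
  rcases hcases with ⟨rfl, rfl⟩ | ⟨rfl, rfl⟩
  · left
    apply sl_ext
    · linear_combination h00
    · linear_combination h01
    · linear_combination h10
    · linear_combination h11
  · right
    simp only [slt] at hy
    apply sl_ext
    · rw [sl_inv00]; linear_combination h00 - hy
    · rw [sl_inv01]; linear_combination h01
    · rw [sl_inv10]; linear_combination h10
    · rw [sl_inv11]; linear_combination h11 - hy

theorem irr_inverts (hirr : ∀ r : F, r * r - τ * r + 1 ≠ 0) (x y : SL2 F) (hy : slt y = τ) (h : x * y * x⁻¹ = y⁻¹) :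
    slt x = 0 ∧ slt (x * y) = 0 := by
  have hd := irr_disc hirr
  have e1 : x * y = y⁻¹ * x := by rw [← h]; group
  have e2 : x = y * (x * y) := by rw [e1]; group
  have t1 : slt (x * y) = slt x * τ - slt (x * y) := by
    conv_lhs => rw [e1, slt_mul_comm, slt_mul_inv, hy]
  have t2 : slt x = slt (x * y) * τ - slt x := by
    conv_lhs => rw [e2, slt_mul_comm]
    have := slt_mul_inv (x * y) y
    have e3 : x * y * y⁻¹ = x := by group
    rw [e3, hy] at this
    linear_combination this
  have hd' : τ * τ - 4 ≠ 0 := sub_ne_zero.mpr hd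
  constructor
  · apply mul_left_cancel₀ hd'
    linear_combination (-τ) * t1 - 2 * t2
  · apply mul_left_cancel₀ hd'
    linear_combination (-τ) * t2 - 2 * t1

end irr

/-- The crucial trace identity. -/
theorem irr_rho {τ : F} (x y t : SL2 F) (hy : slt y = τ) (u v : F) (hn : u * u + τ * u * v + v * v = 1)
    (h00 : t 0 0 = u + v * y 0 0) (h01 : t 0 1 = v * y 0 1)
    (h10 : t 1 0 = v * y 1 0) (h11 : t 1 1 = u + v * y 1 1) :
    slt (y * ((x * t * x⁻¹) * y * (x * t * x⁻¹)⁻¹)) = τ * τ - 2 -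
      v * v * ((slt (y * (x * y * x⁻¹)) - 2) * (slt (y * (x * y * x⁻¹)) - τ * τ + 2)) := by
  rw [slt_four, slt_conj]
  have e1 : slt t = 2 * u + v * τ := by rw [← hy]; simp only [slt, h00, h11]; ring
  have e2 : slt (y * (x * t * x⁻¹)) = u * τ + v * slt (y * (x * y * x⁻¹)) := by
    have dx := sl_det x
    rw [← hy]
    simp only [slt, sl_mul, h00, h01, h10, h11, sl_inv00, sl_inv01, sl_inv10, sl_inv11]
    linear_combination u * (y 0 0 + y 1 1) * dx
  rw [e1, e2, hy]
  linear_combination (τ * τ - 4) * hn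

section count
variable [Fintype F] [DecidableEq F]

theorem conic_card {τ : F} (hirr : ∀ r : F, r * r - τ * r + 1 ≠ 0) :
    (Finset.univ.filter (fun p : F × F => p.1 * p.1 + τ * p.1 * p.2 + p.2 * p.2 = 1)).card
      ≤ Fintype.card F + 1 := by
  let f : Option F → F × F := fun o => match o with
    | none => (1, -τ)
    | some m => (1 + -(2 + τ * m) / (1 + τ * m + m * m), m * (-(2 + τ * m) / (1 + τ * m + m * m)))
  have hsub : (Finset.univ.filter
      (fun p : F × F => p.1 * p.1 + τ * p.1 * p.2 + p.2 * p.2 = 1)) ⊆ Finset.univ.image f := by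
    rintro ⟨u, v⟩ h
    simp only [Finset.mem_filter, Finset.mem_univ, true_and] at h
    rw [Finset.mem_image]
    by_cases hu : u = 1
    · subst hu
      have h' : v * (v + τ) = 0 := by linear_combination h
      rcases mul_eq_zero.mp h' with hv | hv
      · subst hv
        by_cases hτ : τ = 0
        · exact ⟨none, Finset.mem_univ _, by simp [f, hτ]⟩
        · refine ⟨some (-2 / τ), Finset.mem_univ _, ?_⟩
          have : 2 + τ * (-2 / τ) = 0 := by field_simp; ring
          simp only [f, this, neg_zero, zero_div, mul_zero, add_zero]
      · exact ⟨none, Finset.mem_univ _, by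
          simp only [f, Prod.mk.injEq, true_and]; linear_combination -hv⟩
    · have hs : u - 1 ≠ 0 := sub_ne_zero.mpr hu
      refine ⟨some (v / (u - 1)), Finset.mem_univ _, ?_⟩
      have hm : 1 + τ * (v / (u - 1)) + v / (u - 1) * (v / (u - 1)) ≠ 0 := by
        have := hirr (-(v / (u - 1)))
        intro h; apply this; linear_combination h
      have key : -(2 + τ * (v / (u - 1))) / (1 + τ * (v / (u - 1)) + v / (u - 1) * (v / (u - 1)))
          = u - 1 := by
        rw [div_eq_iff hm]
        field_simp
        linear_combination -h
      simp only [f, key, Prod.mk.injEq]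
      constructor
      · ring
      · field_simp
  calc _ ≤ _ := Finset.card_le_card hsub
    _ ≤ _ := Finset.card_image_le
    _ = _ := by simp

theorem circle_card3 {τ : F} (h2 : (2 : F) ≠ 0) (hm : ∀ m : F, 1 + m * m ≠ 0) :
    (Finset.univ.filter (fun p : F × F => p.1 * (τ - p.1) - p.2 * p.2 = 1)).card
      ≤ Fintype.card F + 1 := by
  rcases Finset.eq_empty_or_nonempty
    (Finset.univ.filter (fun p : F × F => p.1 * (τ - p.1) - p.2 * p.2 = 1)) with h0 | ⟨⟨a, b⟩, h0⟩
  · rw [h0]; simp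
  simp only [Finset.mem_filter, Finset.mem_univ, true_and] at h0
  let f : Option F → F × F := fun o => match o with
    | none => (a, -b)
    | some m => (a + -(2 * a - τ + 2 * m * b) / (1 + m * m),
        b + m * (-(2 * a - τ + 2 * m * b) / (1 + m * m)))
  have hsub : (Finset.univ.filter
      (fun p : F × F => p.1 * (τ - p.1) - p.2 * p.2 = 1)) ⊆ Finset.univ.image f := by
    rintro ⟨u, v⟩ h
    simp only [Finset.mem_filter, Finset.mem_univ, true_and] at h
    rw [Finset.mem_image]
    by_cases hu : u = a
    · subst hu
      have h' : (v - b) * (v + b) = 0 := by linear_combination h0 - h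
      by_cases hv : v + b = 0
      · exact ⟨none, Finset.mem_univ _, by
          simp only [f, Prod.mk.injEq, true_and]; linear_combination -hv⟩
      · have hvb : v = b := sub_eq_zero.mp ((mul_eq_zero.mp h').resolve_right hv)
        subst hvb
        have hv0 : v ≠ 0 := by rintro rfl; simp at hv
        refine ⟨some ((τ - 2 * u) / (2 * v)), Finset.mem_univ _, ?_⟩
        have : 2 * u - τ + 2 * ((τ - 2 * u) / (2 * v)) * v = 0 := by field_simp; ring
        simp only [f, this, neg_zero, zero_div, mul_zero, add_zero]
    · have hs : u - a ≠ 0 := sub_ne_zero.mpr hu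
      refine ⟨some ((v - b) / (u - a)), Finset.mem_univ _, ?_⟩
      have key : -(2 * a - τ + 2 * ((v - b) / (u - a)) * b) /
          (1 + (v - b) / (u - a) * ((v - b) / (u - a))) = u - a := by
        rw [div_eq_iff (hm _)]
        field_simp
        linear_combination h - h0
      simp only [f, key, Prod.mk.injEq]
      constructor
      · ring
      · field_simp; ring
  calc _ ≤ _ := Finset.card_le_card hsub
    _ ≤ _ := Finset.card_image_le
    _ = _ := by simp

theorem circle_card1 {τ : F} (h2 : (2 : F) ≠ 0) (hτ : τ * τ ≠ 4) (i : F) (hi : i * i = -1) :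
    (Finset.univ.filter (fun p : F × F => p.1 * (τ - p.1) - p.2 * p.2 = 1)).card
      ≤ Fintype.card F - 1 := by
  have hc : (Finset.univ.erase (0 : F)).card = Fintype.card F - 1 := by
    rw [Finset.card_erase_of_mem (Finset.mem_univ _), Finset.card_univ]
  rw [← hc]
  have hprod : ∀ u v : F, u * (τ - u) - v * v = 1 →
      (2 * u - τ + 2 * i * v) * (2 * u - τ - 2 * i * v) = τ * τ - 4 := by
    intro u v h; linear_combination -4 * h - 4 * v * v * hi
  have hne : τ * τ - 4 ≠ 0 := sub_ne_zero.mpr hτ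
  have hi0 : i ≠ 0 := by rintro rfl; simp at hi
  apply Finset.card_le_card_of_injOn (fun p : F × F => 2 * p.1 - τ + 2 * i * p.2)
  · rintro ⟨u, v⟩ h
    simp only [Finset.coe_filter, Finset.mem_univ, true_and, Set.mem_ofPred_eq] at h
    simp only [Finset.coe_erase, Finset.coe_univ, Set.mem_sdiff, Set.mem_univ, true_and,
      Set.mem_singleton_iff]
    intro h'
    have := hprod u v h
    rw [h', zero_mul] at this
    exact hne this.symm
  · rintro ⟨u, v⟩ h ⟨u', v'⟩ h' he
    simp only [Finset.coe_filter, Finset.mem_univ, true_and, Set.mem_ofPred_eq] at h h' he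
    have e1 := hprod u v h
    have e2 := hprod u' v' h'
    rw [he] at e1
    have hn : 2 * u' - τ + 2 * i * v' ≠ 0 := by
      intro h'; rw [h', zero_mul] at e2; exact hne e2.symm
    have e3 : 2 * u - τ - 2 * i * v = 2 * u' - τ - 2 * i * v' :=
      mul_left_cancel₀ hn (e1.trans e2.symm)
    have h4 : (4 : F) ≠ 0 := by
      have : (4 : F) = 2 * 2 := by norm_num
      rw [this]; exact mul_ne_zero h2 h2
    rw [Prod.mk.injEq]
    constructor
    · apply mul_left_cancel₀ h4; linear_combination he + e3
    · apply mul_left_cancel₀ (mul_ne_zero h4 hi0); linear_combination he - e3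

theorem circle_card2 {τ : F} (h2 : (2 : F) = 0) :
    (Finset.univ.filter (fun p : F × F => p.1 * (τ - p.1) - p.2 * p.2 = 1)).card
      ≤ Fintype.card F := by
  rw [← Finset.card_univ]
  apply Finset.card_le_card_of_injOn (fun p : F × F => p.1)
  · intro p _; simp
  · rintro ⟨u, v⟩ h ⟨u', v'⟩ h' he
    simp only [Finset.coe_filter, Finset.mem_univ, true_and, Set.mem_ofPred_eq] at h h' he
    subst he
    have : (v - v') * (v - v') = 0 := by
      linear_combination h' - h + (v' * v' - v * v') * h2
    have : v = v' := by simpa [sub_eq_zero] using this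
    rw [this]

theorem bad2_card (τ : F) (x : SL2 F) (hx : x ∉ Subgroup.center (SL2 F)) (hx0 : slt x = 0) :
    (Finset.univ.filter (fun y : SL2 F => slt y = τ ∧ slt (x * y) = 0)).card ≤
    (Finset.univ.filter (fun p : F × F => p.1 * (τ - p.1) - p.2 * p.2 = 1)).card := by
  have hd := sl_det x
  have h11 : x 1 1 = - x 0 0 := by rw [slt] at hx0; linear_combination hx0
  obtain ⟨p, r, hpr⟩ : ∃ p r : F, p * (x 1 0 * p + x 1 1 * r) - r * (x 0 0 * p + x 0 1 * r) ≠ 0 := by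
    by_contra hcon
    push Not at hcon
    apply hx
    rw [sl_center]
    have e1 := hcon 1 0
    have e2 := hcon 0 1
    have e3 := hcon 1 1
    refine ⟨by linear_combination -e2, by linear_combination e1, by
      linear_combination e1 + e2 - e3⟩
  let P : Matrix (Fin 2) (Fin 2) F :=
    !![p, x 0 0 * p + x 0 1 * r; r, x 1 0 * p + x 1 1 * r]
  have hP : IsUnit P.det := by
    rw [isUnit_iff_ne_zero, Matrix.det_fin_two]
    simp only [P, Matrix.of_apply, Matrix.cons_val', Matrix.cons_val_zero, Matrix.cons_val_one,
      Matrix.cons_val_fin_one]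
    intro h; apply hpr; linear_combination h
  have hxP : (x : Matrix (Fin 2) (Fin 2) F) * P = P * !![0, -1; 1, 0] := by
    ext i j
    fin_cases i <;> fin_cases j <;>
      simp [P, Matrix.mul_apply, Fin.sum_univ_two, h11]
    · rw [h11] at hd; linear_combination -p * hd
    · rw [h11] at hd; linear_combination -r * hd
  let M : SL2 F → Matrix (Fin 2) (Fin 2) F := fun y => P⁻¹ * (y : Matrix (Fin 2) (Fin 2) F) * P
  have hMinj : ∀ y y', M y = M y' → y = y' := by
    intro y y' h
    apply Subtype.ext
    have e : ∀ y, (y : Matrix (Fin 2) (Fin 2) F) = P * (P⁻¹ * y * P) * P⁻¹ := by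
      intro y
      rw [← mul_assoc, ← mul_assoc, Matrix.mul_nonsing_inv _ hP, one_mul, mul_assoc,
        Matrix.mul_nonsing_inv _ hP, mul_one]
    rw [e y.1, e y'.1]
    exact congrArg (fun A => P * A * P⁻¹) h
  have hMtr : ∀ y, M y 0 0 + M y 1 1 = slt y := by
    intro y
    have : Matrix.trace (M y) = Matrix.trace (y : Matrix (Fin 2) (Fin 2) F) := by
      simp only [M]
      rw [Matrix.trace_mul_comm, ← mul_assoc, Matrix.mul_nonsing_inv _ hP, one_mul]
    rw [Matrix.trace_fin_two, Matrix.trace_fin_two] at this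
    exact this
  have hMdet : ∀ y, M y 0 0 * M y 1 1 - M y 0 1 * M y 1 0 = 1 := by
    intro y
    rw [← Matrix.det_fin_two]
    simp only [M, Matrix.det_mul, y.det_coe, mul_one]
    rw [← Matrix.det_mul, Matrix.nonsing_inv_mul _ hP, Matrix.det_one]
  have hMx : ∀ y, M y 0 1 - M y 1 0 = slt (x * y) := by
    intro y
    have h1 : Matrix.trace (!![0, -1; 1, 0] * M y) =
        Matrix.trace ((x : Matrix (Fin 2) (Fin 2) F) * (y : Matrix (Fin 2) (Fin 2) F)) := by
      have : !![0, -1; 1, 0] = P⁻¹ * ((x : Matrix (Fin 2) (Fin 2) F) * P) := by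
        rw [hxP, ← mul_assoc, Matrix.nonsing_inv_mul _ hP, one_mul]
      rw [this]
      have e : P⁻¹ * ((x : Matrix (Fin 2) (Fin 2) F) * P) * M y = P⁻¹ * (x * y) * P := by
        simp only [M]
        have : P⁻¹ * ((x : Matrix (Fin 2) (Fin 2) F) * P) * (P⁻¹ * y * P)
          = P⁻¹ * x * (P * P⁻¹) * y * P := by simp only [mul_assoc]
        rw [this, Matrix.mul_nonsing_inv _ hP, mul_one]
        simp only [mul_assoc]
      rw [e, Matrix.trace_mul_comm, ← mul_assoc, Matrix.mul_nonsing_inv _ hP, one_mul]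
    rw [← Matrix.SpecialLinearGroup.coe_mul] at h1
    rw [Matrix.trace_fin_two, Matrix.trace_fin_two] at h1
    simp [Matrix.mul_apply, Fin.sum_univ_two] at h1
    rw [slt, sl_mul, sl_mul]
    linear_combination h1
  apply Finset.card_le_card_of_injOn (fun y => (M y 0 0, M y 0 1))
  · intro y hy
    simp only [Finset.coe_filter, Finset.mem_univ, true_and, Set.mem_ofPred_eq] at hy ⊢
    have e1 := hMtr y
    have e2 := hMx y
    have e3 := hMdet y
    rw [hy.1] at e1
    rw [hy.2] at e2
    linear_combination e3 - M y 0 0 * e1 - M y 0 1 * e2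
  · intro y hy y' hy' he
    simp only [Finset.coe_filter, Finset.mem_univ, true_and, Set.mem_ofPred_eq] at hy hy'
    simp only [Prod.mk.injEq] at he
    apply hMinj
    have e1 := hMtr y
    have e2 := hMx y
    have e1' := hMtr y'
    have e2' := hMx y'
    rw [hy.1] at e1
    rw [hy.2] at e2
    rw [hy'.1] at e1'
    rw [hy'.2] at e2'
    ext i j
    fin_cases i <;> fin_cases j
    · exact he.1
    · exact he.2
    · show M y 1 0 = M y' 1 0
      linear_combination he.2 - e2 + e2'
    · show M y 1 1 = M y' 1 1
      linear_combination e1 - e1' - he.1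

theorem bad1_card {τ : F} (hirr : ∀ r : F, r * r - τ * r + 1 ≠ 0)
    (x : SL2 F) (hx : x ∉ Subgroup.center (SL2 F)) :
    (Finset.univ.filter (fun y : SL2 F => slt y = τ ∧ x * y = y * x)).card ≤ 2 := by
  rcases Finset.eq_empty_or_nonempty
    (Finset.univ.filter (fun y : SL2 F => slt y = τ ∧ x * y = y * x)) with h0 | ⟨y, h0⟩
  · rw [h0]; simp
  simp only [Finset.mem_filter, Finset.mem_univ, true_and] at h0
  refine (Finset.card_le_card (t := {y, y⁻¹}) ?_).trans Finset.card_le_two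
  intro z hz
  simp only [Finset.mem_filter, Finset.mem_univ, true_and] at hz
  have := irr_comm_eq hirr y z h0.1 hz.1 (sl_comm_trans x z y hx hz.2 h0.2)
  simpa using this

theorem Y_card_ge (τ : F) : Fintype.card F * (Fintype.card F - 1) ≤
    (Finset.univ.filter (fun y : SL2 F => slt y = τ)).card := by
  have hc : ((Finset.univ : Finset F) ×ˢ (Finset.univ.erase (0 : F))).card =
      Fintype.card F * (Fintype.card F - 1) := by
    rw [Finset.card_product, Finset.card_erase_of_mem (Finset.mem_univ _), Finset.card_univ]
  rw [← hc]
  let f : F × F → SL2 F := fun p => if h : p.2 ≠ 0 then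
    slm p.1 p.2 ((p.1 * (τ - p.1) - 1) / p.2) (τ - p.1) (by field_simp; ring) else 1
  apply Finset.card_le_card_of_injOn f
  · rintro ⟨a, b⟩ h
    have hb : b ≠ 0 := by simpa using h
    rw [Finset.mem_coe, Finset.mem_filter]
    refine ⟨Finset.mem_univ _, ?_⟩
    simp only [f, hb, ne_eq, not_false_eq_true, dif_pos, slt, slm00, slm11]
    ring
  · rintro ⟨a, b⟩ h ⟨a', b'⟩ h' he
    have hb : b ≠ 0 := by simpa using h
    have hb' : b' ≠ 0 := by simpa using h'
    simp only [f, hb, hb', ne_eq, not_false_eq_true, dif_pos] at he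
    have e0 := congrArg (fun g : SL2 F => g 0 0) he
    have e1 := congrArg (fun g : SL2 F => g 0 1) he
    simp only [slm00, slm01] at e0 e1
    rw [e0, e1]

theorem Y_card_le {τ : F} (hirr : ∀ r : F, r * r - τ * r + 1 ≠ 0) :
    (Finset.univ.filter (fun y : SL2 F => slt y = τ)).card ≤
    Fintype.card F * (Fintype.card F - 1) := by
  have hc : ((Finset.univ : Finset F) ×ˢ (Finset.univ.erase (0 : F))).card =
      Fintype.card F * (Fintype.card F - 1) := by
    rw [Finset.card_product, Finset.card_erase_of_mem (Finset.mem_univ _), Finset.card_univ]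
  rw [← hc]
  apply Finset.card_le_card_of_injOn (fun y => (y 0 0, y 0 1))
  · intro y h
    simp only [Finset.coe_filter, Finset.mem_univ, true_and, Set.mem_ofPred_eq] at h
    simpa using irr_01 hirr y h
  · intro y h y' h' he
    simp only [Finset.coe_filter, Finset.mem_univ, true_and, Set.mem_ofPred_eq] at h h'
    have hb := irr_01 hirr y h
    simp only [Prod.mk.injEq] at he
    have d := sl_det y
    have d' := sl_det y'
    have e11 : y 1 1 = y' 1 1 := by
      simp only [slt] at h h'; linear_combination h - h' - he.1
    refine sl_ext he.1 he.2 ?_ e11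
    apply mul_left_cancel₀ hb
    rw [← he.1, ← he.2, ← e11] at d'
    linear_combination d' - d

theorem T_card_le {τ : F} (hirr : ∀ r : F, r * r - τ * r + 1 ≠ 0) (y : SL2 F) (hy : slt y = τ) :
    (Finset.univ.filter (fun t : SL2 F => t * y = y * t)).card ≤ Fintype.card F + 1 := by
  refine le_trans ?_ (conic_card hirr)
  apply Finset.card_le_card_of_injOn
    (fun t => (t 0 0 - t 0 1 / y 0 1 * y 0 0, t 0 1 / y 0 1))
  · intro t ht
    simp only [Finset.coe_filter, Finset.mem_univ, true_and, Set.mem_ofPred_eq] at ht ⊢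
    obtain ⟨u, v, hn, h00, h01, h10, h11⟩ := irr_param hirr y hy t ht
    have hb := irr_01 hirr y hy
    have e1 : t 0 1 / y 0 1 = v := by rw [h01]; field_simp
    have e2 : t 0 0 - v * y 0 0 = u := by rw [h00]; ring
    rw [e1, e2]; exact hn
  · intro t ht t' ht' he
    simp only [Finset.coe_filter, Finset.mem_univ, true_and, Set.mem_ofPred_eq] at ht ht'
    simp only [Prod.mk.injEq] at he
    obtain ⟨u, v, hn, h00, h01, h10, h11⟩ := irr_param hirr y hy t ht
    obtain ⟨u', v', hn', h00', h01', h10', h11'⟩ := irr_param hirr y hy t' ht'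
    have hb := irr_01 hirr y hy
    have e1 : t 0 1 / y 0 1 = v := by rw [h01]; field_simp
    have e2 : t 0 0 - v * y 0 0 = u := by rw [h00]; ring
    have e1' : t' 0 1 / y 0 1 = v' := by rw [h01']; field_simp
    have e2' : t' 0 0 - v' * y 0 0 = u' := by rw [h00']; ring
    rw [e1, e1', e2, e2'] at he
    obtain ⟨rfl, rfl⟩ := he
    apply sl_ext
    · rw [h00, h00']
    · rw [h01, h01']
    · rw [h10, h10']
    · rw [h11, h11']

end count

section tau
variable [Fintype F] [DecidableEq F]

theorem fixed_in_range {L : Type*} [Field L] [Algebra F L] (z : L)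
    (hz : z ^ Fintype.card F = z) : ∃ a : F, algebraMap F L a = z := by
  classical
  have h1 : 1 < Fintype.card F := Fintype.one_lt_card
  have hne := FiniteField.X_pow_card_sub_X_ne_zero L h1
  set P : Polynomial L := Polynomial.X ^ Fintype.card F - Polynomial.X with hP
  have hsub : (Finset.univ.image (algebraMap F L)) ⊆ P.roots.toFinset := by
    intro w hw
    obtain ⟨a, -, rfl⟩ := Finset.mem_image.1 hw
    rw [Multiset.mem_toFinset, Polynomial.mem_roots hne, Polynomial.IsRoot, hP]
    simp only [Polynomial.eval_sub, Polynomial.eval_pow, Polynomial.eval_X]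
    rw [← map_pow, FiniteField.pow_card, sub_self]
  have hcard : P.roots.toFinset.card ≤ (Finset.univ.image (algebraMap F L)).card := by
    rw [Finset.card_image_of_injective _ (algebraMap F L).injective, Finset.card_univ]
    refine (Multiset.toFinset_card_le _).trans ((Polynomial.card_roots' _).trans ?_)
    rw [hP, FiniteField.X_pow_card_sub_X_natDegree_eq L h1]
  have he := Finset.eq_of_subset_of_card_le hsub hcard
  have hmem : z ∈ P.roots.toFinset := by
    rw [Multiset.mem_toFinset, Polynomial.mem_roots hne, Polynomial.IsRoot, hP]
    simp only [Polynomial.eval_sub, Polynomial.eval_pow, Polynomial.eval_X]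
    rw [hz, sub_self]
  rw [← he] at hmem
  obtain ⟨a, -, ha⟩ := Finset.mem_image.1 hmem
  exact ⟨a, ha⟩

theorem eig_pow {L : Type*} [Field L] [Algebra F L] (ζ : L) (y : SL2 F)
    (hζ : ζ * ζ - algebraMap F L (slt y) * ζ + 1 = 0) (m : ℕ) :
    algebraMap F L ((y ^ m) 0 0) * algebraMap F L (y 0 1) +
      algebraMap F L ((y ^ m) 0 1) * (ζ - algebraMap F L (y 0 0)) =
      ζ ^ m * algebraMap F L (y 0 1) := by
  induction m with
  | zero => simp
  | succ m ih =>
    have hd := congrArg (algebraMap F L) (sl_det y)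
    simp only [slt, map_sub, map_mul, map_one, map_add] at hd hζ
    rw [pow_succ, sl_mul, sl_mul, pow_succ]
    simp only [map_add, map_mul]
    linear_combination ζ * ih - algebraMap F L ((y ^ m) 0 1) * hζ +
      algebraMap F L ((y ^ m) 0 1) * (-hd)

theorem exists_tau (h3 : 3 ≤ Fintype.card F) : ∃ τ : F, (∀ r : F, r * r - τ * r + 1 ≠ 0) ∧
    ∀ y : SL2 F, slt y = τ → (∀ t, t * y = y * t → t ∈ Subgroup.zpowers y) ∧
      Nat.card (Subgroup.zpowers y) = Fintype.card F + 1 := by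
  let L := AlgebraicClosure F
  have hne : NeZero (((Fintype.card F + 1 : ℕ) : L)) := by
    constructor
    have h0 : ((Fintype.card F : ℕ) : L) = 0 := by
      rw [← map_natCast (algebraMap F L), Nat.cast_card_eq_zero, map_zero]
    rw [Nat.cast_add, h0]; simp
  obtain ⟨ζ, hζ⟩ := HasEnoughRootsOfUnity.exists_primitiveRoot L (Fintype.card F + 1)
  have hζ1 : ζ ^ Fintype.card F * ζ = 1 := by rw [← pow_succ]; exact hζ.pow_eq_one
  have hζ0 : ζ ≠ 0 := by rintro rfl; simp at hζ1
  have hfr : ζ ^ Fintype.card F = ζ⁻¹ := eq_inv_of_mul_eq_one_left hζ1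
  have hfix : (ζ + ζ⁻¹) ^ Fintype.card F = ζ + ζ⁻¹ := by
    have := map_add (FiniteField.frobeniusAlgHom F L) ζ ζ⁻¹
    simp only [FiniteField.coe_frobeniusAlgHom] at this
    rw [this, inv_pow, hfr, inv_inv, add_comm]
  obtain ⟨τ, hτ⟩ := fixed_in_range (F := F) _ hfix
  have hq : ζ * ζ - algebraMap F L τ * ζ + 1 = 0 := by
    rw [hτ]; linear_combination -(mul_inv_cancel₀ hζ0)
  have hirr : ∀ r : F, r * r - τ * r + 1 ≠ 0 := by
    intro r hr
    have hr' := congrArg (algebraMap F L) hr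
    simp only [map_sub, map_mul, map_one, map_add, map_zero, hτ] at hr'
    have hr0 : r ≠ 0 := by rintro rfl; simp at hr
    have hp : (algebraMap F L r - ζ) * (algebraMap F L r - ζ⁻¹) = 0 := by
      have : ζ * ζ⁻¹ = 1 := mul_inv_cancel₀ hζ0
      linear_combination hr' + this
    have hpow : (algebraMap F L r) ^ (Fintype.card F - 1) = 1 := by
      rw [← map_pow, FiniteField.pow_card_sub_one_eq_one r hr0, map_one]
    have hz : ζ ^ (Fintype.card F - 1) = 1 := by
      rcases mul_eq_zero.1 hp with h | h
      · rwa [sub_eq_zero.1 h] at hpow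
      · rw [sub_eq_zero.1 h, inv_pow] at hpow
        exact inv_eq_one.1 hpow
    have := Nat.le_of_dvd (by omega) (hζ.dvd_of_pow_eq_one _ hz)
    omega
  refine ⟨τ, hirr, ?_⟩
  intro y hy
  have hdvd : Fintype.card F + 1 ∣ orderOf y := by
    apply hζ.dvd_of_pow_eq_one
    have := eig_pow ζ y (by rw [hy]; exact hq) (orderOf y)
    rw [pow_orderOf_eq_one, sl_one00, sl_one01, map_one, map_zero, one_mul, zero_mul, add_zero] at this
    have hb : algebraMap F L (y 0 1) ≠ 0 := by
      rw [Ne, map_eq_zero]; exact irr_01 hirr y hy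
    exact mul_right_cancel₀ hb (by rw [← this, one_mul])
  have hle := Nat.le_of_dvd (orderOf_pos y) hdvd
  have hT := T_card_le hirr y hy
  have hz : Nat.card (Subgroup.zpowers y) = orderOf y := Nat.card_zpowers y
  have hzf : (Finset.univ.filter (fun t => t ∈ Subgroup.zpowers y)).card = orderOf y := by
    rw [← hz, Nat.card_eq_fintype_card, Fintype.card_subtype]
  have hsub : (Finset.univ.filter (fun t => t ∈ Subgroup.zpowers y)) ⊆
      (Finset.univ.filter (fun t : SL2 F => t * y = y * t)) := by
    intro t ht
    rw [Finset.mem_filter] at ht ⊢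
    refine ⟨Finset.mem_univ _, ?_⟩
    obtain ⟨k, rfl⟩ := Subgroup.mem_zpowers_iff.1 ht.2
    exact (Commute.refl y).zpow_left k
  have heq := Finset.eq_of_subset_of_card_le hsub (by omega)
  constructor
  · intro t ht
    have : t ∈ (Finset.univ.filter (fun t : SL2 F => t * y = y * t)) :=
      Finset.mem_filter.2 ⟨Finset.mem_univ _, ht⟩
    rw [← heq, Finset.mem_filter] at this
    exact this.2
  · have := Finset.card_le_card hsub
    omega

end tau

section conj
variable [Fintype F] [DecidableEq F]

theorem exists_form (a b c : F) (ha : a ≠ 0) (hD : b * b - 4 * a * c ≠ 0) :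
    ∃ p r : F, a * p * p + b * p * r + c * r * r = 1 := by
  by_cases h2 : ringChar F = 2
  · obtain ⟨s, hs⟩ := FiniteField.isSquare_of_char_two h2 a⁻¹
    refine ⟨s, 0, ?_⟩
    have : a * a⁻¹ = 1 := mul_inv_cancel₀ ha
    rw [hs] at this
    linear_combination this
  · have hodd := FiniteField.odd_card_of_char_ne_two h2
    have h20 : (2 : F) ≠ 0 := Ring.two_ne_zero h2
    set D := b * b - 4 * a * c with hDdef
    obtain ⟨x, r, h⟩ := FiniteField.exists_root_sum_quadratic
      (f := Polynomial.X ^ 2 - Polynomial.C (4 * a)) (g := Polynomial.C (-D) * Polynomial.X ^ 2)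
      (by compute_degree!) (by compute_degree!) hodd
    simp only [Polynomial.eval_sub, Polynomial.eval_pow, Polynomial.eval_X, Polynomial.eval_C,
      Polynomial.eval_mul] at h
    refine ⟨(x - b * r) / (2 * a), r, ?_⟩
    field_simp
    linear_combination h + r ^ 2 * hDdef

theorem conj_comp {τ : F} (hirr : ∀ r : F, r * r - τ * r + 1 ≠ 0) (y : SL2 F) (hy : slt y = τ) :
    IsConj (slm 0 (-1) 1 τ (by ring)) y := by
  have hd := sl_det y
  have hD := irr_disc hirr
  have h10 : y 1 0 ≠ 0 := by
    intro h0
    apply hirr (y 0 0)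
    rw [← hy, slt]
    linear_combination -hd - y 0 1 * h0
  obtain ⟨p, r, h⟩ := exists_form (y 1 0) (y 1 1 - y 0 0) (-y 0 1) h10 (by
    intro h0
    apply hD
    rw [← hy, slt]
    linear_combination h0 + 4 * hd)
  have hP : p * (y 1 0 * p + y 1 1 * r) - (y 0 0 * p + y 0 1 * r) * r = 1 := by
    linear_combination h
  rw [isConj_iff]
  refine ⟨slm p (y 0 0 * p + y 0 1 * r) r (y 1 0 * p + y 1 1 * r) hP, ?_⟩
  rw [mul_inv_eq_iff_eq_mul]
  have ht : τ = y 0 0 + y 1 1 := hy.symm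
  apply sl_ext <;> simp only [sl_mul, slm00, slm01, slm10, slm11] <;>
    first | ring1 | linear_combination (y 0 0 * p + y 0 1 * r) * ht + p * hd | linear_combination (y 1 0 * p + y 1 1 * r) * ht + r * hd

theorem conj_tau {τ : F} (hirr : ∀ r : F, r * r - τ * r + 1 ≠ 0) (y z : SL2 F) (hy : slt y = τ)
    (hz : slt z = τ) : IsConj y z :=
  (conj_comp hirr y hy).symm.trans (conj_comp hirr z hz)

end conj

section keylemma
variable [Fintype F] [DecidableEq F]

theorem index_mul_le (H : Subgroup (SL2 F)) (y : SL2 F) (hT : ∀ t, t * y = y * t → t ∈ H)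
    (C : Finset (SL2 F)) (hC : ∀ z ∈ C, ∃ h ∈ H, h * y * h⁻¹ = z) :
    H.index * C.card ≤ (Finset.univ.filter (fun z : SL2 F => slt z = slt y)).card := by
  classical
  have h1 : H.index * C.card = ((Finset.univ : Finset (SL2 F ⧸ H)) ×ˢ C).card := by
    rw [Finset.card_product, Finset.card_univ, Subgroup.index, Nat.card_eq_fintype_card]
  rw [h1]
  apply Finset.card_le_card_of_injOn (fun p => p.1.out * p.2 * p.1.out⁻¹)
  · rintro ⟨k, z⟩ hp
    rw [Finset.mem_coe, Finset.mem_product] at hp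
    obtain ⟨h, hh, rfl⟩ := hC z hp.2
    rw [Finset.mem_coe, Finset.mem_filter]
    refine ⟨Finset.mem_univ _, ?_⟩
    rw [slt_conj, slt_conj]
  · rintro ⟨k, z⟩ hp ⟨k', z'⟩ hp' he
    rw [Finset.mem_coe, Finset.mem_product] at hp hp'
    obtain ⟨h, hh, hz⟩ := hC z hp.2
    obtain ⟨h', hh', hz'⟩ := hC z' hp'.2
    simp only at he hz hz'
    have hk : k = k' := by
      rw [← QuotientGroup.out_eq' k, ← QuotientGroup.out_eq' k', QuotientGroup.eq]
      have hc : ((k.out * h)⁻¹ * (k'.out * h')) * y = y * ((k.out * h)⁻¹ * (k'.out * h')) := by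
        rw [← hz, ← hz'] at he
        have : (k.out * h) * y * (k.out * h)⁻¹ = (k'.out * h') * y * (k'.out * h')⁻¹ := by
          calc _ = k.out * (h * y * h⁻¹) * k.out⁻¹ := by group
            _ = _ := he
            _ = _ := by group
        have e2 : y = (k.out * h)⁻¹ * ((k'.out * h') * y * (k'.out * h')⁻¹) * (k.out * h) := by
          rw [← this]; group
        calc _ = ((k.out * h)⁻¹ * ((k'.out * h') * y * (k'.out * h')⁻¹) * (k.out * h)) *
            ((k.out * h)⁻¹ * (k'.out * h')) := by group
          _ = _ := by rw [← e2]
      have hm := hT _ hc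
      have : k.out⁻¹ * k'.out = h * ((k.out * h)⁻¹ * (k'.out * h')) * h'⁻¹ := by group
      rw [this]
      exact H.mul_mem (H.mul_mem hh hm) (H.inv_mem hh')
    subst hk
    have : z = z' := by simpa using he
    rw [this]

/-- the number of square roots of one -/
def dsq (F : Type*) [Field F] [DecidableEq F] : ℕ := if (2 : F) = 0 then 1 else 2

theorem center_card_le : (Finset.univ.filter
    (fun t : SL2 F => t ∈ Subgroup.center (SL2 F))).card ≤ dsq F := by
  have hs : (Finset.univ.filter (fun t : SL2 F => t ∈ Subgroup.center (SL2 F))) ⊆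
      {1, slm (-1) 0 0 (-1) (by ring)} := by
    intro t ht
    rw [Finset.mem_filter, sl_center] at ht
    obtain ⟨-, h1, h2, h3⟩ := ht
    have hd := sl_det t
    rw [h1, ← h3, zero_mul, sub_zero, mul_self_eq_one_iff] at hd
    rw [Finset.mem_insert, Finset.mem_singleton]
    rcases hd with hd | hd
    · left; apply sl_ext <;> simp [h1, h2, ← h3, hd]
    · right; apply sl_ext <;> simp only [slm00, slm01, slm10, slm11, h1, h2, ← h3, hd]
  refine (Finset.card_le_card hs).trans ?_
  rw [dsq]
  split_ifs with h
  · have : (slm (-1) 0 0 (-1) (by ring) : SL2 F) = 1 := by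
      have h' : (-1 : F) = 1 := by linear_combination -h
      apply sl_ext <;> simp only [slm00, slm01, slm10, slm11, h', sl_one00, sl_one01, sl_one10, sl_one11]
    rw [this]; simp
  · exact Finset.card_le_two

theorem orbit_card {τ : F} (hirr : ∀ r : F, r * r - τ * r + 1 ≠ 0) (y z : SL2 F) (hy : slt y = τ)
    (hz : slt z = τ) (h1 : slt (y * z) ≠ 2) (h2 : slt (y * z) ≠ τ * τ - 2) :
    (Finset.univ.filter (fun t : SL2 F => t * y = y * t)).card ≤ dsq F *
    ((Finset.univ.filter (fun t : SL2 F => t * y = y * t)).image (fun t => t * z * t⁻¹)).card := by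
  classical
  have hnc : z * y ≠ y * z := by
    intro h
    rcases irr_comm_eq hirr y z hy hz h with rfl | rfl
    · apply h2; rw [slt_sq, hz]
    · apply h1; rw [mul_inv_cancel, slt_one]
  apply Finset.card_le_mul_card_image
  intro w hw
  obtain ⟨t0, ht0, rfl⟩ := Finset.mem_image.1 hw
  rw [Finset.mem_filter] at ht0
  refine le_trans ?_ (center_card_le (F := F))
  apply Finset.card_le_card_of_injOn (fun t => t0⁻¹ * t)
  · intro t ht
    simp only [Finset.mem_coe, Finset.mem_filter, Finset.mem_univ, true_and] at ht ⊢
    by_contra hc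
    apply hnc
    have cy : Commute (t0⁻¹ * t) y :=
      (Commute.inv_left (show Commute t0 y from ht0.2)).mul_left ht.1
    have cz : (t0⁻¹ * t) * z = z * (t0⁻¹ * t) := by
      calc _ = t0⁻¹ * (t * z * t⁻¹) * t := by group
        _ = _ := by rw [ht.2]; group
    exact sl_comm_trans _ z y hc cz cy
  · intro t _ t' _ h
    exact mul_left_cancel h

theorem rho_card {τ : F} (hirr : ∀ r : F, r * r - τ * r + 1 ≠ 0) (y : SL2 F) (hy : slt y = τ)
    (κ : F) (hκ : κ ≠ 0) (R : Finset F)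
    (hR : ∀ u v, u * u + τ * u * v + v * v = 1 → v ≠ 0 → v * v * κ ∈ R) :
    (Finset.univ.filter (fun t : SL2 F => t * y = y * t)).card ≤ dsq F + 2 * dsq F * R.card := by
  classical
  set P := Finset.univ.filter (fun p : F × F => p.1 * p.1 + τ * p.1 * p.2 + p.2 * p.2 = 1) with hP
  have hTP : (Finset.univ.filter (fun t : SL2 F => t * y = y * t)).card ≤ P.card := by
    apply Finset.card_le_card_of_injOn
      (fun t => (t 0 0 - t 0 1 / y 0 1 * y 0 0, t 0 1 / y 0 1))
    · intro t ht
      simp only [hP, Finset.coe_filter, Finset.mem_univ, true_and, Set.mem_ofPred_eq] at ht ⊢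
      obtain ⟨u, v, hn, h00, h01, h10, h11⟩ := irr_param hirr y hy t ht
      have hb := irr_01 hirr y hy
      have e1 : t 0 1 / y 0 1 = v := by rw [h01]; field_simp
      have e2 : t 0 0 - v * y 0 0 = u := by rw [h00]; ring
      rw [e1, e2]; exact hn
    · intro t ht t' ht' he
      simp only [Finset.coe_filter, Finset.mem_univ, true_and, Set.mem_ofPred_eq] at ht ht'
      obtain ⟨u, v, hn, h00, h01, h10, h11⟩ := irr_param hirr y hy t ht
      obtain ⟨u', v', hn', h00', h01', h10', h11'⟩ := irr_param hirr y hy t' ht'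
      have hb := irr_01 hirr y hy
      have e1 : t 0 1 / y 0 1 = v := by rw [h01]; field_simp
      have e2 : t 0 0 - v * y 0 0 = u := by rw [h00]; ring
      have e1' : t' 0 1 / y 0 1 = v' := by rw [h01']; field_simp
      have e2' : t' 0 0 - v' * y 0 0 = u' := by rw [h00']; ring
      simp only [Prod.mk.injEq, e1, e1', e2, e2'] at he
      obtain ⟨rfl, rfl⟩ := he
      apply sl_ext <;> simp only [*]
  refine hTP.trans ?_
  rw [← Finset.card_filter_add_card_filter_not (s := P) (fun p => p.2 = 0)]
  apply add_le_add
  · have hs : P.filter (fun p => p.2 = 0) ⊆ {(1, 0), (-1, 0)} := by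
      rintro ⟨u, v⟩ hp
      simp only [hP, Finset.mem_filter, Finset.mem_univ, true_and] at hp
      obtain ⟨h, rfl⟩ := hp
      have : u * u = 1 := by linear_combination h
      rw [mul_self_eq_one_iff] at this
      rcases this with rfl | rfl <;> simp
    refine (Finset.card_le_card hs).trans ?_
    rw [dsq]
    split_ifs with h
    · have h' : (-1 : F) = 1 := by linear_combination -h
      rw [h']; simp
    · exact Finset.card_le_two
  · have him : (P.filter (fun p => ¬ p.2 = 0)).image (fun p => p.2 * p.2 * κ) ⊆ R := by
      intro r hr
      obtain ⟨⟨u, v⟩, hp, rfl⟩ := Finset.mem_image.1 hr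
      simp only [hP, Finset.mem_filter, Finset.mem_univ, true_and] at hp
      exact hR u v hp.1 hp.2
    refine le_trans (Finset.card_le_mul_card_image _ (2 * dsq F) ?_)
      (Nat.mul_le_mul_left _ (Finset.card_le_card him))
    intro r hr
    obtain ⟨⟨u, v⟩, hp, rfl⟩ := Finset.mem_image.1 hr
    simp only [hP, Finset.mem_filter, Finset.mem_univ, true_and] at hp
    obtain ⟨hn, hv⟩ := hp
    have hs : (P.filter (fun p => ¬ p.2 = 0)).filter (fun p => p.2 * p.2 * κ = v * v * κ) ⊆
        {(u, v), (-τ * v - u, v)} ∪ {(-u, -v), (τ * v + u, -v)} := by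
      rintro ⟨u', v'⟩ hp
      simp only [hP, Finset.mem_filter, Finset.mem_univ, true_and] at hp
      obtain ⟨⟨hn', hv'⟩, he⟩ := hp
      have hvv := mul_right_cancel₀ hκ he
      simp only [Finset.mem_union, Finset.mem_insert, Finset.mem_singleton, Prod.mk.injEq]
      rcases mul_self_eq_mul_self_iff.1 hvv with h | h
      · subst h
        left
        have : (u' - u) * (u' - (-τ * v' - u)) = 0 := by linear_combination hn' - hn
        rcases mul_eq_zero.1 this with h | h
        · left; exact ⟨sub_eq_zero.1 h, rfl⟩
        · right; exact ⟨sub_eq_zero.1 h, rfl⟩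
      · subst h
        right
        have : (u' - -u) * (u' - (τ * v + u)) = 0 := by linear_combination hn' - hn
        rcases mul_eq_zero.1 this with h | h
        · left; exact ⟨sub_eq_zero.1 h, rfl⟩
        · right; exact ⟨sub_eq_zero.1 h, rfl⟩
    refine (Finset.card_le_card hs).trans ?_
    rw [dsq]
    split_ifs with h
    · have hneg : ∀ a : F, -a = a := fun a => by linear_combination -a * h
      have e1 : (-u, -v) = (u, v) := by rw [hneg, hneg]
      have e2 : (τ * v + u, -v) = (-τ * v - u, v) := by
        rw [hneg v, Prod.mk.injEq]; refine ⟨?_, rfl⟩; linear_combination (τ * v + u) * h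
      rw [e1, e2, Finset.union_self]
      exact Finset.card_le_two
    · refine (Finset.card_union_le _ _).trans ?_
      have := Finset.card_le_two (a := (u, v)) (b := (-τ * v - u, v))
      have := Finset.card_le_two (a := (-u, -v)) (b := (τ * v + u, -v))
      omega

end keylemma

section keylemma2
variable [Fintype F] [DecidableEq F]

theorem index_bound {τ : F} (hirr : ∀ r : F, r * r - τ * r + 1 ≠ 0) (H : Subgroup (SL2 F))
    (x y : SL2 F) (hy : slt y = τ) (hT : ∀ t, t * y = y * t → t ∈ H)
    (hTc : (Finset.univ.filter (fun t : SL2 F => t * y = y * t)).card = Fintype.card F + 1)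
    (hxH : x ∈ H) (hxy : x * y ≠ y * x) (hx : ¬ (slt x = 0 ∧ slt (x * y) = 0)) :
    ∃ c r : ℕ, Fintype.card F + 1 ≤ dsq F + 2 * dsq F * r ∧
      (Fintype.card F + 1) * (r - 1) + dsq F ≤ dsq F * c ∧
      H.index * c ≤ Fintype.card F * (Fintype.card F - 1) := by
  classical
  set C : Finset (SL2 F) := Finset.univ.filter (fun z => ∃ h ∈ H, h * y * h⁻¹ = z) with hC
  set R1 := (C.image (fun z => slt (y * z))).erase (τ * τ - 2) with hR1
  have hyH : y ∈ H := hT y rfl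
  have hCm : ∀ z ∈ C, ∃ h ∈ H, h * y * h⁻¹ = z := fun z hz => (Finset.mem_filter.1 hz).2
  have hCt : ∀ z ∈ C, slt z = τ := by
    intro z hz
    obtain ⟨h, -, rfl⟩ := hCm z hz
    rw [slt_conj, hy]
  have hyC : y ∈ C := Finset.mem_filter.2 ⟨Finset.mem_univ _, 1, H.one_mem, by group⟩
  refine ⟨C.card, R1.card, ?_, ?_, ?_⟩
  · rw [← hTc]
    set π := slt (y * (x * y * x⁻¹)) with hπ
    have hπ1 : π ≠ 2 := by
      intro h
      exact hx (irr_inverts hirr x y hy (irr_aniso hirr y _ hy (by rw [slt_conj, hy]) h))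
    have hπ2 : π ≠ τ * τ - 2 := by
      intro h
      apply hxy
      have := irr_aniso' hirr y _ hy (by rw [slt_conj, hy]) h
      exact mul_inv_eq_iff_eq_mul.1 this
    have hκ : (π - 2) * (π - τ * τ + 2) ≠ 0 := by
      apply mul_ne_zero (sub_ne_zero.2 hπ1)
      intro h; apply hπ2; linear_combination h
    refine (rho_card hirr y hy _ hκ (R1.image (fun r => τ * τ - 2 - r)) ?_).trans ?_
    · intro u v hn hv
      rw [Finset.mem_image]
      have hdet : (u + v * y 0 0) * (u + v * y 1 1) - (v * y 0 1) * (v * y 1 0) = 1 := by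
        have hd := sl_det y
        rw [← hy, slt] at hn
        linear_combination hn + v * v * hd
      have hr := irr_rho x y (slm _ _ _ _ hdet) hy u v hn rfl rfl rfl rfl
      refine ⟨_, ?_, (?_ : τ * τ - 2 - slt (y * ((x * slm _ _ _ _ hdet * x⁻¹) * y *
        (x * slm _ _ _ _ hdet * x⁻¹)⁻¹)) = _)⟩
      · rw [hR1, Finset.mem_erase]
        constructor
        · rw [hr]
          intro h
          have : v * v * ((π - 2) * (π - τ * τ + 2)) = 0 := by linear_combination -h
          exact (mul_ne_zero (mul_ne_zero hv hv) hκ) this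
        · apply Finset.mem_image_of_mem
          rw [hC, Finset.mem_filter]
          refine ⟨Finset.mem_univ _, x * slm _ _ _ _ hdet * x⁻¹, ?_, rfl⟩
          refine H.mul_mem (H.mul_mem hxH (hT _ ?_)) (H.inv_mem hxH)
          rw [sl_comm_iff]
          simp only [slm00, slm01, slm10, slm11]
          refine ⟨by ring, by ring, by ring⟩
      · rw [hr]; ring
    · exact Nat.add_le_add_left (Nat.mul_le_mul_left _ Finset.card_image_le) _
  · set R2 := R1.erase 2 with hR2
    set C2 := C.filter (fun z => slt (y * z) ∈ R2) with hC2
    have h1 : C2.card + 1 ≤ C.card := by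
      have : C2 ⊆ C.erase y := by
        intro z hz
        rw [hC2, Finset.mem_filter] at hz
        rw [Finset.mem_erase]
        refine ⟨?_, hz.1⟩
        rintro rfl
        have := hz.2
        rw [hR2, Finset.mem_erase, hR1, Finset.mem_erase] at this
        apply this.2.1
        rw [slt_sq, hy]
      have := Finset.card_le_card this
      rw [Finset.card_erase_of_mem hyC] at this
      have : 0 < C.card := Finset.card_pos.2 ⟨y, hyC⟩
      omega
    have h2 : (Fintype.card F + 1) * R2.card ≤ dsq F * C2.card := by
      have hmaps : Set.MapsTo (fun z => slt (y * z)) (C2 : Set (SL2 F)) (R2 : Set F) := by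
        intro z hz
        exact (Finset.mem_filter.1 (Finset.mem_coe.1 hz)).2
      rw [Finset.card_eq_sum_card_fiberwise (f := fun z => slt (y * z)) (t := R2) hmaps, Finset.mul_sum, mul_comm, ← smul_eq_mul]
      apply Finset.card_nsmul_le_sum
      intro r hr
      have hr' := hr
      rw [hR2, Finset.mem_erase, hR1, Finset.mem_erase, Finset.mem_image] at hr'
      obtain ⟨hr2, hr3, z, hz, rfl⟩ := hr'
      rw [← hTc]
      refine (orbit_card hirr y z hy (hCt z hz) hr2 hr3).trans (Nat.mul_le_mul_left _ ?_)
      apply Finset.card_le_card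
      intro w hw
      obtain ⟨t, ht, rfl⟩ := Finset.mem_image.1 hw
      rw [Finset.mem_filter] at ht
      have e : slt (y * (t * z * t⁻¹)) = slt (y * z) := by
        have : y * (t * z * t⁻¹) = t * (y * z) * t⁻¹ := by
          calc _ = (y * t) * z * t⁻¹ := by group
            _ = _ := by rw [← ht.2]; group
        rw [this, slt_conj]
      rw [Finset.mem_filter, hC2, Finset.mem_filter, e]
      refine ⟨⟨?_, hr⟩, rfl⟩
      obtain ⟨h, hh, rfl⟩ := hCm z hz
      rw [hC, Finset.mem_filter]
      exact ⟨Finset.mem_univ _, t * h, H.mul_mem (hT t ht.2) hh, by group⟩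
    have h3 : R1.card - 1 ≤ R2.card := Finset.pred_card_le_card_erase
    calc _ ≤ (Fintype.card F + 1) * R2.card + dsq F :=
          Nat.add_le_add_right (Nat.mul_le_mul_left _ h3) _
      _ ≤ dsq F * C2.card + dsq F := Nat.add_le_add_right h2 _
      _ = dsq F * (C2.card + 1) := by ring
      _ ≤ _ := Nat.mul_le_mul_left _ h1
  · refine (index_mul_le H y hT C hCm).trans ?_
    rw [hy]
    exact Y_card_le hirr

theorem sq_spread (N : Subgroup (SL2 F)) (hd : ∀ (a : F) (ha : a ≠ 0) (g : SL2 F), g ∈ N →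
      sld a ha * g * (sld a ha)⁻¹ ∈ N)
    (t : F) (ht : t ≠ 0) (h : slu t ∈ N) (s : F) : slu s ∈ N := by
  have hmul : ∀ a : F, slu (t * (a * a)) ∈ N := by
    intro a
    by_cases ha : a = 0
    · have : slu (t * (a * a)) = (1 : SL2 F) := by
        rw [ha]; apply sl_ext <;> simp [slu, slm00, slm01, slm10, slm11]
      rw [this]; exact N.one_mem
    · have := hd a ha _ h
      have e : sld a ha * slu t * (sld a ha)⁻¹ = slu (t * (a * a)) := by
        apply sl_ext <;> simp only [sl_mul, sld, slu, slm00, slm01, slm10, slm11, sl_inv00,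
          sl_inv01, sl_inv10, sl_inv11] <;> field_simp <;> ring
      rwa [e] at this
  by_cases h2 : ringChar F = 2
  · obtain ⟨b, hb⟩ := FiniteField.isSquare_of_char_two h2 (s / t)
    have := hmul b
    rw [← hb] at this
    rwa [mul_div_cancel₀ _ ht] at this
  · have h20 : (2 : F) ≠ 0 := Ring.two_ne_zero h2
    have h40 : (4 : F) ≠ 0 := by
      have : (4 : F) = 2 * 2 := by norm_num
      rw [this]; exact mul_ne_zero h20 h20
    have e : slu s = slu (t * ((s / t + 1) / 2 * ((s / t + 1) / 2))) *
        (slu (t * ((s / t - 1) / 2 * ((s / t - 1) / 2))))⁻¹ := by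
      rw [eq_mul_inv_iff_mul_eq, slu_mul]
      congr 1
      field_simp
      ring
    rw [e]
    exact N.mul_mem (hmul _) (N.inv_mem (hmul _))

theorem top_of_weyl (N : Subgroup (SL2 F)) (hu : ∀ s, slu s ∈ N)
    (w : SL2 F) (hw : w ∈ N) (h10 : w 1 0 ≠ 0) : N = ⊤ := by
  apply sl_gen N hu
  intro t
  have hd := sl_det w
  set w' := slu (-(w 0 0) / w 1 0) * w * slu (-(w 1 1) / w 1 0) with hw'
  have hm : w' ∈ N := N.mul_mem (N.mul_mem (hu _) hw) (hu _)
  have e : sll t = w' * slu (-t / (w 1 0 * w 1 0)) * w'⁻¹ := by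
    rw [eq_mul_inv_iff_mul_eq]
    have e00 : w' 0 0 = 0 := by
      simp only [hw', sl_mul, slu, slm00, slm01, slm10, slm11]; field_simp; ring
    have e01 : w' 0 1 = -1 / w 1 0 := by
      simp only [hw', sl_mul, slu, slm00, slm01, slm10, slm11]; field_simp; linear_combination -hd
    have e10 : w' 1 0 = w 1 0 := by
      simp only [hw', sl_mul, slu, slm00, slm01, slm10, slm11]; ring
    have e11 : w' 1 1 = 0 := by
      simp only [hw', sl_mul, slu, slm00, slm01, slm10, slm11]; field_simp; ring
    clear_value w'
    apply sl_ext <;> simp only [e00, e01, e10, e11, sl_mul, slu, sll,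
      slm00, slm01, slm10, slm11] <;> field_simp <;> ring
  rw [e]
  exact N.mul_mem (N.mul_mem hm (hu _)) (N.inv_mem hm)

theorem top_of_index (H : Subgroup (SL2 F)) (h : ¬ Fintype.card F ∣ Nat.factorial H.index) :
    H = ⊤ := by
  classical
  have hex : ∃ t : F, t ≠ 0 ∧ slu t ∈ H.normalCore := by
    by_contra hcon
    push Not at hcon
    apply h
    let φ : Multiplicative F →* Equiv.Perm (SL2 F ⧸ H) :=
      (MulAction.toPermHom (SL2 F) (SL2 F ⧸ H)).comp
      { toFun := fun t => slu t.toAdd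
        map_one' := by apply sl_ext <;> simp [slu, slm00, slm01, slm10, slm11]
        map_mul' := fun a b => by rw [slu_mul]; rfl }
    have hφ : Function.Injective φ := by
      rw [injective_iff_map_eq_one]
      intro a ha
      by_contra hne
      apply hcon a.toAdd (fun h0 => hne (by rw [← ofAdd_toAdd a, h0]; rfl))
      rw [Subgroup.normalCore_eq_ker, MonoidHom.mem_ker]
      exact ha
    have := Subgroup.card_dvd_of_injective φ hφ
    rw [Nat.card_perm] at this
    rw [Subgroup.index]
    simpa [Nat.card_eq_fintype_card] using this
  obtain ⟨t, ht, hm⟩ := hex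
  have hN : H.normalCore = ⊤ := by
    have hu := sq_spread H.normalCore (fun a ha g hg => (Subgroup.normalCore_normal H).conj_mem g hg _)
      t ht hm
    apply sl_gen _ hu
    intro s
    have := (Subgroup.normalCore_normal H).conj_mem _ (hu (-s)) (slm 0 1 (-1) 0 (by ring))
    convert this using 1
    apply sl_ext <;> simp [sl_mul, slu, sll, slm00, slm01, slm10, slm11, sl_inv00,
          sl_inv01, sl_inv10, sl_inv11]
  exact top_le_iff.1 (hN ▸ Subgroup.normalCore_le H)

end keylemma2

theorem arith_even (q k c r : ℕ) (hq : 11 ≤ q) (he : q % 2 = 0) (h1 : q + 1 ≤ 1 + 2 * 1 * r)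
    (h2 : (q + 1) * (r - 1) + 1 ≤ 1 * c) (h3 : k * c ≤ q * (q - 1)) : ¬ q ∣ Nat.factorial k := by
  obtain ⟨s, rfl⟩ : ∃ s, q = 2 * s := ⟨q / 2, by omega⟩
  obtain ⟨r', rfl⟩ : ∃ r', r = s + r' := ⟨r - s, by omega⟩
  obtain ⟨u, rfl⟩ : ∃ u, s = u + 1 := ⟨s - 1, by omega⟩
  have e1 : u + 1 + r' - 1 = u + r' := by omega
  have e2 : 2 * (u + 1) - 1 = 2 * u + 1 := by omega
  rw [e1] at h2
  rw [e2] at h3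
  have hk : k ≤ 2 := by
    by_contra hk
    push Not at hk
    have h4 : 3 * c ≤ k * c := Nat.mul_le_mul_right _ hk
    have h5 : (2 * (u + 1) + 1) * u ≤ (2 * (u + 1) + 1) * (u + r') :=
      Nat.mul_le_mul_left _ (by omega)
    nlinarith
  intro hd
  have hf := Nat.le_of_dvd (Nat.factorial_pos k) hd
  have : Nat.factorial k ≤ Nat.factorial 2 := Nat.factorial_le hk
  have e : Nat.factorial 2 = 2 := rfl
  omega

theorem arith_315 (p n : ℕ) (hp : p.Prime) (hq : 11 ≤ p ^ n) : ¬ p ^ n ∣ 315 := by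
  intro h
  have hn : n ≠ 0 := by rintro rfl; simp at hq
  have hpd : p ∣ 3 * 3 * 5 * 7 := (dvd_pow_self p hn).trans h
  have key : ∀ m : ℕ, p ^ n ∣ m → 0 < m → m < 11 → False := fun m hm h0 h1 => by
    have := Nat.le_of_dvd h0 hm
    omega
  have h3 : p = 3 ∨ p = 5 ∨ p = 7 := by
    rcases (Nat.Prime.dvd_mul hp).1 hpd with h | h
    · rcases (Nat.Prime.dvd_mul hp).1 h with h | h
      · rcases (Nat.Prime.dvd_mul hp).1 h with h | h <;>
        exact Or.inl ((Nat.prime_dvd_prime_iff_eq hp (by norm_num)).1 h)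
      · exact Or.inr (Or.inl ((Nat.prime_dvd_prime_iff_eq hp (by norm_num)).1 h))
    · exact Or.inr (Or.inr ((Nat.prime_dvd_prime_iff_eq hp (by norm_num)).1 h))
  rcases h3 with rfl | rfl | rfl
  · exact key 9 (Nat.Coprime.dvd_of_dvd_mul_left (n := 9) (m := 35)
      (Nat.Coprime.pow_left n (by norm_num)) h) (by norm_num) (by norm_num)
  · exact key 5 (Nat.Coprime.dvd_of_dvd_mul_left (n := 5) (m := 63)
      (Nat.Coprime.pow_left n (by norm_num)) h) (by norm_num) (by norm_num)
  · exact key 7 (Nat.Coprime.dvd_of_dvd_mul_left (n := 7) (m := 45)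
      (Nat.Coprime.pow_left n (by norm_num)) h) (by norm_num) (by norm_num)

theorem arith_odd (p n k c r : ℕ) (hp : p.Prime) (hq : 11 ≤ p ^ n) (he : p ^ n % 2 = 1)
    (h1 : p ^ n + 1 ≤ 2 + 2 * 2 * r)
    (h2 : (p ^ n + 1) * (r - 1) + 2 ≤ 2 * c) (h3 : k * c ≤ p ^ n * (p ^ n - 1)) :
    ¬ p ^ n ∣ Nat.factorial k := by
  have h315 := arith_315 p n hp hq
  have hk : k ≤ 8 ∨ (p ^ n = 13 ∧ k ≤ 10) ∨ (p ^ n = 17 ∧ k ≤ 9) ∨ (p ^ n = 25 ∧ k ≤ 9) := by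
    have h21 : p ^ n ≠ 21 := by
      intro h
      apply h315
      rw [h]; norm_num
    generalize p ^ n = q at *
    have h4 : q % 4 = 1 ∨ q % 4 = 3 := by omega
    rcases h4 with h4 | h4
    · obtain ⟨s, rfl⟩ : ∃ s, q = 4 * s + 1 := ⟨q / 4, by omega⟩
      obtain ⟨r', rfl⟩ : ∃ r', r = s + r' := ⟨r - s, by omega⟩
      obtain ⟨u, rfl⟩ : ∃ u, s = u + 1 := ⟨s - 1, by omega⟩
      have e1 : u + 1 + r' - 1 = u + r' := by omega
      rw [e1] at h2
      rw [Nat.add_sub_cancel] at h3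
      have h5 : (4 * (u + 1) + 1 + 1) * u ≤ (4 * (u + 1) + 1 + 1) * (u + r') :=
        Nat.mul_le_mul_left _ (by omega)
      have h6 : (u + 1) * (2 * u + 1) ≤ c := by nlinarith
      have h7 : k * ((u + 1) * (2 * u + 1)) ≤ (4 * (u + 1) + 1) * (4 * (u + 1)) :=
        (Nat.mul_le_mul_left _ h6).trans h3
      have h8 : (k * (2 * u + 1)) * (u + 1) ≤ (4 * (4 * (u + 1) + 1)) * (u + 1) := by nlinarith
      have h9 := Nat.le_of_mul_le_mul_right h8 (by omega)
      have b10 : k ≤ 10 := by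
        by_contra hc
        push Not at hc
        have : 11 * (2 * u + 1) ≤ k * (2 * u + 1) := Nat.mul_le_mul_right _ hc
        omega
      by_cases hu3 : u = 2
      · subst hu3; right; left; exact ⟨by norm_num, b10⟩
      have b9 : k ≤ 9 := by
        by_contra hc
        push Not at hc
        have : 10 * (2 * u + 1) ≤ k * (2 * u + 1) := Nat.mul_le_mul_right _ hc
        omega
      by_cases hu4 : u = 3
      · subst hu4; right; right; left; exact ⟨by norm_num, b9⟩
      by_cases hu5 : u = 5
      · subst hu5; right; right; right; exact ⟨by norm_num, b9⟩
      have b8 : k ≤ 8 := by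
        by_contra hc
        push Not at hc
        have : 9 * (2 * u + 1) ≤ k * (2 * u + 1) := Nat.mul_le_mul_right _ hc
        omega
      exact Or.inl b8
    · left
      obtain ⟨s, rfl⟩ : ∃ s, q = 4 * s + 3 := ⟨q / 4, by omega⟩
      obtain ⟨r', rfl⟩ : ∃ r', r = s + 1 + r' := ⟨r - s - 1, by omega⟩
      have e1 : s + 1 + r' - 1 = s + r' := by omega
      have e2 : 4 * s + 3 - 1 = 4 * s + 2 := by omega
      rw [e1] at h2
      rw [e2] at h3
      have h5 : (4 * s + 3 + 1) * s ≤ (4 * s + 3 + 1) * (s + r') :=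
        Nat.mul_le_mul_left _ (by omega)
      by_contra hc
      push Not at hc
      have : 9 * c ≤ k * c := Nat.mul_le_mul_right _ hc
      nlinarith
  intro hd
  rcases hk with hk | ⟨hq', hk⟩ | ⟨hq', hk⟩ | ⟨hq', hk⟩
  · apply h315
    have := hd.trans (Nat.factorial_dvd_factorial hk)
    have e : Nat.factorial 8 = 128 * 315 := by decide
    rw [e] at this
    refine Nat.Coprime.dvd_of_dvd_mul_left ?_ this
    have : Nat.Coprime (p ^ n) 2 := by
      rw [Nat.coprime_two_right, Nat.odd_iff]; exact he
    exact Nat.Coprime.pow_right 7 this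
  · have := hd.trans (Nat.factorial_dvd_factorial hk)
    rw [hq'] at this
    revert this; decide
  · have := hd.trans (Nat.factorial_dvd_factorial hk)
    rw [hq'] at this
    revert this; decide
  · have := hd.trans (Nat.factorial_dvd_factorial hk)
    rw [hq'] at this
    revert this; decide

section keylemma3
variable [Fintype F] [DecidableEq F]

theorem two_zero_iff : (2 : F) = 0 ↔ Fintype.card F % 2 = 0 := by
  rw [FiniteField.even_card_iff_char_two.symm]
  constructor
  · intro h
    by_contra hc
    exact Ring.two_ne_zero hc h
  · intro h
    have : ((2 : ℕ) : F) = 0 := by rw [← h]; exact ringChar.Nat.cast_ringChar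
    simpa using this

theorem key_ns {τ : F} (hirr : ∀ r : F, r * r - τ * r + 1 ≠ 0) (hq : 11 ≤ Fintype.card F)
    (H : Subgroup (SL2 F))
    (x y : SL2 F) (hy : slt y = τ) (hT : ∀ t, t * y = y * t → t ∈ Subgroup.zpowers y)
    (hTc : Nat.card (Subgroup.zpowers y) = Fintype.card F + 1)
    (hxH : x ∈ H) (hyH : y ∈ H) (hxy : x * y ≠ y * x) (hx : ¬ (slt x = 0 ∧ slt (x * y) = 0)) :
    H = ⊤ := by
  classical
  have hTH : ∀ t, t * y = y * t → t ∈ H := fun t ht => by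
    have := hT t ht
    exact (Subgroup.zpowers_le.2 hyH) this
  have hcard : (Finset.univ.filter (fun t : SL2 F => t * y = y * t)).card =
      Fintype.card F + 1 := by
    rw [← hTc, Nat.card_eq_fintype_card, Fintype.card_subtype]
    congr 1
    ext t
    simp only [Finset.mem_filter, Finset.mem_univ, true_and]
    refine ⟨hT t, ?_⟩
    intro ht
    obtain ⟨k, rfl⟩ := Subgroup.mem_zpowers_iff.1 ht
    exact (Commute.refl y).zpow_left k
  obtain ⟨c, r, h1, h2, h3⟩ := index_bound hirr H x y hy hTH hcard hxH hxy hx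
  apply top_of_index
  by_cases h20 : (2 : F) = 0
  · have hd : dsq F = 1 := by rw [dsq, if_pos h20]
    rw [hd] at h1 h2
    exact arith_even _ _ c r hq (two_zero_iff.1 h20) h1 h2 h3
  · have hd : dsq F = 2 := by rw [dsq, if_neg h20]
    rw [hd] at h1 h2
    obtain ⟨n, hp, hn⟩ := FiniteField.card F (ringChar F)
    have ho : Fintype.card F % 2 = 1 := by
      have := (not_congr two_zero_iff).1 h20
      omega
    rw [hn] at h1 h2 h3 hq ho ⊢
    exact arith_odd _ _ _ c r hp hq ho h1 h2 h3

end keylemma3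

theorem spread_of_uniform {G : Type*} [Group G] {k : ℕ} (h : UniformSpreadAtLeast G k) :
    SpreadAtLeast G k := by
  obtain ⟨s, hs⟩ := h
  intro x hx
  obtain ⟨y, -, hy⟩ := hs x hx
  exact ⟨y, hy⟩

theorem psl_gen (x y : SL2 F) (h : ∀ H : Subgroup (SL2 F), x ∈ H → y ∈ H → H = ⊤) :
    Subgroup.closure {(x : PSL2 F), (y : PSL2 F)} = ⊤ := by
  have := h ((Subgroup.closure {(x : PSL2 F), (y : PSL2 F)}).comap (QuotientGroup.mk' _))
    (Subgroup.mem_comap.2 (Subgroup.subset_closure (by simp)))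
    (Subgroup.mem_comap.2 (Subgroup.subset_closure (by simp)))
  rw [eq_top_iff]
  intro g _
  obtain ⟨g, rfl⟩ := QuotientGroup.mk_surjective g
  have hg : g ∈ (⊤ : Subgroup (SL2 F)) := Subgroup.mem_top g
  rw [← this] at hg
  exact hg

theorem psl_lift {k : ℕ} (x : Fin k → PSL2 F) (hx : ∀ i, x i ≠ 1) :
    ∃ x' : Fin k → SL2 F, (∀ i, x' i ∉ Subgroup.center (SL2 F)) ∧ ∀ i, x i = (x' i : PSL2 F) := by
  choose x' hx' using fun i => QuotientGroup.mk_surjective (x i)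
  refine ⟨x', ?_, fun i => (hx' i).symm⟩
  intro i hi
  apply hx i
  rw [← hx' i]
  exact (QuotientGroup.eq_one_iff _).2 hi

section lower
variable [Fintype F] [DecidableEq F]

/-- The elements of trace `τ` which are not good partners of `x`. -/
def bad (τ : F) (x : SL2 F) : Finset (SL2 F) :=
  Finset.univ.filter (fun y => slt y = τ ∧ (x * y = y * x ∨ (slt x = 0 ∧ slt (x * y) = 0)))

theorem bad_le (τ : F) (x : SL2 F) : (bad τ x).card ≤
    (Finset.univ.filter (fun y : SL2 F => slt y = τ ∧ x * y = y * x)).card +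
    (Finset.univ.filter (fun y : SL2 F => slt y = τ ∧ (slt x = 0 ∧ slt (x * y) = 0))).card := by
  refine le_trans (Finset.card_le_card ?_) (Finset.card_union_le _ _)
  intro y hy
  simp only [bad, Finset.mem_filter, Finset.mem_union, Finset.mem_univ, true_and] at hy ⊢
  tauto

theorem bad_of_ne {τ : F} (hirr : ∀ r : F, r * r - τ * r + 1 ≠ 0) (x : SL2 F)
    (hx : x ∉ Subgroup.center (SL2 F)) (hx0 : slt x ≠ 0) : (bad τ x).card ≤ 2 := by
  refine le_trans (Finset.card_le_card ?_) (bad1_card hirr x hx)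
  intro y hy
  simp only [bad, Finset.mem_filter, Finset.mem_univ, true_and] at hy ⊢
  tauto

theorem bad_of_eq {τ : F} (x : SL2 F)
    (hx : x ∉ Subgroup.center (SL2 F)) (hx0 : slt x = 0)
    (hnc : ∀ y, slt y = τ → x * y ≠ y * x) : (bad τ x).card ≤
    (Finset.univ.filter (fun p : F × F => p.1 * (τ - p.1) - p.2 * p.2 = 1)).card := by
  refine le_trans (Finset.card_le_card ?_) (bad2_card τ x hx hx0)
  intro y hy
  simp only [bad, Finset.mem_filter, Finset.mem_univ, true_and] at hy ⊢
  have := hnc y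
  tauto

theorem bad_of_eq' {τ : F} (hirr : ∀ r : F, r * r - τ * r + 1 ≠ 0) (x : SL2 F)
    (hx : x ∉ Subgroup.center (SL2 F)) (hx0 : slt x = 0) : (bad τ x).card ≤
    2 + (Finset.univ.filter (fun p : F × F => p.1 * (τ - p.1) - p.2 * p.2 = 1)).card := by
  refine le_trans (bad_le τ x) (add_le_add (bad1_card hirr x hx) ?_)
  refine le_trans (Finset.card_le_card ?_) (bad2_card τ x hx hx0)
  intro y hy
  simp only [Finset.mem_filter, Finset.mem_univ, true_and] at hy ⊢
  tauto

theorem nocomm_aux {τ : F} (hirr : ∀ r : F, r * r - τ * r + 1 ≠ 0) (x y : SL2 F)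
    (hx : x ∉ Subgroup.center (SL2 F)) (hx0 : slt x = 0) (hy : slt y = τ) (h : x * y = y * x) :
    ∃ u v : F, v ≠ 0 ∧ u * u + τ * u * v + v * v = 1 ∧ 2 * u + v * τ = 0 := by
  obtain ⟨u, v, hn, h00, h01, h10, h11⟩ := irr_param hirr y hy x h
  refine ⟨u, v, ?_, hn, ?_⟩
  · rintro rfl
    apply hx
    rw [sl_center, h00, h01, h10, h11]
    simp
  · rw [← hx0, ← hy, slt, slt, h00, h11]; ring

theorem nocomm_even {τ : F} (hirr : ∀ r : F, r * r - τ * r + 1 ≠ 0) (h2 : (2 : F) = 0) (x : SL2 F)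
    (hx : x ∉ Subgroup.center (SL2 F)) (hx0 : slt x = 0) (y : SL2 F) (hy : slt y = τ) :
    x * y ≠ y * x := by
  intro h
  obtain ⟨u, v, hv, hn, ht⟩ := nocomm_aux hirr x y hx hx0 hy h
  have : v * τ = 0 := by linear_combination ht - u * h2
  have hτ : τ = 0 := (mul_eq_zero.1 this).resolve_left hv
  apply hirr 1
  rw [hτ]; linear_combination h2

theorem nocomm_one {τ : F} (hirr : ∀ r : F, r * r - τ * r + 1 ≠ 0) (h2 : (2 : F) ≠ 0) (i : F)
    (hi : i * i = -1) (x : SL2 F)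
    (hx : x ∉ Subgroup.center (SL2 F)) (hx0 : slt x = 0) (y : SL2 F) (hy : slt y = τ) :
    x * y ≠ y * x := by
  intro h
  obtain ⟨u, v, hv, hn, ht⟩ := nocomm_aux hirr x y hx hx0 hy h
  have hu : u = - v * τ / 2 := by field_simp; linear_combination ht
  apply hirr ((τ + 2 * i / v) / 2)
  subst hu
  field_simp
  field_simp at hn
  linear_combination 4 * hi + hn

theorem exists_good {τ : F} {k : ℕ} (x : Fin k → SL2 F)
    (hs : ∑ i, (bad τ (x i)).card < Fintype.card F * (Fintype.card F - 1)) :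
    ∃ y : SL2 F, slt y = τ ∧ ∀ i, y ∉ bad τ (x i) := by
  classical
  by_contra hcon
  push Not at hcon
  have hsub : (Finset.univ.filter (fun y : SL2 F => slt y = τ)) ⊆
      Finset.univ.biUnion (fun i => bad τ (x i)) := by
    intro y hy
    obtain ⟨i, hi⟩ := hcon y (Finset.mem_filter.1 hy).2
    exact Finset.mem_biUnion.2 ⟨i, Finset.mem_univ _, hi⟩
  have h1 := Finset.card_le_card hsub
  have h2 := Finset.card_biUnion_le (s := Finset.univ) (t := fun i => bad τ (x i))
  have h3 := Y_card_ge τ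
  omega

/-- common part of the lower bounds -/
theorem lower_core (hq : 11 ≤ Fintype.card F) : ∃ τ : F, (∀ r : F, r * r - τ * r + 1 ≠ 0) ∧
    ∃ s : PSL2 F, ∀ (k : ℕ) (x : Fin k → SL2 F), (∀ i, x i ∉ Subgroup.center (SL2 F)) →
      ∑ i, (bad τ (x i)).card < Fintype.card F * (Fintype.card F - 1) →
      ∃ y : PSL2 F, IsConj s y ∧ ∀ i, Subgroup.closure {(x i : PSL2 F), y} = ⊤ := by
  obtain ⟨τ, hirr, hT⟩ := exists_tau (F := F) (by omega)
  refine ⟨τ, hirr, ((slm 0 (-1) 1 τ (by ring) : SL2 F) : PSL2 F), ?_⟩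
  intro k x hx hs
  obtain ⟨y, hy, hyb⟩ := exists_good x hs
  refine ⟨(y : PSL2 F), ?_, ?_⟩
  · exact MonoidHom.map_isConj (QuotientGroup.mk' (Subgroup.center (SL2 F))) (conj_comp hirr y hy)
  · intro i
    apply psl_gen
    intro H hxH hyH
    have := hyb i
    simp only [bad, Finset.mem_filter, Finset.mem_univ, true_and, not_and, not_or] at this
    have h2 := this hy
    refine key_ns hirr hq H (x i) y hy (hT y hy).1 (hT y hy).2 hxH hyH h2.1 ?_
    rintro ⟨h3, h4⟩
    exact h2.2 h3 h4

theorem sum_bad_le {τ : F} {k b : ℕ} (x : Fin k → SL2 F) (hb : ∀ i, (bad τ (x i)).card ≤ b) :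
    ∑ i, (bad τ (x i)).card ≤ k * b := by
  have := Finset.sum_le_card_nsmul Finset.univ (fun i => (bad τ (x i)).card) b (fun i _ => hb i)
  simpa using this

theorem lower_even (hq : 11 ≤ Fintype.card F) (he : Fintype.card F % 2 = 0) :
    UniformSpreadAtLeast (PSL2 F) (Fintype.card F - 2) := by
  obtain ⟨τ, hirr, s, hs⟩ := lower_core hq
  have h2 := two_zero_iff.2 he
  refine ⟨s, ?_⟩
  intro x hx
  obtain ⟨x', hx', hxx⟩ := psl_lift x hx
  simp only [hxx]
  apply hs _ x' hx'
  refine lt_of_le_of_lt (sum_bad_le (b := Fintype.card F) x' ?_) ?_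
  · intro i
    by_cases h0 : slt (x' i) = 0
    · exact (bad_of_eq _ (hx' i) h0 (nocomm_even hirr h2 _ (hx' i) h0)).trans (circle_card2 h2)
    · exact (bad_of_ne hirr _ (hx' i) h0).trans (by omega)
  · rw [mul_comm]
    exact Nat.mul_lt_mul_of_pos_left (by omega) (by omega)

theorem lower_one (hq : 11 ≤ Fintype.card F) (he : Fintype.card F % 4 = 1) :
    UniformSpreadAtLeast (PSL2 F) (Fintype.card F - 1) := by
  obtain ⟨τ, hirr, s, hs⟩ := lower_core hq
  have h2 : (2 : F) ≠ 0 := fun h => by have := two_zero_iff.1 h; omega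
  obtain ⟨i, hi⟩ := FiniteField.isSquare_neg_one_iff (F := F).2 (by omega)
  refine ⟨s, ?_⟩
  intro x hx
  obtain ⟨x', hx', hxx⟩ := psl_lift x hx
  simp only [hxx]
  apply hs _ x' hx'
  refine lt_of_le_of_lt (sum_bad_le (b := Fintype.card F - 1) x' ?_) ?_
  · intro j
    by_cases h0 : slt (x' j) = 0
    · exact (bad_of_eq _ (hx' j) h0 (nocomm_one hirr h2 i hi.symm _ (hx' j) h0)).trans
        (circle_card1 h2 (irr_disc hirr) i hi.symm)
    · exact (bad_of_ne hirr _ (hx' j) h0).trans (by omega)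
  · exact Nat.mul_lt_mul_of_pos_right (by omega) (by omega)

theorem three_facts (he : Fintype.card F % 4 = 3) : (2 : F) ≠ 0 ∧ ∀ m : F, 1 + m * m ≠ 0 := by
  refine ⟨fun h => by have := two_zero_iff.1 h; omega, ?_⟩
  intro m hm
  have : IsSquare (-1 : F) := ⟨m, by linear_combination -hm⟩
  exact FiniteField.isSquare_neg_one_iff.1 this he

theorem bad_three {τ : F} (hirr : ∀ r : F, r * r - τ * r + 1 ≠ 0) (hq : 11 ≤ Fintype.card F)
    (he : Fintype.card F % 4 = 3) (x : SL2 F)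
    (hx : x ∉ Subgroup.center (SL2 F)) : (bad τ x).card ≤ Fintype.card F + 3 := by
  obtain ⟨h2, hm⟩ := three_facts (F := F) he
  by_cases h0 : slt x = 0
  · have := circle_card3 (τ := τ) h2 hm
    exact (bad_of_eq' hirr _ hx h0).trans (by omega)
  · exact (bad_of_ne hirr _ hx h0).trans (by omega)

theorem lower_three_unif (hq : 11 ≤ Fintype.card F) (he : Fintype.card F % 4 = 3) :
    UniformSpreadAtLeast (PSL2 F) (Fintype.card F - 4) := by
  obtain ⟨τ, hirr, s, hs⟩ := lower_core hq
  refine ⟨s, ?_⟩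
  intro x hx
  obtain ⟨x', hx', hxx⟩ := psl_lift x hx
  simp only [hxx]
  apply hs _ x' hx'
  refine lt_of_le_of_lt (sum_bad_le (b := Fintype.card F + 3) x'
    (fun i => bad_three hirr hq he _ (hx' i))) ?_
  obtain ⟨n, hn⟩ : ∃ n, Fintype.card F = n + 4 := ⟨Fintype.card F - 4, by omega⟩
  rw [hn]
  have e1 : n + 4 - 4 = n := by omega
  have e2 : n + 4 - 1 = n + 3 := by omega
  rw [e1, e2]
  nlinarith

theorem lower_three_mixed (hq : 11 ≤ Fintype.card F) (he : Fintype.card F % 4 = 3)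
    (x : Fin (Fintype.card F - 3) → SL2 F) (hx : ∀ i, x i ∉ Subgroup.center (SL2 F))
    (j : Fin (Fintype.card F - 3)) (hj : slt (x j) ≠ 0) :
    ∃ y : PSL2 F, ∀ i, Subgroup.closure {(x i : PSL2 F), y} = ⊤ := by
  obtain ⟨τ, hirr, s, hs⟩ := lower_core hq
  obtain ⟨y, -, hy⟩ := hs _ x hx (by
    rw [← Finset.add_sum_erase Finset.univ _ (Finset.mem_univ j)]
    have h1 := bad_of_ne hirr (x j) (hx j) hj
    have h2 := Finset.sum_le_card_nsmul (Finset.univ.erase j) (fun i => (bad τ (x i)).card)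
      (Fintype.card F + 3) (fun i _ => bad_three hirr hq he _ (hx i))
    rw [Finset.card_erase_of_mem (Finset.mem_univ _), Finset.card_univ, Fintype.card_fin,
      smul_eq_mul] at h2
    refine lt_of_le_of_lt (add_le_add h1 h2) ?_
    obtain ⟨n, hn⟩ : ∃ n, Fintype.card F = n + 4 := ⟨Fintype.card F - 4, by omega⟩
    rw [hn]
    have e1 : n + 4 - 3 - 1 = n := by omega
    have e2 : n + 4 - 1 = n + 3 := by omega
    rw [e1, e2]
    nlinarith)
  exact ⟨y, hy⟩

end lower

section split
variable [Fintype F] [DecidableEq F]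

theorem exists_notin_list (l : List F) (h : l.length < Fintype.card F) : ∃ r : F, r ∉ l := by
  by_contra hcon
  push Not at hcon
  have : (Finset.univ : Finset F) ⊆ l.toFinset := fun r _ => List.mem_toFinset.2 (hcon r)
  have := Finset.card_le_card this
  have h2 := l.toFinset_card_le
  rw [Finset.card_univ] at this
  omega

theorem same_class (h2 : (2 : F) ≠ 0) (e1 e2 e3 : F) (h1 : e1 ≠ 0) (h2' : e2 ≠ 0) (h3 : e3 ≠ 0) :
    IsSquare (e1 * e2) ∨ IsSquare (e1 * e3) ∨ IsSquare (e2 * e3) := by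
  have hc : ringChar F ≠ 2 := by
    intro h
    apply h2
    have : ((2 : ℕ) : F) = 0 := by rw [← h]; exact ringChar.Nat.cast_ringChar
    simpa using this
  have key : ∀ a b : F, a ≠ 0 → b ≠ 0 → quadraticChar F a = quadraticChar F b →
      IsSquare (a * b) := by
    intro a b ha hb hab
    rw [← quadraticChar_one_iff_isSquare (mul_ne_zero ha hb), map_mul, hab]
    rcases quadraticChar_dichotomy hb with h | h <;> rw [h] <;> norm_num
  rcases quadraticChar_dichotomy h1 with a1 | a1 <;>
  rcases quadraticChar_dichotomy h2' with a2 | a2 <;>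
  rcases quadraticChar_dichotomy h3 with a3 | a3 <;>
  first
  | exact Or.inl (key e1 e2 h1 h2' (a1.trans a2.symm))
  | exact Or.inr (Or.inl (key e1 e3 h1 h3 (a1.trans a3.symm)))
  | exact Or.inr (Or.inr (key e2 e3 h2' h3 (a2.trans a3.symm)))

theorem exists_three (a : F) (hq : 14 ≤ Fintype.card F) (ha : 1 + a * a ≠ 0) :
    ∃ r : Fin 3 → F, (∀ i, r i ≠ 0 ∧ r i * r i ≠ 1 ∧ (1 + a * a) * (r i * r i) ≠ a * a) ∧
      ∀ i j, i ≠ j → r i * r i ≠ r j * r j ∧ (r i * r i) * (r j * r j) ≠ 1 := by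
  obtain ⟨e, he⟩ : ∃ e : F, ∀ r, (1 + a * a) * (r * r) = a * a → r = e ∨ r = -e := by
    by_cases h : ∃ e : F, (1 + a * a) * (e * e) = a * a
    · obtain ⟨e, he⟩ := h
      refine ⟨e, fun r hr => ?_⟩
      have : r * r = e * e := mul_left_cancel₀ ha (by rw [hr, he])
      exact mul_self_eq_mul_self_iff.1 this
    · push Not at h
      exact ⟨0, fun r hr => absurd hr (h r)⟩
  have good : ∀ r : F, r ∉ [0, 1, -1, e, -e] →
      r ≠ 0 ∧ r * r ≠ 1 ∧ (1 + a * a) * (r * r) ≠ a * a := by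
    intro r hr
    simp only [List.mem_cons, List.not_mem_nil, or_false, not_or] at hr
    refine ⟨hr.1, ?_, ?_⟩
    · intro h
      rcases mul_self_eq_one_iff.1 h with h | h
      · exact hr.2.1 h
      · exact hr.2.2.1 h
    · intro h
      rcases he r h with h | h
      · exact hr.2.2.2.1 h
      · exact hr.2.2.2.2 h
  have good2 : ∀ r s : F, s ≠ 0 → r ∉ [s, -s, s⁻¹, -s⁻¹] → r * r ≠ s * s ∧ (r * r) * (s * s) ≠ 1 := by
    intro r s hs hr
    simp only [List.mem_cons, List.not_mem_nil, or_false, not_or] at hr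
    constructor
    · intro h
      rcases mul_self_eq_mul_self_iff.1 h with h | h
      · exact hr.1 h
      · exact hr.2.1 h
    · intro h
      have h' : (r * s) * (r * s) = 1 := by linear_combination h
      rcases mul_self_eq_one_iff.1 h' with h | h
      · apply hr.2.2.1; exact eq_inv_of_mul_eq_one_left h
      · apply hr.2.2.2; field_simp; linear_combination h
  obtain ⟨r1, h1⟩ := exists_notin_list [0, 1, -1, e, -e] (by simp; omega)
  have g1 := good r1 h1
  obtain ⟨r2, h2⟩ := exists_notin_list ([0, 1, -1, e, -e] ++ [r1, -r1, r1⁻¹, -r1⁻¹])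
    (by simp; omega)
  rw [List.mem_append, not_or] at h2
  have g2 := good r2 h2.1
  have g12 := good2 r2 r1 g1.1 h2.2
  obtain ⟨r3, h3⟩ := exists_notin_list ([0, 1, -1, e, -e] ++ ([r1, -r1, r1⁻¹, -r1⁻¹] ++
    [r2, -r2, r2⁻¹, -r2⁻¹])) (by simp; omega)
  rw [List.mem_append, List.mem_append, not_or, not_or] at h3
  have g3 := good r3 h3.1
  have g13 := good2 r3 r1 g1.1 h3.2.1
  have g23 := good2 r3 r2 g2.1 h3.2.2
  refine ⟨![r1, r2, r3], ?_, ?_⟩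
  · intro i
    fin_cases i
    · exact g1
    · exact g2
    · exact g3
  · have g12' : r1 * r1 ≠ r2 * r2 ∧ (r1 * r1) * (r2 * r2) ≠ 1 :=
      ⟨fun h => g12.1 h.symm, fun h => g12.2 (by rw [mul_comm]; exact h)⟩
    have g13' : r1 * r1 ≠ r3 * r3 ∧ (r1 * r1) * (r3 * r3) ≠ 1 :=
      ⟨fun h => g13.1 h.symm, fun h => g13.2 (by rw [mul_comm]; exact h)⟩
    have g23' : r2 * r2 ≠ r3 * r3 ∧ (r2 * r2) * (r3 * r3) ≠ 1 :=
      ⟨fun h => g23.1 h.symm, fun h => g23.2 (by rw [mul_comm]; exact h)⟩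
    intro i j hij
    fin_cases i <;> fin_cases j <;> first | exact absurd rfl hij | assumption

theorem unip_of_pair (H : Subgroup (SL2 F)) (hD : ∀ (r : F) (hr : r ≠ 0), sld r hr ∈ H)
    (g h : SL2 F) (hg : g ∈ H) (hh : h ∈ H) (g10 : g 1 0 ≠ 0) (g11 : g 1 1 ≠ 0)
    (h10 : h 1 0 ≠ 0) (h11 : h 1 1 ≠ 0) (hsq : IsSquare ((g 1 0 * g 1 1) * (h 1 0 * h 1 1)))
    (hne : g 0 1 * g 1 0 ≠ h 0 1 * h 1 0) : ∃ t : F, t ≠ 0 ∧ slu t ∈ H := by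
  obtain ⟨s, hs⟩ := hsq
  have hs0 : s ≠ 0 := by
    rintro rfl
    rw [mul_zero] at hs
    exact (mul_ne_zero (mul_ne_zero g10 g11) (mul_ne_zero h10 h11)) hs
  set l := s / (h 1 0 * h 1 1) with hl
  have hl0 : l ≠ 0 := by rw [hl]; exact div_ne_zero hs0 (mul_ne_zero h10 h11)
  have hll : g 1 0 * g 1 1 = l * l * (h 1 0 * h 1 1) := by
    rw [hl]; field_simp; linear_combination hs
  set m := g 1 0 / (l * h 1 0) with hm
  have hm0 : m ≠ 0 := by rw [hm]; exact div_ne_zero g10 (mul_ne_zero hl0 h10)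
  have e10 : g 1 0 = l * m * h 1 0 := by rw [hm]; field_simp
  have e11 : m * g 1 1 = l * h 1 1 := by
    apply mul_left_cancel₀ (mul_ne_zero hl0 h10)
    linear_combination hll - g 1 1 * e10
  have dg := sl_det g
  have dh := sl_det h
  set k := sld l⁻¹ (inv_ne_zero hl0) * h * sld m hm0 with hk
  have k00 : k 0 0 = m / l * h 0 0 := by
    simp only [hk, sl_mul, sld, slm00, slm01, slm10, slm11]; field_simp; ring
  have k01 : k 0 1 = h 0 1 / (l * m) := by
    simp only [hk, sl_mul, sld, slm00, slm01, slm10, slm11]; field_simp; ring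
  have k10 : k 1 0 = g 1 0 := by
    rw [e10]; simp only [hk, sl_mul, sld, slm00, slm01, slm10, slm11]; field_simp; ring
  have k11 : k 1 1 = g 1 1 := by
    have : g 1 1 = l * h 1 1 / m := by field_simp; linear_combination e11
    rw [this]; simp only [hk, sl_mul, sld, slm00, slm01, slm10, slm11]; field_simp; ring
  have hkH : k ∈ H := H.mul_mem (H.mul_mem (hD _ _) hh) (hD _ _)
  have dk := sl_det k
  have hkk : k 0 1 * k 1 0 = h 0 1 * h 1 0 := by
    rw [k01, k10, e10]; field_simp
  clear_value k
  refine ⟨(g * k⁻¹) 0 1, ?_, ?_⟩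
  · simp only [sl_mul, sl_inv01, sl_inv11]
    intro h0
    apply hne
    rw [← hkk]
    rw [k10] at dk ⊢
    rw [k11] at dk
    have hk0 : g 0 1 - k 0 1 = 0 := by
      linear_combination g 1 1 * h0 - g 0 1 * dk + k 0 1 * dg
    linear_combination g 1 0 * hk0
  · have : slu ((g * k⁻¹) 0 1) = g * k⁻¹ := by
      apply sl_ext
      · simp only [slu, slm00, sl_mul, sl_inv00, sl_inv10, k10, k11]; linear_combination -dg
      · simp only [slu, slm01]
      · simp only [slu, slm10, sl_mul, sl_inv00, sl_inv10, k10, k11]; ring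
      · simp only [slu, slm11, sl_mul, sl_inv01, sl_inv11]
        rw [k10, k11] at dk
        linear_combination -dk
    rw [this]
    exact H.mul_mem hg (H.inv_mem hkH)

theorem split_top (H : Subgroup (SL2 F)) (hD : ∀ (r : F) (hr : r ≠ 0), sld r hr ∈ H)
    (hq : 14 ≤ Fintype.card F) (h2 : (2 : F) ≠ 0) (hm : ∀ m : F, 1 + m * m ≠ 0)
    (x : SL2 F) (hx : x ∈ H) (hx0 : slt x = 0) (ha : x 0 0 ≠ 0) : H = ⊤ := by
  have hd := sl_det x
  have h11 : x 1 1 = - x 0 0 := by rw [slt] at hx0; linear_combination hx0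
  rw [h11] at hd
  have hc : x 1 0 ≠ 0 := by
    intro h; apply hm (x 0 0); rw [h] at hd; linear_combination -hd
  have hb : x 0 1 ≠ 0 := by
    intro h; apply hm (x 0 0); rw [h] at hd; linear_combination -hd
  obtain ⟨r, hr, hrr⟩ := exists_three (x 0 0) hq (hm _)
  let X : Fin 3 → SL2 F := fun i => x * sld (r i) (hr i).1 * x⁻¹
  have hX : ∀ i, X i ∈ H := fun i => H.mul_mem (H.mul_mem hx (hD _ _)) (H.inv_mem hx)
  have X01 : ∀ i, X i 0 1 = x 0 0 * x 0 1 * ((r i)⁻¹ - r i) := by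
    intro i
    simp only [X, sl_mul, sld, slm00, slm01, slm10, slm11, sl_inv00, sl_inv01, sl_inv10, sl_inv11,
      h11]
    ring
  have X10 : ∀ i, X i 1 0 = x 0 0 * x 1 0 * ((r i)⁻¹ - r i) := by
    intro i
    simp only [X, sl_mul, sld, slm00, slm01, slm10, slm11, sl_inv00, sl_inv01, sl_inv10, sl_inv11,
      h11]
    ring
  have X11 : ∀ i, X i 1 1 = (1 + x 0 0 * x 0 0) * r i - x 0 0 * x 0 0 * (r i)⁻¹ := by
    intro i
    simp only [X, sl_mul, sld, slm00, slm01, slm10, slm11, sl_inv00, sl_inv01, sl_inv10, sl_inv11,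
      h11]
    linear_combination r i * hd
  have hs : ∀ i, (r i)⁻¹ - r i ≠ 0 := by
    intro i h
    apply (hr i).2.1
    have := mul_inv_cancel₀ (hr i).1
    linear_combination this - r i * h
  have n10 : ∀ i, X i 1 0 ≠ 0 := fun i => by
    rw [X10]; exact mul_ne_zero (mul_ne_zero ha hc) (hs i)
  have n11 : ∀ i, X i 1 1 ≠ 0 := fun i => by
    rw [X11]; intro h
    apply (hr i).2.2
    have := mul_inv_cancel₀ (hr i).1
    linear_combination r i * h + x 0 0 * x 0 0 * this
  have nne : ∀ i j, i ≠ j → X i 0 1 * X i 1 0 ≠ X j 0 1 * X j 1 0 := by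
    intro i j hij h
    rw [X01, X01, X10, X10] at h
    have hne := hrr i j hij
    have h' : ((r i)⁻¹ - r i) * ((r i)⁻¹ - r i) = ((r j)⁻¹ - r j) * ((r j)⁻¹ - r j) := by
      apply mul_left_cancel₀ (mul_ne_zero (mul_ne_zero ha hb) (mul_ne_zero ha hc))
      linear_combination h
    have hi0 := (hr i).1
    have hj0 := (hr j).1
    field_simp at h'
    have h3 : (r i * r i - r j * r j) * ((r i * r i) * (r j * r j) - 1) = 0 := by
      linear_combination h'
    rcases mul_eq_zero.1 h3 with h4 | h4
    · exact hne.1 (sub_eq_zero.1 h4)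
    · exact hne.2 (sub_eq_zero.1 h4)
  have hex : ∃ t : F, t ≠ 0 ∧ slu t ∈ H := by
    rcases same_class h2 _ _ _ (mul_ne_zero (n10 0) (n11 0)) (mul_ne_zero (n10 1) (n11 1))
      (mul_ne_zero (n10 2) (n11 2)) with h | h | h
    · exact unip_of_pair H hD _ _ (hX _) (hX _) (n10 _) (n11 _) (n10 _) (n11 _) h
        (nne _ _ (by decide))
    · exact unip_of_pair H hD _ _ (hX _) (hX _) (n10 _) (n11 _) (n10 _) (n11 _) h
        (nne _ _ (by decide))
    · exact unip_of_pair H hD _ _ (hX _) (hX _) (n10 _) (n11 _) (n10 _) (n11 _) h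
        (nne _ _ (by decide))
  obtain ⟨t, ht, htH⟩ := hex
  exact top_of_weyl H (sq_spread H (fun a ha g hg => H.mul_mem (H.mul_mem (hD _ _) hg)
    (H.inv_mem (hD _ _))) t ht htH) x hx hc

end split

section split2
variable [Fintype F] [DecidableEq F]

theorem Y_card_ge' (τ : F) : Fintype.card F * (Fintype.card F - 1) ≤
    (Finset.univ.filter (fun y : SL2 F => slt y = τ ∧ y 0 1 ≠ 0)).card := by
  have hc : ((Finset.univ : Finset F) ×ˢ (Finset.univ.erase (0 : F))).card =
      Fintype.card F * (Fintype.card F - 1) := by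
    rw [Finset.card_product, Finset.card_erase_of_mem (Finset.mem_univ _), Finset.card_univ]
  rw [← hc]
  let f : F × F → SL2 F := fun p => if h : p.2 ≠ 0 then
    slm p.1 p.2 ((p.1 * (τ - p.1) - 1) / p.2) (τ - p.1) (by field_simp; ring) else 1
  apply Finset.card_le_card_of_injOn f
  · rintro ⟨a, b⟩ h
    have hb : b ≠ 0 := by simpa using h
    rw [Finset.mem_coe, Finset.mem_filter]
    refine ⟨Finset.mem_univ _, ?_, ?_⟩
    · simp only [f, hb, ne_eq, not_false_eq_true, dif_pos, slt, slm00, slm11]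
      ring
    · simp only [f, hb, ne_eq, not_false_eq_true, dif_pos, slm01]
  · rintro ⟨a, b⟩ h ⟨a', b'⟩ h' he
    have hb : b ≠ 0 := by simpa using h
    have hb' : b' ≠ 0 := by simpa using h'
    simp only [f, hb, hb', ne_eq, not_false_eq_true, dif_pos] at he
    have e0 := congrArg (fun g : SL2 F => g 0 0) he
    have e1 := congrArg (fun g : SL2 F => g 0 1) he
    simp only [slm00, slm01] at e0 e1
    rw [e0, e1]

theorem diag_conj (y : SL2 F) (z : F) (hz : z ≠ 0) (hz2 : z⁻¹ - z ≠ 0) (hy : slt y = z + z⁻¹)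
    (hb : y 0 1 ≠ 0) : ∃ P : SL2 F, P * y * P⁻¹ = sld z hz := by
  have hd := sl_det y
  have h11 : y 1 1 = z + z⁻¹ - y 0 0 := by rw [slt] at hy; linear_combination hy
  have hzz : z * z⁻¹ = 1 := mul_inv_cancel₀ hz
  obtain ⟨w, hw⟩ : ∃ w, w = z⁻¹ := ⟨_, rfl⟩
  rw [← hw] at hz2 h11 hzz
  obtain ⟨e, he⟩ : ∃ e, e * (y 0 1 * (w - z)) = 1 := ⟨_, inv_mul_cancel₀ (mul_ne_zero hb hz2)⟩
  have hQ : y 0 1 * e * (w - y 0 0) - y 0 1 * ((z - y 0 0) * e) = 1 := by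
    linear_combination he
  have key : y * slm _ _ _ _ hQ = slm _ _ _ _ hQ * sld z hz := by
    apply sl_ext <;> simp only [sl_mul, sld, slm00, slm01, slm10, slm11, ← hw, h11]
    · ring
    · ring
    · rw [h11] at hd
      linear_combination (-e) * hd + e * hzz
    · rw [h11] at hd
      linear_combination (-1) * hd + hzz
  refine ⟨(slm _ _ _ _ hQ)⁻¹, ?_⟩
  rw [inv_inv, mul_assoc, key, inv_mul_cancel_left]

theorem split_spread (hq : 14 ≤ Fintype.card F) (he : Fintype.card F % 4 = 3)
    {k : ℕ} (hk : k = Fintype.card F - 3)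
    (x : Fin k → SL2 F) (hx : ∀ i, x i ∉ Subgroup.center (SL2 F)) (hx0 : ∀ i, slt (x i) = 0) :
    ∃ y : SL2 F, ∀ i, ∀ H : Subgroup (SL2 F), x i ∈ H → y ∈ H → H = ⊤ := by
  classical
  obtain ⟨h2, hm⟩ := three_facts (F := F) he
  obtain ⟨ζ, hζ⟩ := IsCyclic.exists_generator (α := Fˣ)
  have hord : orderOf ζ = Fintype.card F - 1 := by
    rw [orderOf_eq_card_of_forall_mem_zpowers hζ, Nat.card_eq_fintype_card, Fintype.card_units]
  set z : F := (ζ : F) with hz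
  have hz0 : z ≠ 0 := ζ.ne_zero
  have hz2 : z⁻¹ - z ≠ 0 := by
    intro h
    have h1 : z ^ 2 = 1 := by
      have := mul_inv_cancel₀ hz0
      linear_combination this - z * h
    have h3 : ζ ^ 2 = 1 := by
      apply Units.ext
      rw [Units.val_pow_eq_pow_val, Units.val_one]
      exact h1
    have := Nat.le_of_dvd (by norm_num) (orderOf_dvd_of_pow_eq_one h3)
    omega
  obtain ⟨y, hy, hyb, hyx⟩ : ∃ y : SL2 F, slt y = z + z⁻¹ ∧ y 0 1 ≠ 0 ∧
      ∀ i, slt (x i * y) ≠ 0 := by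
    by_contra hcon
    push Not at hcon
    have hsub : (Finset.univ.filter (fun y : SL2 F => slt y = z + z⁻¹ ∧ y 0 1 ≠ 0)) ⊆
        Finset.univ.biUnion (fun i => Finset.univ.filter
          (fun y : SL2 F => slt y = z + z⁻¹ ∧ slt (x i * y) = 0)) := by
      intro y hy
      have hy' := (Finset.mem_filter.1 hy).2
      obtain ⟨i, hi⟩ := hcon y hy'.1 hy'.2
      exact Finset.mem_biUnion.2 ⟨i, Finset.mem_univ _, Finset.mem_filter.2
        ⟨Finset.mem_univ _, hy'.1, hi⟩⟩
    have h1 := Finset.card_le_card hsub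
    have h3 := Finset.card_biUnion_le (s := Finset.univ) (t := fun i => Finset.univ.filter
          (fun y : SL2 F => slt y = z + z⁻¹ ∧ slt (x i * y) = 0))
    have h4 := Finset.sum_le_card_nsmul Finset.univ (fun i => (Finset.univ.filter
          (fun y : SL2 F => slt y = z + z⁻¹ ∧ slt (x i * y) = 0)).card) (Fintype.card F + 1)
          (fun i _ => (bad2_card _ (x i) (hx i) (hx0 i)).trans (circle_card3 h2 hm))
    have h5 := Y_card_ge' (z + z⁻¹)
    have h6 := h5.trans (h1.trans (h3.trans h4))
    rw [Finset.card_univ, Fintype.card_fin, hk, smul_eq_mul] at h6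
    obtain ⟨n, hn⟩ : ∃ n, Fintype.card F = n + 3 := ⟨Fintype.card F - 3, by omega⟩
    rw [hn] at h6
    have e1 : n + 3 - 3 = n := by omega
    have e2 : n + 3 - 1 = n + 2 := by omega
    rw [e1, e2] at h6
    nlinarith
  obtain ⟨P, hP⟩ := diag_conj y z hz0 hz2 hy hyb
  refine ⟨y, ?_⟩
  intro i H hxH hyH
  have hmem : ∀ g ∈ H, P * g * P⁻¹ ∈ H.map (MulAut.conj P).toMonoidHom := fun g hg =>
    ⟨g, hg, by simp⟩
  have htop : H.map (MulAut.conj P).toMonoidHom = ⊤ := by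
    apply split_top _ _ hq h2 hm (P * x i * P⁻¹) (hmem _ hxH)
    · rw [slt_conj, hx0]
    · intro h0
      apply hyx i
      have e : slt (x i * y) = slt ((P * x i * P⁻¹) * sld z hz0) := by
        rw [← hP]
        have : (P * x i * P⁻¹) * (P * y * P⁻¹) = P * (x i * y) * P⁻¹ := by group
        rw [this, slt_conj]
      have e2 : slt (P * x i * P⁻¹) = 0 := by rw [slt_conj, hx0]
      rw [e]
      generalize P * x i * P⁻¹ = X at *
      simp only [slt] at e2 ⊢
      have h11 : X 1 1 = 0 := by linear_combination e2 - h0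
      simp only [sl_mul, sld, slm00, slm01, slm10, slm11, h0, h11]
      ring
    · intro r hr
      obtain ⟨n, hn⟩ := Subgroup.mem_zpowers_iff.1 (hζ (Units.mk0 r hr))
      have hzm : sld z hz0 ∈ H.map (MulAut.conj P).toMonoidHom := by
        rw [← hP]; exact hmem _ hyH
      let φ : Fˣ →* SL2 F :=
        { toFun := fun u => sld (u : F) u.ne_zero
          map_one' := by apply sl_ext <;> simp [sld, slm00, slm01, slm10, slm11]
          map_mul' := fun a b => by
            apply sl_ext <;> simp only [sl_mul, sld, slm00, slm01, slm10, slm11, Units.val_mul] <;>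
              field_simp <;> ring }
      have e1 : sld r hr = φ (Units.mk0 r hr) := rfl
      have e2 : sld z hz0 = φ ζ := rfl
      rw [e1, ← hn, map_zpow, ← e2]
      exact Subgroup.zpow_mem _ hzm n
  rw [eq_top_iff]
  intro g _
  have : P * g * P⁻¹ ∈ H.map (MulAut.conj P).toMonoidHom := by rw [htop]; trivial
  obtain ⟨g', hg', e⟩ := this
  have e' : P * g' * P⁻¹ = P * g * P⁻¹ := by simpa using e
  have : g' = g := by simpa using e'
  rw [← this]; exact hg'

theorem eleven_spread (hq : Fintype.card F = 11)
    {k : ℕ} (x : Fin k → SL2 F) (hx0 : ∀ i, slt (x i) = 0) :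
    ∃ y : SL2 F, ∀ i, ∀ H : Subgroup (SL2 F), x i ∈ H → y ∈ H → H = ⊤ := by
  obtain ⟨h2, hm⟩ := three_facts (F := F) (by rw [hq])
  refine ⟨slu 1, ?_⟩
  intro i H hxH hyH
  let A : AddSubgroup F :=
    { carrier := {t | slu t ∈ H}
      add_mem' := fun {a b} ha hb => by
        have ha' : slu a ∈ H := ha
        have hb' : slu b ∈ H := hb
        change slu (a + b) ∈ H
        rw [← slu_mul]; exact H.mul_mem ha' hb'
      zero_mem' := by
        change slu 0 ∈ H
        have : slu (0 : F) = 1 := by apply sl_ext <;> simp [slu, slm00, slm01, slm10, slm11]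
        rw [this]; exact H.one_mem
      neg_mem' := fun {a} ha => by
        have ha' : slu a ∈ H := ha
        change slu (-a) ∈ H
        have : slu (-a) = (slu a)⁻¹ := by
          rw [eq_inv_iff_mul_eq_one, slu_mul]
          apply sl_ext <;> simp [slu, slm00, slm01, slm10, slm11]
        rw [this]; exact H.inv_mem ha' }
  have hu : ∀ t, slu t ∈ H := by
    intro t
    haveI : Fact (Nat.Prime 11) := ⟨by norm_num⟩
    have h1 : t ∈ AddSubgroup.zmultiples (1 : F) :=
      mem_zmultiples_of_prime_card (p := 11) (by rw [Nat.card_eq_fintype_card, hq]) one_ne_zero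
    have h2 : AddSubgroup.zmultiples (1 : F) ≤ A := by
      rw [AddSubgroup.zmultiples_le]; exact hyH
    exact h2 h1
  apply top_of_weyl H hu (x i) hxH
  intro h
  have hd := sl_det (x i)
  have h0 := hx0 i
  rw [slt] at h0
  apply hm (x i 0 0)
  linear_combination x i 0 0 * h0 - hd - x i 0 1 * h

theorem lower_three_spread (hq : 11 ≤ Fintype.card F) (he : Fintype.card F % 4 = 3) :
    SpreadAtLeast (PSL2 F) (Fintype.card F - 3) := by
  intro x hx
  obtain ⟨x', hx', hxx⟩ := psl_lift x hx
  simp only [hxx]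
  by_cases hall : ∀ i, slt (x' i) = 0
  · have : ∃ y : SL2 F, ∀ i, ∀ H : Subgroup (SL2 F), x' i ∈ H → y ∈ H → H = ⊤ := by
      by_cases h14 : 14 ≤ Fintype.card F
      · exact split_spread h14 he rfl x' hx' hall
      · exact eleven_spread (by omega) x' hall
    obtain ⟨y, hy⟩ := this
    exact ⟨(y : PSL2 F), fun i => psl_gen _ _ (hy i)⟩
  · push Not at hall
    obtain ⟨j, hj⟩ := hall
    exact lower_three_mixed hq he x' hx' j hj

end split2

theorem dihedral_comm {G : Type*} [Group G] (x y : G) (hx : x * x = 1) (hxy : x * y * (x * y) = 1)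
    (htop : Subgroup.closure {x, y} = ⊤) (g h : G) (hg : g * g ≠ 1) (hh : h * h ≠ 1) :
    g * h = h * g := by
  have hxi : x⁻¹ = x := inv_eq_of_mul_eq_one_left hx
  have hc : ∀ n : ℤ, x * y ^ n = y ^ (-n) * x := by
    intro n
    have h1 : x * y * x⁻¹ = y⁻¹ := by
      rw [hxi]
      apply eq_inv_of_mul_eq_one_left
      rw [← hxy]; group
    have h2 : x * y ^ n * x⁻¹ = y ^ (-n) := by
      rw [← conj_zpow, h1, _root_.inv_zpow, _root_.zpow_neg]
    rw [← h2]; group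
  have key : ∀ g : G, (∃ n : ℤ, g = y ^ n) ∨ ∃ n : ℤ, g = y ^ n * x := by
    intro g
    have hgm : g ∈ Subgroup.closure {x, y} := by rw [htop]; trivial
    induction hgm using Subgroup.closure_induction with
    | mem a ha =>
      rcases ha with rfl | ha
      · exact Or.inr ⟨0, by simp⟩
      · rw [Set.mem_singleton_iff] at ha
        exact Or.inl ⟨1, by simp [ha]⟩
    | one => exact Or.inl ⟨0, by simp⟩
    | mul a b _ _ iha ihb =>
      rcases iha with ⟨m, rfl⟩ | ⟨m, rfl⟩ <;> rcases ihb with ⟨n, rfl⟩ | ⟨n, rfl⟩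
      · exact Or.inl ⟨m + n, by rw [_root_.zpow_add]⟩
      · exact Or.inr ⟨m + n, by rw [_root_.zpow_add, mul_assoc]⟩
      · exact Or.inr ⟨m + -n, by rw [_root_.zpow_add, mul_assoc, mul_assoc, hc]⟩
      · refine Or.inl ⟨m + -n, ?_⟩
        rw [_root_.zpow_add, mul_assoc, ← mul_assoc x, hc, mul_assoc, hx, mul_one]
    | inv a _ iha =>
      rcases iha with ⟨m, rfl⟩ | ⟨m, rfl⟩
      · exact Or.inl ⟨-m, by rw [_root_.zpow_neg]⟩
      · refine Or.inr ⟨m, ?_⟩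
        rw [_root_.mul_inv_rev, hxi, ← _root_.zpow_neg, hc, neg_neg]
  have kk : ∀ g : G, g * g ≠ 1 → ∃ n : ℤ, g = y ^ n := by
    intro g hg
    rcases key g with h | ⟨n, rfl⟩
    · exact h
    · exfalso
      apply hg
      rw [mul_assoc, ← mul_assoc x, hc, mul_assoc, hx, mul_one, ← _root_.zpow_add, add_neg_cancel,
        _root_.zpow_zero]
  obtain ⟨m, rfl⟩ := kk g hg
  obtain ⟨n, rfl⟩ := kk h hh
  rw [← _root_.zpow_add, ← _root_.zpow_add, add_comm]

theorem psl_one_iff (g : SL2 F) : (g : PSL2 F) = 1 ↔ g ∈ Subgroup.center (SL2 F) :=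
  QuotientGroup.eq_one_iff _

theorem psl_sq_of_slt (g : SL2 F) (h : slt g = 0) : (g : PSL2 F) * (g : PSL2 F) = 1 := by
  rw [← QuotientGroup.mk_mul, psl_one_iff, sl_center]
  rw [slt] at h
  have h1 : g 1 1 = - g 0 0 := by linear_combination h
  simp only [sl_mul, h1]
  refine ⟨?_, ?_, ?_⟩ <;> ring

section
variable [Fintype F]

theorem psl_not_dihedral (hq : 11 ≤ Fintype.card F) (x y : PSL2 F) (hx : x * x = 1)
    (hxy : x * y * (x * y) = 1) : Subgroup.closure {x, y} ≠ ⊤ := by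
  intro htop
  obtain ⟨t, ht0, ht⟩ : ∃ t : F, t ≠ 0 ∧ t ^ 4 ≠ 1 := by
    classical
    by_contra hcon
    push Not at hcon
    have hsub : (Finset.univ : Finset F) ⊆ insert 0 (Polynomial.nthRoots 4 (1 : F)).toFinset := by
      intro t _
      rw [Finset.mem_insert, Multiset.mem_toFinset, Polynomial.mem_nthRoots (by norm_num)]
      by_cases h : t = 0
      · exact Or.inl h
      · exact Or.inr (hcon t h)
    have h1 := Finset.card_le_card hsub
    have h2 := Finset.card_insert_le (0 : F) (Polynomial.nthRoots 4 (1 : F)).toFinset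
    have h3 := Multiset.toFinset_card_le (Polynomial.nthRoots 4 (1 : F))
    have h4 := Polynomial.card_nthRoots 4 (1 : F)
    rw [Finset.card_univ] at h1
    omega
  have hi : t * t⁻¹ = 1 := mul_inv_cancel₀ ht0
  obtain ⟨w, hw⟩ : ∃ w, w = t⁻¹ := ⟨_, rfl⟩
  rw [← hw] at hi
  have hA : t * w - 0 * 0 = 1 := by linear_combination hi
  have hB : t * w - 1 * 0 = 1 := by linear_combination hi
  have hne : t * t ≠ w * w := by
    intro h
    apply ht
    linear_combination t ^ 2 * h + (t * w + 1) * hi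
  have hc := dihedral_comm x y hx hxy htop ((slm t 0 0 w hA : SL2 F) : PSL2 F)
    ((slm t 1 0 w hB : SL2 F) : PSL2 F) ?_ ?_
  · rw [← QuotientGroup.mk_mul, ← QuotientGroup.mk_mul, QuotientGroup.eq, sl_center] at hc
    have h2 := hc.1
    simp only [sl_mul, sl_inv00, sl_inv01, sl_inv10, sl_inv11, slm00, slm01, slm10, slm11] at h2
    have h4 : w ≠ 0 := by rintro rfl; simp at hi
    have h5 : w * w * (t - w) = 0 := by linear_combination (-1) * h2
    have h6 : t = w := by
      rcases mul_eq_zero.1 h5 with h | h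
      · exact absurd (mul_self_eq_zero.1 h) h4
      · exact sub_eq_zero.1 h
    exact hne (by rw [h6])
  · rw [← QuotientGroup.mk_mul, Ne, psl_one_iff, sl_center]
    simp only [sl_mul, slm00, slm01, slm10, slm11]
    rintro ⟨_, _, h⟩
    apply hne
    linear_combination h
  · rw [← QuotientGroup.mk_mul, Ne, psl_one_iff, sl_center]
    simp only [sl_mul, slm00, slm01, slm10, slm11]
    rintro ⟨_, _, h⟩
    apply hne
    linear_combination h

theorem psl_borel (x y : SL2 F) (hx : x 1 0 = 0) (hy : y 1 0 = 0) :
    Subgroup.closure {(x : PSL2 F), (y : PSL2 F)} ≠ ⊤ := by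
  intro htop
  have key : ∀ g : PSL2 F, g ∈ Subgroup.closure {(x : PSL2 F), (y : PSL2 F)} →
      ∃ h : SL2 F, h 1 0 = 0 ∧ g = (h : PSL2 F) := by
    intro g hg
    induction hg using Subgroup.closure_induction with
    | mem a ha =>
      rcases ha with rfl | ha
      · exact ⟨x, hx, rfl⟩
      · exact ⟨y, hy, ha⟩
    | one => exact ⟨1, by simp, rfl⟩
    | mul a b _ _ iha ihb =>
      obtain ⟨h, h1, rfl⟩ := iha
      obtain ⟨k, k1, rfl⟩ := ihb
      exact ⟨h * k, by rw [sl_mul, h1, k1]; ring, rfl⟩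
    | inv a _ iha =>
      obtain ⟨h, h1, rfl⟩ := iha
      exact ⟨h⁻¹, by rw [sl_inv10, h1, neg_zero], rfl⟩
  obtain ⟨h, h1, h2⟩ := key ((sll 1 : SL2 F) : PSL2 F) (by rw [htop]; trivial)
  rw [QuotientGroup.eq, sl_center] at h2
  have h3 := h2.2.1
  have h4 := sl_det h
  simp only [sl_mul, sl_inv00, sl_inv01, sl_inv10, sl_inv11, sll, slm00, slm01, slm10, slm11, h1]
    at h2 h4
  obtain ⟨a, b, c⟩ := h2
  have h5 : h 0 0 = 0 := by linear_combination (-1) * b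
  rw [h5] at h4
  simp at h4

theorem upper_even (hq : 11 ≤ Fintype.card F) (he : Fintype.card F % 2 = 0) :
    ¬ SpreadAtLeast (PSL2 F) (Fintype.card F - 1) := by
  classical
  intro hS
  have h2 : (2 : F) = 0 := two_zero_iff.2 he
  have hcard : Fintype.card Fˣ = Fintype.card F - 1 := Fintype.card_units F
  let e : Fin (Fintype.card F - 1) ≃ Fˣ := (finCongr hcard.symm).trans (Fintype.equivFin Fˣ).symm
  obtain ⟨y, hy⟩ := hS (fun i => ((slu ((e i : Fˣ) : F) : SL2 F) : PSL2 F)) (by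
    intro i
    rw [Ne, psl_one_iff, sl_center]
    rintro ⟨h, _, _⟩
    exact (e i).ne_zero h)
  obtain ⟨y, rfl⟩ := QuotientGroup.mk_surjective y
  have hy' : ∀ t : F, t ≠ 0 →
      Subgroup.closure {((slu t : SL2 F) : PSL2 F), (y : PSL2 F)} = ⊤ := by
    intro t ht
    have := hy (e.symm (Units.mk0 t ht))
    simpa using this
  have hinv : ∀ t : F, slt (slu t) = 0 := by
    intro t
    simp only [slt, slu, slm00, slm11]
    linear_combination h2
  by_cases hc : y 1 0 = 0
  · exact psl_borel (slu 1) y rfl hc (hy' 1 one_ne_zero)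
  · by_cases h0 : slt y = 0
    · have h1 := hy' 1 one_ne_zero
      have hxx := psl_sq_of_slt _ (hinv 1)
      have hyy := psl_sq_of_slt _ h0
      refine psl_not_dihedral hq (((slu 1 : SL2 F) : PSL2 F))
        (((slu 1 : SL2 F) : PSL2 F) * (y : PSL2 F)) hxx ?_ ?_
      · have e1 : ((slu 1 : SL2 F) : PSL2 F) * (((slu 1 : SL2 F) : PSL2 F) * (y : PSL2 F)) =
            (y : PSL2 F) := by
          rw [← mul_assoc, hxx, one_mul]
        rw [e1, hyy]
      · rw [eq_top_iff, ← h1, Subgroup.closure_le]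
        rintro a (rfl | ha)
        · exact Subgroup.subset_closure (by simp)
        · rw [Set.mem_singleton_iff] at ha
          subst ha
          exact (Subgroup.mul_mem_cancel_left _ (Subgroup.subset_closure (by simp))).1
            (Subgroup.subset_closure (Set.mem_insert_of_mem _ (Set.mem_singleton _)))
    · obtain ⟨t, ht⟩ : ∃ t, t * y 1 0 = - slt y := ⟨_, div_mul_cancel₀ _ hc⟩
      have ht0 : t ≠ 0 := by
        rintro rfl
        apply h0
        rw [zero_mul] at ht
        exact neg_eq_zero.1 ht.symm
      refine psl_not_dihedral hq _ _ (psl_sq_of_slt _ (hinv t)) ?_ (hy' t ht0)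
      rw [← QuotientGroup.mk_mul]
      apply psl_sq_of_slt
      simp only [slt] at ht
      simp only [slt, sl_mul, slu, slm00, slm01, slm10, slm11]
      linear_combination ht

theorem upper_one (hq : 11 ≤ Fintype.card F) (he : Fintype.card F % 4 = 1) :
    ¬ SpreadAtLeast (PSL2 F) (Fintype.card F) := by
  classical
  intro hS
  have h2 : (2 : F) ≠ 0 := by
    intro h
    have := two_zero_iff.1 h
    omega
  obtain ⟨i, hi⟩ : ∃ i : F, i * i = -1 := by
    obtain ⟨i, hi⟩ := (FiniteField.isSquare_neg_one_iff (F := F)).2 (by omega)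
    exact ⟨i, hi.symm⟩
  have hi0 : i ≠ 0 := by
    rintro rfl
    simp at hi
  have hdet : ∀ t : F, i * (-i) - t * 0 = 1 := by
    intro t
    linear_combination (-1) * hi
  let e : Fin (Fintype.card F) ≃ F := (Fintype.equivFin F).symm
  obtain ⟨y, hy⟩ := hS (fun j => ((slm i (e j) 0 (-i) (hdet (e j)) : SL2 F) : PSL2 F)) (by
    intro j
    rw [Ne, psl_one_iff, sl_center]
    simp only [slm00, slm01, slm10, slm11]
    rintro ⟨_, _, h⟩
    have : 2 * i = 0 := by linear_combination h
    rcases mul_eq_zero.1 this with h | h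
    · exact h2 h
    · exact hi0 h)
  obtain ⟨y, rfl⟩ := QuotientGroup.mk_surjective y
  have hy' : ∀ t : F,
      Subgroup.closure {((slm i t 0 (-i) (hdet t) : SL2 F) : PSL2 F), (y : PSL2 F)} = ⊤ := by
    intro t
    have := hy (e.symm t)
    simpa using this
  by_cases hc : y 1 0 = 0
  · exact psl_borel _ y rfl hc (hy' 1)
  · obtain ⟨t, ht⟩ : ∃ t, t * y 1 0 = - (i * y 0 0 - i * y 1 1) := ⟨_, div_mul_cancel₀ _ hc⟩
    refine psl_not_dihedral hq _ _ (psl_sq_of_slt _ ?_) ?_ (hy' t)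
    · simp only [slt, slm00, slm11]
      ring
    · rw [← QuotientGroup.mk_mul]
      apply psl_sq_of_slt
      simp only [slt, sl_mul, slm00, slm01, slm10, slm11]
      linear_combination ht

end

end PSLHelpers

/-- Burness–Harper: the spread and uniform spread of `PSL₂(q)` for `q ≥ 11`:
if `q` is even both equal `q - 2`; if `q ≡ 1 (mod 4)` both equal `q - 1`;
if `q ≡ 3 (mod 4)` the spread is at least `q - 3` and the uniform spread is at
least `q - 4`. -/
theorem spread_uniformSpread_psl2 (F : Type*) [Field F] [Fintype F] (q : ℕ)
    (hq : Fintype.card F = q) (hq11 : 11 ≤ q) :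
    (Even q →
      UniformSpreadAtLeast
        (Matrix.SpecialLinearGroup (Fin 2) F ⧸
          Subgroup.center (Matrix.SpecialLinearGroup (Fin 2) F)) (q - 2) ∧
      SpreadAtLeast
        (Matrix.SpecialLinearGroup (Fin 2) F ⧸
          Subgroup.center (Matrix.SpecialLinearGroup (Fin 2) F)) (q - 2) ∧
      ¬ UniformSpreadAtLeast
        (Matrix.SpecialLinearGroup (Fin 2) F ⧸
          Subgroup.center (Matrix.SpecialLinearGroup (Fin 2) F)) (q - 1) ∧
      ¬ SpreadAtLeast
        (Matrix.SpecialLinearGroup (Fin 2) F ⧸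
          Subgroup.center (Matrix.SpecialLinearGroup (Fin 2) F)) (q - 1)) ∧
    (q % 4 = 1 →
      UniformSpreadAtLeast
        (Matrix.SpecialLinearGroup (Fin 2) F ⧸
          Subgroup.center (Matrix.SpecialLinearGroup (Fin 2) F)) (q - 1) ∧
      SpreadAtLeast
        (Matrix.SpecialLinearGroup (Fin 2) F ⧸
          Subgroup.center (Matrix.SpecialLinearGroup (Fin 2) F)) (q - 1) ∧
      ¬ UniformSpreadAtLeast
        (Matrix.SpecialLinearGroup (Fin 2) F ⧸
          Subgroup.center (Matrix.SpecialLinearGroup (Fin 2) F)) q ∧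
      ¬ SpreadAtLeast
        (Matrix.SpecialLinearGroup (Fin 2) F ⧸
          Subgroup.center (Matrix.SpecialLinearGroup (Fin 2) F)) q) ∧
    (q % 4 = 3 →
      SpreadAtLeast
        (Matrix.SpecialLinearGroup (Fin 2) F ⧸
          Subgroup.center (Matrix.SpecialLinearGroup (Fin 2) F)) (q - 3) ∧
      UniformSpreadAtLeast
        (Matrix.SpecialLinearGroup (Fin 2) F ⧸
          Subgroup.center (Matrix.SpecialLinearGroup (Fin 2) F)) (q - 4)) := by
  classical
  subst hq
  refine ⟨fun he => ?_, fun he => ?_, fun he => ?_⟩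
  · have he' := Nat.even_iff.1 he
    have h1 := lower_even (F := F) hq11 he'
    have h2 := upper_even (F := F) hq11 he'
    exact ⟨h1, spread_of_uniform h1, fun h => h2 (spread_of_uniform h), h2⟩
  · have h1 := lower_one (F := F) hq11 he
    have h2 := upper_one (F := F) hq11 he
    exact ⟨h1, spread_of_uniform h1, fun h => h2 (spread_of_uniform h), h2⟩
  · exact ⟨lower_three_spread (F := F) hq11 he, lower_three_unif (F := F) hq11 he⟩
end
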